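/- Let n ≥ 2, let l be a nonzero integer, and let μ be a continuous, translation invariant valuation on ℂⁿ satisfying μ(gK) = (det g)^l μ(K) for all g ∈ U(n) and all convex bodies K. Then for all convex bodies K, L ⊆ ℂⁿ: ∫_{SU(n)} ∫_{ℂⁿ} μ̃(K ∩ (gL + x)) dx dg = μ(K)·vol(L) + vol(K)·μ(L). -/

import Mathlib

open MeasureTheory
open scoped ENNReal

noncomputable section

/-- `ℂⁿ`, regarded as a real inner product space via `Re⟨z,w⟫`. -/
abbrev Cn (n : ℕ) := EuclideanSpace ℂ (Fin n)

/-- `μ` is a valuation: it is finitely additive on convex bodies of `ℂⁿ`. -/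
def IsValuation {n : ℕ} (μ : ConvexBody (Cn n) → ℂ) : Prop :=
  ∀ K L U I : ConvexBody (Cn n),
    (U : Set (Cn n)) = (K : Set (Cn n)) ∪ (L : Set (Cn n)) →
    (I : Set (Cn n)) = (K : Set (Cn n)) ∩ (L : Set (Cn n)) →
    μ U + μ I = μ K + μ L

/-- `μ` is translation invariant. -/
def TranslationInvariant {n : ℕ} (μ : ConvexBody (Cn n) → ℂ) : Prop :=
  ∀ (x : Cn n) (K L : ConvexBody (Cn n)),
    (L : Set (Cn n)) = (fun y => x + y) '' (K : Set (Cn n)) → μ L = μ K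

/-- `μ` has weight `l` : `μ (g K) = (det g)^l • μ K` for all `g ∈ U(n)`. -/
def HasWeight {n : ℕ} (l : ℤ) (μ : ConvexBody (Cn n) → ℂ) : Prop :=
  ∀ g ∈ Matrix.unitaryGroup (Fin n) ℂ, ∀ K L : ConvexBody (Cn n),
    (L : Set (Cn n)) = (Matrix.toEuclideanLin g) '' (K : Set (Cn n)) →
    μ L = (Matrix.det g) ^ l * μ K

instance (n : ℕ) : MeasurableSpace (Cn n) := borel _
instance (n : ℕ) : BorelSpace (Cn n) := ⟨rfl⟩

/-- The special unitary group `SU(n)`, as a subgroup of the unitary group. -/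
def SUgrp (n : ℕ) : Subgroup ↥(Matrix.unitaryGroup (Fin n) ℂ) where
  carrier := {g | Matrix.det (g : Matrix (Fin n) (Fin n) ℂ) = 1}
  one_mem' := by simp
  mul_mem' := by
    intro a b ha hb
    simp only [Set.mem_setOf_eq, Matrix.UnitaryGroup.mul_val, Matrix.det_mul] at *
    rw [ha, hb, mul_one]
  inv_mem' := by
    intro a ha
    simp only [Set.mem_setOf_eq, Matrix.UnitaryGroup.inv_val] at *
    rw [Matrix.star_eq_conjTranspose, Matrix.det_conjTranspose, ha, star_one]

instance (n : ℕ) : MeasurableSpace ↥(Matrix.unitaryGroup (Fin n) ℂ) := borel _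
instance (n : ℕ) : MeasurableSpace ↥(SUgrp n) := borel _

/-- The action of a unitary matrix on `ℂⁿ`. -/
def actU {n : ℕ} (g : ↥(Matrix.unitaryGroup (Fin n) ℂ)) : Cn n → Cn n :=
  Matrix.toEuclideanLin (g : Matrix (Fin n) (Fin n) ℂ)

/-- The action of an element of `SU(n)` on `ℂⁿ`. -/
def actSU {n : ℕ} (g : ↥(SUgrp n)) : Cn n → Cn n :=
  actU (g : ↥(Matrix.unitaryGroup (Fin n) ℂ))

open Classical in
/-- The extension of `μ` by `0` to arbitrary subsets of `ℂⁿ` : `μ̃ S = μ S` if `S` is a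
convex body and `μ̃ S = 0` otherwise (in particular `μ̃ ∅ = 0`). -/
def extendVal {n : ℕ} (μ : ConvexBody (Cn n) → ℂ) (S : Set (Cn n)) : ℂ :=
  if h : Convex ℝ S ∧ IsCompact S ∧ S.Nonempty then μ ⟨S, h.1, h.2.1, h.2.2⟩ else 0

/-- The Lebesgue volume of a convex body of `ℂⁿ`, as a complex number. -/
def volC {n : ℕ} (K : ConvexBody (Cn n)) : ℂ := ((volume (K : Set (Cn n))).toReal : ℂ)

section

open Metric Set Filter Topology
open scoped Pointwise

section Basics

variable {E : Type*} [NormedAddCommGroup E] [InnerProductSpace ℝ E]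

open Classical in
/-- The extension of a functional on convex bodies by zero to arbitrary sets. -/
def eVal (μ : ConvexBody E → ℂ) (S : Set E) : ℂ :=
  if h : Convex ℝ S ∧ IsCompact S ∧ S.Nonempty then μ ⟨S, h.1, h.2.1, h.2.2⟩ else 0

/-- Continuous translation invariant valuations. -/
structure TVal (μ : ConvexBody E → ℂ) : Prop where
  val : ∀ K L U I : ConvexBody E, (U : Set E) = (K : Set E) ∪ (L : Set E) →
    (I : Set E) = (K : Set E) ∩ (L : Set E) → μ U + μ I = μ K + μ L
  cont : Continuous μ
  trans : ∀ (x : E) (K L : ConvexBody E),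
    (L : Set E) = (fun y => x + y) '' (K : Set E) → μ L = μ K

@[simp] theorem eVal_coe (μ : ConvexBody E → ℂ) (K : ConvexBody E) : eVal μ (K : Set E) = μ K := by
  unfold eVal
  rw [dif_pos ⟨K.convex, K.isCompact, K.nonempty⟩]
  rfl

@[simp] theorem eVal_empty (μ : ConvexBody E → ℂ) : eVal μ ∅ = 0 := by
  simp [eVal]

theorem eVal_of (μ : ConvexBody E → ℂ) {S : Set E} (h1 : Convex ℝ S) (h2 : IsCompact S)
    (h3 : S.Nonempty) : eVal μ S = μ ⟨S, h1, h2, h3⟩ :=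
  eVal_coe μ ⟨S, h1, h2, h3⟩

theorem exists_mem_inter_of_union_convex {F : Type*} [NormedAddCommGroup F] [NormedSpace ℝ F]
    {S T : Set F} (hS : IsClosed S) (hT : IsClosed T) (h : Convex ℝ (S ∪ T)) {a b : F}
    (ha : a ∈ S) (hb : b ∈ T) : ∃ c ∈ segment ℝ a b, c ∈ S ∩ T := by
  have hp : IsPreconnected (segment ℝ a b) := (convex_segment a b).isPreconnected
  rw [isPreconnected_closed_iff] at hp
  obtain ⟨c, hc, hc'⟩ := hp S T hS hT (h.segment_subset (Or.inl ha) (Or.inr hb))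
    ⟨a, left_mem_segment ℝ a b, ha⟩ ⟨b, right_mem_segment ℝ a b, hb⟩
  exact ⟨c, hc, hc'⟩

theorem image_inter_of_union_convex {F : Type*} [NormedAddCommGroup F] [NormedSpace ℝ F]
    (A : F →L[ℝ] E) {S T : Set F} (hS : IsClosed S) (hT : IsClosed T)
    (h : Convex ℝ (S ∪ T)) : A '' (S ∩ T) = A '' S ∩ A '' T := by
  refine Subset.antisymm (image_inter_subset _ _ _) ?_
  rintro _ ⟨⟨a, ha, rfl⟩, b, hb, hab⟩
  obtain ⟨c, hc, hc'⟩ := exists_mem_inter_of_union_convex hS hT h ha hb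
  refine ⟨c, hc', ?_⟩
  obtain ⟨s, t, hs, ht, hst, rfl⟩ := hc
  simp only [map_add, map_smul, hab]
  rw [← add_smul, hst, one_smul]

theorem TVal.eVal_image_union {μ : ConvexBody E → ℂ} (hμ : TVal μ)
    {F : Type*} [NormedAddCommGroup F] [NormedSpace ℝ F]
    (A : F →L[ℝ] E) {S T : Set F} (hS : IsCompact S) (hT : IsCompact T)
    (hS' : Convex ℝ S) (hT' : Convex ℝ T) (h : Convex ℝ (S ∪ T)) :
    eVal μ (A '' (S ∪ T)) + eVal μ (A '' (S ∩ T)) = eVal μ (A '' S) + eVal μ (A '' T) := by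
  rcases S.eq_empty_or_nonempty with rfl | hSn
  · simp
  rcases T.eq_empty_or_nonempty with rfl | hTn
  · simp
  obtain ⟨a, ha⟩ := hSn
  obtain ⟨b, hb⟩ := hTn
  obtain ⟨c, hc, hc'⟩ := exists_mem_inter_of_union_convex hS.isClosed hT.isClosed h ha hb
  have aux : ∀ R : Set F, IsCompact R → Convex ℝ R → ∀ x ∈ R,
      ∃ K : ConvexBody E, (K : Set E) = A '' R := fun R h1 h2 x hx =>
    ⟨⟨A '' R, h2.linear_image A.toLinearMap, h1.image A.continuous, ⟨A x, x, hx, rfl⟩⟩, rfl⟩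
  obtain ⟨K, hK⟩ := aux S hS hS' a ha
  obtain ⟨L, hL⟩ := aux T hT hT' b hb
  obtain ⟨U, hU⟩ := aux (S ∪ T) (hS.union hT) h a (Or.inl ha)
  obtain ⟨I, hI⟩ := aux (S ∩ T) (hS.inter hT) (hS'.inter hT') c hc'
  rw [← hK, ← hL, ← hU, ← hI]
  simp only [eVal_coe]
  apply hμ.val
  · rw [hU, hK, hL, image_union]
  · rw [hI, hK, hL, image_inter_of_union_convex A hS.isClosed hT.isClosed h]

theorem TVal.eVal_union {μ : ConvexBody E → ℂ} (hμ : TVal μ) {S T : Set E}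
    (hS : IsCompact S) (hT : IsCompact T)
    (hS' : Convex ℝ S) (hT' : Convex ℝ T) (h : Convex ℝ (S ∪ T)) :
    eVal μ (S ∪ T) + eVal μ (S ∩ T) = eVal μ S + eVal μ T := by
  simpa using hμ.eVal_image_union (ContinuousLinearMap.id ℝ E) hS hT hS' hT' h

/-- The image of a convex body under a continuous linear map. -/
def mapBody {F : Type*} [NormedAddCommGroup F] [NormedSpace ℝ F] (A : F →L[ℝ] E)
    (K : ConvexBody F) : ConvexBody E :=
  ⟨A '' K, K.convex.linear_image A.toLinearMap, K.isCompact.image A.continuous,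
    K.nonempty.image A⟩

@[simp] theorem coe_mapBody {F : Type*} [NormedAddCommGroup F] [NormedSpace ℝ F] (A : F →L[ℝ] E)
    (K : ConvexBody F) : (mapBody A K : Set E) = A '' K := rfl

/-- The translate of a convex body. -/
def transBody (x : E) (K : ConvexBody E) : ConvexBody E :=
  ⟨(fun y => x + y) '' (K : Set E), by
    simpa using K.convex.translate x, K.isCompact.image (by fun_prop), K.nonempty.image _⟩

@[simp] theorem coe_transBody (x : E) (K : ConvexBody E) :
    (transBody x K : Set E) = (fun y => x + y) '' (K : Set E) := rfl

theorem TVal.transBody {μ : ConvexBody E → ℂ} (hμ : TVal μ) (x : E) (K : ConvexBody E) :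
    μ (transBody x K) = μ K := hμ.trans x K _ rfl

theorem TVal.eVal_translate {μ : ConvexBody E → ℂ} (hμ : TVal μ) (x : E) (S : Set E) :
    eVal μ ((fun y => x + y) '' S) = eVal μ S := by
  by_cases h : Convex ℝ S ∧ IsCompact S ∧ S.Nonempty
  · have := hμ.transBody x ⟨S, h.1, h.2.1, h.2.2⟩
    rw [← eVal_coe μ, ← eVal_coe μ] at this
    exact this
  · have h' : ¬ (Convex ℝ ((fun y => x + y) '' S) ∧ IsCompact ((fun y => x + y) '' S) ∧
        ((fun y => x + y) '' S).Nonempty) := by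
      rintro ⟨h1, h2, h3⟩
      have e : S = (fun y => -x + y) '' ((fun y => x + y) '' S) := by
        rw [image_image]; simp
      refine h ⟨?_, ?_, h3.of_image⟩
      · rw [e]; simpa using h1.translate (-x)
      · rw [e]; exact h2.image (by fun_prop)
    rw [eVal, eVal, dif_neg h, dif_neg h']

theorem ConvexBody.exists_near (K L : ConvexBody E) {x : E} (hx : x ∈ K) :
    ∃ y ∈ L, dist x y ≤ dist K L := by
  obtain ⟨y, hy, h⟩ := L.isCompact.exists_infDist_eq_dist L.nonempty x
  refine ⟨y, hy, ?_⟩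
  rw [← h, ← ConvexBody.hausdorffDist_coe]
  exact infDist_le_hausdorffDist_of_mem hx ConvexBody.hausdorffEDist_ne_top

theorem ConvexBody.dist_le_of {K L : ConvexBody E} {r : ℝ} (hr : 0 ≤ r)
    (h1 : ∀ x ∈ K, ∃ y ∈ L, dist x y ≤ r) (h2 : ∀ x ∈ L, ∃ y ∈ K, dist x y ≤ r) :
    dist K L ≤ r := by
  rw [← ConvexBody.hausdorffDist_coe]
  exact hausdorffDist_le_of_mem_dist hr h1 h2

theorem ConvexBody.exists_bound (K : ConvexBody E) : ∃ R : ℝ, 0 < R ∧ (K : Set E) ⊆ closedBall 0 R := by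
  obtain ⟨R, hR⟩ := K.isBounded.subset_closedBall 0
  exact ⟨max R 1, by positivity, hR.trans (closedBall_subset_closedBall (le_max_left _ _))⟩

/-- A convex body as a nonempty compact set. -/
def ConvexBody.toNC (K : ConvexBody E) : TopologicalSpace.NonemptyCompacts E :=
  ⟨⟨K, K.isCompact⟩, K.nonempty⟩

theorem ConvexBody.isometry_toNC : Isometry (ConvexBody.toNC (E := E)) := by
  refine Isometry.of_dist_eq fun K L => ?_
  rw [Metric.NonemptyCompacts.dist_eq, ← ConvexBody.hausdorffDist_coe]
  rfl

theorem isClosed_convex_nonemptyCompacts :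
    IsClosed {A : TopologicalSpace.NonemptyCompacts E | Convex ℝ (A : Set E)} := by
  rw [← closure_subset_iff_isClosed]
  intro A hA x hx y hy a b ha hb hab
  rw [Metric.mem_closure_iff] at hA
  have hfin : ∀ B C : TopologicalSpace.NonemptyCompacts E,
      hausdorffEDist (B : Set E) C ≠ ⊤ := fun B C =>
    hausdorffEDist_ne_top_of_nonempty_of_bounded B.nonempty C.nonempty
      B.isCompact.isBounded C.isCompact.isBounded
  change a • x + b • y ∈ (A : Set E)
  rw [← A.isCompact.isClosed.closure_eq, Metric.mem_closure_iff]
  intro ε hε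
  obtain ⟨B, hB, hd⟩ := hA (ε / 2) (by positivity)
  rw [Metric.NonemptyCompacts.dist_eq] at hd
  obtain ⟨x', hx', h1⟩ := exists_dist_lt_of_hausdorffDist_lt hx hd (hfin _ _)
  obtain ⟨y', hy', h2⟩ := exists_dist_lt_of_hausdorffDist_lt hy hd (hfin _ _)
  obtain ⟨z, hz, h3⟩ := exists_dist_lt_of_hausdorffDist_lt' (hB hx' hy' ha hb hab) hd (hfin _ _)
  refine ⟨z, hz, ?_⟩
  have h4 : dist (a • x + b • y) (a • x' + b • y') ≤ ε / 2 := by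
    rw [dist_eq_norm] at *
    calc ‖a • x + b • y - (a • x' + b • y')‖ = ‖a • (x - x') + b • (y - y')‖ := by
          congr 1; module
      _ ≤ ‖a • (x - x')‖ + ‖b • (y - y')‖ := norm_add_le _ _
      _ = a * ‖x - x'‖ + b * ‖y - y'‖ := by
          rw [norm_smul, norm_smul, Real.norm_of_nonneg ha, Real.norm_of_nonneg hb]
      _ ≤ a * (ε / 2) + b * (ε / 2) := by
          gcongr
      _ = ε / 2 := by rw [← add_mul, hab, one_mul]
  calc dist (a • x + b • y) z ≤ _ + _ := dist_triangle _ (a • x' + b • y') _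
    _ < ε / 2 + ε / 2 := by
      refine add_lt_add_of_le_of_lt h4 ?_
      rwa [dist_comm]
    _ = ε := by ring

theorem ConvexBody.isClosedEmbedding_toNC : IsClosedEmbedding (ConvexBody.toNC (E := E)) := by
  refine ⟨ConvexBody.isometry_toNC.isEmbedding, ?_⟩
  convert isClosed_convex_nonemptyCompacts (E := E)
  ext A
  constructor
  · rintro ⟨K, rfl⟩
    exact K.convex
  · intro h
    exact ⟨⟨A, h, A.isCompact, A.nonempty⟩, rfl⟩

/-- Blaschke selection theorem. -/
theorem ConvexBody.isCompact_subsets {B : Set E} (hB : IsCompact B) :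
    IsCompact {K : ConvexBody E | (K : Set E) ⊆ B} :=
  ConvexBody.isClosedEmbedding_toNC.isCompact_preimage
    (TopologicalSpace.NonemptyCompacts.isCompact_subsets_of_isCompact hB)

theorem TVal.exists_bound [FiniteDimensional ℝ E] {μ : ConvexBody E → ℂ} (hμ : TVal μ) (R : ℝ) :
    ∃ M : ℝ, 0 ≤ M ∧ ∀ (x : E) (S : Set E), S ⊆ closedBall x R → ‖eVal μ S‖ ≤ M := by
  have hc := (ConvexBody.isCompact_subsets (isCompact_closedBall (0 : E) R))
  obtain ⟨M, hM⟩ := (hc.image hμ.cont).isBounded.exists_norm_le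
  refine ⟨max M 0, le_max_right _ _, fun x S hS => ?_⟩
  rw [← hμ.eVal_translate (-x) S]
  unfold eVal
  split_ifs with h
  · refine (hM _ ⟨_, ?_, rfl⟩).trans (le_max_left _ _)
    change (fun y => -x + y) '' S ⊆ closedBall 0 R
    rintro _ ⟨y, hy, rfl⟩
    have := hS hy
    rw [mem_closedBall, dist_eq_norm] at *
    simpa [sub_eq_add_neg, add_comm] using this
  · simp

end Basics

section PolyTools

open Polynomial

theorem Polynomial.exists_antidifference (p : ℂ[X]) :
    ∃ q : ℂ[X], ∀ s : ℕ, q.eval ((s + 1 : ℕ) : ℂ) - q.eval (s : ℂ) = p.eval (s : ℂ) := by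
  refine ⟨∑ k ∈ p.support, C (p.coeff k / ((k : ℂ) + 1)) *
    (Polynomial.bernoulli (k + 1)).map (algebraMap ℚ ℂ), fun s => ?_⟩
  rw [eval_finsetSum, eval_finsetSum, ← Finset.sum_sub_distrib, eval_eq_sum, Polynomial.sum]
  refine Finset.sum_congr rfl fun k _ => ?_
  have h : ∀ r : ℕ, ((Polynomial.bernoulli (k + 1)).map (algebraMap ℚ ℂ)).eval (r : ℂ) =
      (((Polynomial.bernoulli (k + 1)).eval (r : ℚ) : ℚ) : ℂ) := by
    intro r
    have : (r : ℂ) = algebraMap ℚ ℂ (r : ℚ) := by simp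
    rw [this, eval_map_algebraMap, aeval_algebraMap_apply]
    simp
  simp only [eval_mul, h, eval_C]
  have h2 := Polynomial.bernoulli_eval_one_add (k + 1) (s : ℚ)
  have h3 : (((s + 1 : ℕ) : ℚ)) = 1 + (s : ℚ) := by push_cast; ring
  rw [h3, h2]
  have h4 : ((k : ℂ) + 1) ≠ 0 := by exact_mod_cast Nat.succ_ne_zero k
  push_cast
  field_simp
  ring

/-- `f` agrees with a polynomial on all naturals `≥ N`. -/
def PolyFrom (N : ℕ) (f : ℕ → ℂ) : Prop :=
  ∃ p : ℂ[X], ∀ s : ℕ, N ≤ s → f s = p.eval (s : ℂ)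

theorem PolyFrom.antidifference {N : ℕ} {f : ℕ → ℂ}
    (h : PolyFrom N fun s => f (s + 1) - f s) : PolyFrom N f := by
  obtain ⟨p, hp⟩ := h
  obtain ⟨q, hq⟩ := p.exists_antidifference
  refine ⟨q + C (f N - q.eval (N : ℂ)), fun s hs => ?_⟩
  induction s, hs using Nat.le_induction with
  | base => simp
  | succ s hs ih =>
    have h1 := hp s hs
    have h2 := hq s
    simp only [eval_add, eval_C] at *
    linear_combination h1 + ih - h2

theorem PolyFrom.sub {N : ℕ} {f g : ℕ → ℂ} (hf : PolyFrom N f) (hg : PolyFrom N g) :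
    PolyFrom N fun s => f s - g s := by
  obtain ⟨p, hp⟩ := hf
  obtain ⟨q, hq⟩ := hg
  exact ⟨p - q, fun s hs => by simp only [hp s hs, hq s hs, eval_sub]⟩

theorem PolyFrom.shift {N : ℕ} {f : ℕ → ℂ} (hf : PolyFrom N f) :
    PolyFrom N fun s => f (s + 1) := by
  obtain ⟨p, hp⟩ := hf
  exact ⟨p.comp (X + 1), fun s hs => by
    change f (s + 1) = _
    rw [hp (s + 1) (by omega)]; simp⟩

theorem Polynomial.natDegree_le_of_growth (p : ℂ[X]) (d : ℕ) (B : ℝ)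
    (h : ∀ m : ℕ, 1 ≤ m → ‖p.eval (m : ℂ)‖ ≤ B * (m : ℝ) ^ d) : p.natDegree ≤ d := by
  have hm : (X ^ d : ℂ[X]).Monic := monic_X_pow d
  set q := p /ₘ X ^ d
  set r := p %ₘ X ^ d
  have hpq : r + X ^ d * q = p := modByMonic_add_div p (X ^ d)
  have hr : r.natDegree ≤ d := by
    have := natDegree_modByMonic_le p hm
    simpa using this
  have hrb : ∀ m : ℕ, 1 ≤ m → ‖r.eval (m : ℂ)‖ ≤
      (∑ k ∈ r.support, ‖r.coeff k‖) * (m : ℝ) ^ d := by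
    intro m hm1
    rw [eval_eq_sum, Polynomial.sum, Finset.sum_mul]
    refine (norm_sum_le _ _).trans (Finset.sum_le_sum fun k hk => ?_)
    rw [norm_mul, norm_pow, Complex.norm_natCast]
    gcongr
    · exact_mod_cast hm1
    · exact (le_natDegree_of_mem_supp k hk).trans hr
  have hq : q.degree ≤ 0 := by
    by_contra hq
    push Not at hq
    have ht := q.tendsto_norm_atTop hq (z := fun m : ℕ => (m : ℂ)) (l := atTop) (by
      simpa using tendsto_natCast_atTop_atTop (R := ℝ))
    obtain ⟨m, hm1, hm2⟩ := ((ht.eventually_gt_atTop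
      (B + ∑ k ∈ r.support, ‖r.coeff k‖)).and (eventually_ge_atTop 1)).exists
    have h1 : ‖(m : ℂ) ^ d * q.eval (m : ℂ)‖ ≤
        (B + ∑ k ∈ r.support, ‖r.coeff k‖) * (m : ℝ) ^ d := by
      have : (m : ℂ) ^ d * q.eval (m : ℂ) = p.eval (m : ℂ) - r.eval (m : ℂ) := by
        rw [← hpq]; simp
      rw [this, add_mul]
      exact (norm_sub_le _ _).trans (add_le_add (h m hm2) (hrb m hm2))
    rw [norm_mul, norm_pow, Complex.norm_natCast, mul_comm] at h1
    have : (0 : ℝ) < (m : ℝ) ^ d := by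
      have : (0 : ℝ) < m := by exact_mod_cast hm2
      positivity
    exact absurd (le_of_mul_le_mul_right h1 this) (not_le.mpr hm1)
  rw [← hpq]
  refine (natDegree_add_le _ _).trans (max_le hr ?_)
  refine natDegree_mul_le.trans ?_
  rw [natDegree_X_pow, natDegree_eq_zero_iff_degree_le_zero.mpr hq, add_zero]

theorem Polynomial.eq_of_eval_nat {p q : ℂ[X]} (N : ℕ)
    (h : ∀ m : ℕ, N ≤ m → p.eval (m : ℂ) = q.eval (m : ℂ)) : p = q := by
  refine eq_of_infinite_eval_eq p q ?_
  have : (fun m : ℕ => (m : ℂ)) '' Ici N ⊆ {x | p.eval x = q.eval x} := by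
    rintro _ ⟨m, hm, rfl⟩
    exact h m hm
  exact ((Set.Ici_infinite N).image (Nat.cast_injective.injOn)).mono this

end PolyTools

section BodyMetric

variable {E : Type*} [NormedAddCommGroup E] [InnerProductSpace ℝ E]
variable {F : Type*} [NormedAddCommGroup F] [InnerProductSpace ℝ F]

theorem ConvexBody.dist_add_le (K K' L L' : ConvexBody E) :
    dist (K + L) (K' + L') ≤ dist K K' + dist L L' := by
  have key : ∀ K K' L L' : ConvexBody E, ∀ x ∈ K + L, ∃ y ∈ K' + L',
      dist x y ≤ dist K K' + dist L L' := by
    intro K K' L L' x hx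
    obtain ⟨a, ha, b, hb, rfl⟩ : x ∈ (K : Set E) + (L : Set E) := by
      rw [← ConvexBody.coe_add]; exact hx
    obtain ⟨a', ha', h1⟩ := ConvexBody.exists_near K K' ha
    obtain ⟨b', hb', h2⟩ := ConvexBody.exists_near L L' hb
    refine ⟨a' + b', ?_, (dist_add_add_le _ _ _ _).trans (add_le_add h1 h2)⟩
    change a' + b' ∈ ((K' + L' : ConvexBody E) : Set E)
    rw [ConvexBody.coe_add]
    exact Set.add_mem_add ha' hb'
  refine ConvexBody.dist_le_of (by positivity) (key _ _ _ _) fun x hx => ?_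
  rw [dist_comm K, dist_comm L]
  exact key _ _ _ _ x hx

theorem ConvexBody.continuous_add {X : Type*} [TopologicalSpace X] {f g : X → ConvexBody E}
    (hf : Continuous f) (hg : Continuous g) : Continuous fun x => f x + g x := by
  have : LipschitzWith 2 fun p : ConvexBody E × ConvexBody E => p.1 + p.2 := by
    refine LipschitzWith.of_dist_le_mul fun p q => ?_
    refine (ConvexBody.dist_add_le _ _ _ _).trans ?_
    rw [Prod.dist_eq]
    have h1 := le_max_left (dist p.1 q.1) (dist p.2 q.2)
    have h2 := le_max_right (dist p.1 q.1) (dist p.2 q.2)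
    push_cast
    linarith
  exact this.continuous.comp (hf.prodMk hg)

theorem dist_mapBody_le (A : F →L[ℝ] E) (K L : ConvexBody F) :
    dist (mapBody A K) (mapBody A L) ≤ ‖A‖ * dist K L := by
  have key : ∀ K L : ConvexBody F, ∀ x ∈ mapBody A K, ∃ y ∈ mapBody A L,
      dist x y ≤ ‖A‖ * dist K L := by
    rintro K L _ ⟨a, ha, rfl⟩
    obtain ⟨b, hb, h⟩ := ConvexBody.exists_near K L ha
    exact ⟨A b, ⟨b, hb, rfl⟩, (A.dist_le_opNorm a b).trans (by gcongr)⟩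
  refine ConvexBody.dist_le_of (by positivity) (key _ _) fun x hx => ?_
  rw [dist_comm K]
  exact key _ _ x hx

theorem continuous_mapBody (A : F →L[ℝ] E) : Continuous (mapBody A) :=
  (LipschitzWith.of_dist_le_mul (K := ⟨‖A‖, norm_nonneg _⟩) fun K L =>
    dist_mapBody_le A K L).continuous

theorem dist_mapBody_le_of_subset (A B : F →L[ℝ] E) (K : ConvexBody F) {R : ℝ} (hR : 0 ≤ R)
    (hK : (K : Set F) ⊆ closedBall 0 R) :
    dist (mapBody A K) (mapBody B K) ≤ ‖A - B‖ * R := by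
  have key : ∀ A B : F →L[ℝ] E, ∀ x ∈ mapBody A K, ∃ y ∈ mapBody B K,
      dist x y ≤ ‖A - B‖ * R := by
    rintro A B _ ⟨a, ha, rfl⟩
    refine ⟨B a, ⟨a, ha, rfl⟩, ?_⟩
    rw [dist_eq_norm, ← _root_.sub_apply]
    refine ((A - B).le_opNorm a).trans ?_
    gcongr
    simpa using hK ha
  refine ConvexBody.dist_le_of (by positivity) (key _ _) fun x hx => ?_
  rw [← norm_neg, neg_sub]
  exact key _ _ x hx

theorem continuous_mapBody_left (K : ConvexBody F) :
    Continuous fun A : F →L[ℝ] E => mapBody A K := by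
  obtain ⟨R, hR, hK⟩ := K.exists_bound
  exact (LipschitzWith.of_dist_le_mul (K := ⟨R, hR.le⟩) fun A B => by
    rw [dist_eq_norm A B, mul_comm]
    exact dist_mapBody_le_of_subset A B K hR.le hK).continuous

theorem ConvexBody.smul_eq_mapBody (t : ℝ) (K : ConvexBody E) :
    t • K = mapBody (t • ContinuousLinearMap.id ℝ E) K := by
  apply ConvexBody.ext
  rw [ConvexBody.coe_smul, coe_mapBody]
  ext x
  simp [Set.mem_smul_set]

theorem ConvexBody.continuous_const_smul (t : ℝ) : Continuous fun K : ConvexBody E => t • K := by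
  simp_rw [ConvexBody.smul_eq_mapBody]
  exact continuous_mapBody _

theorem ConvexBody.continuous_smul_const (K : ConvexBody E) : Continuous fun t : ℝ => t • K := by
  simp_rw [ConvexBody.smul_eq_mapBody]
  exact (continuous_mapBody_left K).comp (by fun_prop)

theorem mapBody_comp {G : Type*} [NormedAddCommGroup G] [InnerProductSpace ℝ G]
    (A : F →L[ℝ] E) (B : G →L[ℝ] F) (K : ConvexBody G) :
    mapBody A (mapBody B K) = mapBody (A.comp B) K := by
  apply ConvexBody.ext
  simp only [coe_mapBody, image_image]
  rfl

theorem mapBody_id (K : ConvexBody E) : mapBody (ContinuousLinearMap.id ℝ E) K = K := by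
  apply ConvexBody.ext
  simp

theorem mapBody_add (A : F →L[ℝ] E) (K L : ConvexBody F) :
    mapBody A (K + L) = mapBody A K + mapBody A L := by
  apply ConvexBody.ext
  simp only [coe_mapBody, ConvexBody.coe_add]
  exact Set.image_add A

theorem mapBody_smul (A : F →L[ℝ] E) (t : ℝ) (K : ConvexBody F) :
    mapBody A (t • K) = t • mapBody A K := by
  rw [ConvexBody.smul_eq_mapBody, ConvexBody.smul_eq_mapBody, mapBody_comp, mapBody_comp]
  congr 1
  ext x
  simp

theorem ConvexBody.add_smul_of_nonneg {s t : ℝ} (hs : 0 ≤ s) (ht : 0 ≤ t) (K : ConvexBody E) :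
    (s + t) • K = s • K + t • K :=
  SetLike.ext' (by
    simp only [ConvexBody.coe_smul, ConvexBody.coe_add]
    exact Convex.add_smul K.convex hs ht)

end BodyMetric

section Polytopes

variable {E : Type*} [NormedAddCommGroup E] [InnerProductSpace ℝ E]
variable {ι : Type*} [Fintype ι]

/-- The part of the simplex `{t ≥ 0, ∑ t = s}` supported on `S` and bounded by one on `I`. -/
def cutSimplex (S I : Finset ι) (s : ℝ) : Set (ι → ℝ) :=
  {t | (∀ i, 0 ≤ t i) ∧ (∀ i ∉ S, t i = 0) ∧ (∀ i ∈ I, t i ≤ 1) ∧ ∑ i, t i = s}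

theorem convex_cutSimplex (S I : Finset ι) (s : ℝ) : Convex ℝ (cutSimplex S I s) := by
  rintro x ⟨h1, h2, h3, h4⟩ y ⟨k1, k2, k3, k4⟩ a b ha hb hab
  refine ⟨fun i => ?_, fun i hi => ?_, fun i hi => ?_, ?_⟩
  · have := h1 i
    have := k1 i
    simp only [Pi.add_apply, Pi.smul_apply, smul_eq_mul]
    positivity
  · simp [h2 i hi, k2 i hi]
  · simp only [Pi.add_apply, Pi.smul_apply, smul_eq_mul]
    nlinarith [h3 i hi, k3 i hi]
  · simp only [Pi.add_apply, Pi.smul_apply, smul_eq_mul, Finset.sum_add_distrib,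
      ← Finset.mul_sum, h4, k4]
    rw [← add_mul, hab, one_mul]

theorem isCompact_cutSimplex (S I : Finset ι) (s : ℝ) : IsCompact (cutSimplex S I s) := by
  refine IsCompact.of_isClosed_subset (isCompact_Icc (a := (0 : ι → ℝ)) (b := fun _ => s)) ?_ ?_
  · simp only [cutSimplex, Set.ofPred_and, Set.ofPred_forall]
    refine (isClosed_iInter fun i => isClosed_le (by fun_prop) (by fun_prop)).inter
      ((isClosed_iInter fun i => isClosed_iInter fun _ =>
        isClosed_eq (by fun_prop) (by fun_prop)).inter
      ((isClosed_iInter fun i => isClosed_iInter fun _ =>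
        isClosed_le (by fun_prop) (by fun_prop)).inter
        (isClosed_eq (by fun_prop) (by fun_prop))))
  · rintro t ⟨h1, -, -, h4⟩
    refine ⟨h1, fun i => ?_⟩
    change t i ≤ s
    rw [← h4]
    exact Finset.single_le_sum (f := t) (fun j _ => h1 j) (Finset.mem_univ i)

variable [DecidableEq ι]

theorem cutSimplex_step {S I : Finset ι} {i : ι} (hi : i ∈ S) (hI : i ∉ I) (s : ℝ) :
    cutSimplex S I (s + 1) = cutSimplex S (insert i I) (s + 1) ∪
      (fun t => Pi.single i 1 + t) '' cutSimplex S I s ∧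
    cutSimplex S (insert i I) (s + 1) ∩ (fun t => Pi.single i 1 + t) '' cutSimplex S I s =
      (fun t => Pi.single i 1 + t) '' cutSimplex (S.erase i) I s := by
  have hshift : ∀ (S' : Finset ι) (t : ι → ℝ), (i ∉ S' → t i = 1) → 1 ≤ t i → (∀ j, 0 ≤ t j) →
      (∀ j ∉ S', j ≠ i → t j = 0) → (∀ j ∈ I, t j ≤ 1) → ∑ j, t j = s + 1 →
      t ∈ (fun t => Pi.single i 1 + t) '' cutSimplex S' I s := by
    intro S' t h0 h1 h2 h3 h4 h5
    refine ⟨t - Pi.single i 1, ⟨fun j => ?_, fun j hj => ?_, fun j hj => ?_, ?_⟩, by simp⟩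
    · by_cases hj : j = i
      · subst hj; simpa using h1
      · simpa [hj] using h2 j
    · by_cases hji : j = i
      · subst hji; simp [h0 hj]
      · simpa [hji] using h3 j hj hji
    · have hji : j ≠ i := fun h => hI (h ▸ hj)
      simpa [hji] using h4 j hj
    · simp [h5]
  have hback : ∀ (S' : Finset ι) (t : ι → ℝ), t ∈ (fun t => Pi.single i 1 + t) '' cutSimplex S' I s →
      (i ∉ S' → t i = 1) ∧ 1 ≤ t i ∧ (∀ j, 0 ≤ t j) ∧
      (∀ j ∉ S', j ≠ i → t j = 0) ∧ (∀ j ∈ I, t j ≤ 1) ∧ ∑ j, t j = s + 1 := by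
    rintro S' _ ⟨u, ⟨h1, h2, h3, h4⟩, rfl⟩
    refine ⟨fun h => by simp [h2 i h], by simpa using h1 i, fun j => ?_, fun j hj hji => ?_,
      fun j hj => ?_, ?_⟩
    · by_cases hj : j = i
      · subst hj
        have := h1 j
        simp only [Pi.add_apply, Pi.single_eq_same]
        linarith
      · simpa [hj] using h1 j
    · simpa [hji] using h2 j hj
    · have hji : j ≠ i := fun h => hI (h ▸ hj)
      simpa [hji] using h3 j hj
    · simp [Finset.sum_add_distrib, h4, add_comm]
  constructor
  · ext t
    constructor
    · rintro ⟨h1, h2, h3, h4⟩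
      rcases le_total (t i) 1 with h | h
      · refine Or.inl ⟨h1, h2, fun j hj => ?_, h4⟩
        rcases Finset.mem_insert.mp hj with rfl | hj
        · exact h
        · exact h3 j hj
      · exact Or.inr (hshift S t (fun h => absurd hi h) h h1 (fun j hj _ => h2 j hj) h3 h4)
    · rintro (⟨h1, h2, h3, h4⟩ | h)
      · exact ⟨h1, h2, fun j hj => h3 j (Finset.mem_insert_of_mem hj), h4⟩
      · obtain ⟨-, -, h2, h3, h4, h5⟩ := hback S t h
        exact ⟨h2, fun j hj => h3 j hj (fun h => hj (h ▸ hi)), h4, h5⟩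
  · ext t
    constructor
    · rintro ⟨⟨h1, h2, h3, h4⟩, h⟩
      obtain ⟨-, k1, -, -, k4, -⟩ := hback S t h
      have hti : t i = 1 := le_antisymm (h3 i (Finset.mem_insert_self _ _)) k1
      refine hshift _ t (fun _ => hti) k1 h1 (fun j hj hji => h2 j fun h => hj ?_) k4 h4
      exact Finset.mem_erase.mpr ⟨hji, h⟩
    · intro h
      obtain ⟨k0, k1, k2, k3, k4, k5⟩ := hback _ t h
      have hti := k0 (Finset.notMem_erase i S)
      have k3' : ∀ j ∉ S, j ≠ i → t j = 0 := fun j hj hji =>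
        k3 j (fun h => hj (Finset.mem_of_mem_erase h)) hji
      refine ⟨⟨k2, fun j hj => k3' j hj fun h => hj (h ▸ hi), fun j hj => ?_, k5⟩,
        hshift S t (fun _ => hti) k1 k2 k3' k4 k5⟩
      rcases Finset.mem_insert.mp hj with rfl | hj
      · exact hti.le
      · exact k4 j hj

theorem TVal.polyFrom_cutSimplex {φ : ConvexBody E → ℂ} (hφ : TVal φ) (A : (ι → ℝ) →L[ℝ] E)
    (n : ℕ) : ∀ S I : Finset ι, I ⊆ S → 2 * S.card - I.card = n →
      PolyFrom (Fintype.card ι + 1) fun s => eVal φ (A '' cutSimplex S I s) := by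
  induction n using Nat.strong_induction_on with
  | _ n ih =>
    intro S I hIS hn
    by_cases hI : S ⊆ I
    · obtain rfl := Finset.Subset.antisymm hIS hI
      refine ⟨0, fun s hs => ?_⟩
      have : cutSimplex I I (s : ℝ) = ∅ := by
        rw [eq_empty_iff_forall_notMem]
        rintro t ⟨h1, h2, h3, h4⟩
        have h5 : ∑ i, t i ≤ ∑ i : ι, (1 : ℝ) := Finset.sum_le_sum fun i _ => by
          by_cases hi : i ∈ I
          · exact h3 i hi
          · rw [h2 i hi]; exact zero_le_one
        rw [h4] at h5
        simp only [Finset.sum_const, Finset.card_univ, nsmul_eq_mul, mul_one] at h5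
        have : s ≤ Fintype.card ι := by exact_mod_cast h5
        omega
      simp [this]
    · obtain ⟨i, hi, hiI⟩ := Finset.not_subset.mp hI
      have hIc := Finset.card_le_card hIS
      have hIlt : I.card < S.card := Finset.card_lt_card ⟨hIS, hI⟩
      have h1 := ih _ (by rw [Finset.card_insert_of_notMem hiI]; omega) S (insert i I)
        (Finset.insert_subset hi hIS) rfl
      have h2 := ih _ (by rw [Finset.card_erase_of_mem hi]; omega) (S.erase i) I
        (fun j hj => Finset.mem_erase.mpr ⟨fun h => hiI (h ▸ hj), hIS hj⟩) rfl
      apply PolyFrom.antidifference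
      convert h1.shift.sub h2 using 2 with s
      have himg : ∀ T : Set (ι → ℝ), eVal φ (A '' ((fun t => Pi.single i 1 + t) '' T)) =
          eVal φ (A '' T) := by
        intro T
        rw [← hφ.eVal_translate (A (Pi.single i 1)) (A '' T), image_image, image_image]
        simp only [map_add]
      obtain ⟨e1, e2⟩ := cutSimplex_step hi hiI (s : ℝ)
      have hcv : Convex ℝ ((fun t => Pi.single i 1 + t) '' cutSimplex S I (s : ℝ)) := by
        simpa using (convex_cutSimplex S I (s : ℝ)).translate (Pi.single i 1)
      have := hφ.eVal_image_union A (isCompact_cutSimplex S (insert i I) ((s : ℝ) + 1))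
        ((isCompact_cutSimplex S I (s : ℝ)).image (f := fun t => Pi.single i 1 + t)
          (by fun_prop)) (convex_cutSimplex _ _ _) hcv (e1 ▸ convex_cutSimplex _ _ _)
      rw [← e1, e2, himg, himg] at this
      push_cast
      linear_combination this

theorem TVal.exists_poly_polytope {φ : ConvexBody E → ℂ} (hφ : TVal φ) (P : ConvexBody E)
    (A : (ι → ℝ) →L[ℝ] E) (hP : (P : Set E) = A '' stdSimplex ℝ ι) :
    ∃ p : Polynomial ℂ, ∀ t : ℝ, 0 ≤ t → φ (t • P) = p.eval (t : ℂ) := by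
  set N := Fintype.card ι + 1
  have key : ∀ q : ℕ, PolyFrom N fun s => φ (((s : ℝ) * (q : ℝ)⁻¹) • P) := by
    intro q
    obtain ⟨p, hp⟩ := hφ.polyFrom_cutSimplex ((q : ℝ)⁻¹ • A) _ Finset.univ ∅
      (Finset.empty_subset _) rfl
    refine ⟨p, fun s hs => ?_⟩
    have hps := hp s hs
    beta_reduce at hps ⊢
    rw [← hps, ← eVal_coe φ, ConvexBody.coe_smul, hP]
    congr 1
    have hs0 : (0 : ℝ) < s := by exact_mod_cast (Nat.succ_pos _).trans_le hs
    have : cutSimplex (Finset.univ : Finset ι) ∅ (s : ℝ) = (s : ℝ) • stdSimplex ℝ ι := by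
      ext t
      rw [Set.mem_smul_set_iff_inv_smul_mem₀ hs0.ne']
      simp only [cutSimplex, stdSimplex, Set.mem_ofPred_eq, Pi.smul_apply, smul_eq_mul,
        ← Finset.mul_sum]
      constructor
      · rintro ⟨h1, -, -, h4⟩
        exact ⟨fun i => mul_nonneg (by positivity) (h1 i), by rw [h4, inv_mul_cancel₀ hs0.ne']⟩
      · rintro ⟨h1, h2⟩
        refine ⟨fun i => ?_, by simp, by simp, ?_⟩
        · have := h1 i
          rwa [mul_nonneg_iff_of_pos_left (by positivity)] at this
        · field_simp at h2
          exact h2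
    rw [this, ← Set.image_smul, ← Set.image_smul, image_image, image_image]
    refine image_congr fun x _ => ?_
    rw [_root_.smul_apply, map_smul, smul_smul, mul_comm]
  obtain ⟨p, hp⟩ := key 1
  have hq : ∀ q : ℕ, 1 ≤ q → ∀ s : ℕ, N ≤ s →
      φ (((s : ℝ) * (q : ℝ)⁻¹) • P) = p.eval ((s : ℂ) * (q : ℂ)⁻¹) := by
    intro q hq
    have hq0 : (q : ℝ) ≠ 0 := by positivity
    have hq0' : (q : ℂ) ≠ 0 := by exact_mod_cast hq0
    obtain ⟨r, hr⟩ := key q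
    have hrp : r.comp (Polynomial.C (q : ℂ) * Polynomial.X) = p := by
      refine Polynomial.eq_of_eval_nat N fun m hm => ?_
      have h1 := hr (m * q) (hm.trans (Nat.le_mul_of_pos_right m hq))
      have h2 := hp m hm
      simp only [Polynomial.eval_comp, Polynomial.eval_mul, Polynomial.eval_C, Polynomial.eval_X]
      push_cast at h1 h2
      rw [← h2, mul_comm, ← h1]
      congr 2
      field_simp
    intro s hs
    have hrs := hr s hs
    beta_reduce at hrs
    rw [hrs, ← hrp]
    simp only [Polynomial.eval_comp, Polynomial.eval_mul, Polynomial.eval_C, Polynomial.eval_X]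
    congr 1
    field_simp
  have hrat : ∀ a q : ℕ, 1 ≤ a → 1 ≤ q →
      φ (((a : ℝ) * (q : ℝ)⁻¹) • P) = p.eval ((a : ℂ) * (q : ℂ)⁻¹) := by
    intro a q ha hq1
    have h := hq (N * q) (Nat.mul_pos (Nat.succ_pos _) hq1) (N * a) (Nat.le_mul_of_pos_right N ha)
    have hN : (N : ℝ) ≠ 0 := by positivity
    have hq0 : (q : ℝ) ≠ 0 := by positivity
    have hN' : (N : ℂ) ≠ 0 := by exact_mod_cast hN
    have hq0' : (q : ℂ) ≠ 0 := by exact_mod_cast hq0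
    convert h using 2
    · congr 1
      push_cast
      field_simp
    · push_cast
      field_simp
  refine ⟨p, fun t ht => ?_⟩
  have hclosed : IsClosed {t : ℝ | φ (t • P) = p.eval (t : ℂ)} :=
    isClosed_eq (hφ.cont.comp (ConvexBody.continuous_smul_const P))
      (p.continuous.comp Complex.continuous_ofReal)
  have hmem : t ∈ closure {t : ℝ | φ (t • P) = p.eval (t : ℂ)} := by
    rw [Metric.mem_closure_iff]
    intro ε hε
    obtain ⟨r, h1, h2⟩ := exists_rat_btwn (show t < t + ε by linarith)
    refine ⟨r, ?_, by rw [dist_comm, Real.dist_eq, abs_of_pos] <;> linarith⟩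
    have hr0 : 0 < r := by exact_mod_cast ht.trans_lt h1
    have h := hrat r.num.toNat r.den (by have := Rat.num_pos.mpr hr0; omega) r.den_pos
    have hn : ((r.num.toNat : ℕ) : ℤ) = r.num := Int.toNat_of_nonneg (Rat.num_pos.mpr hr0).le
    have e1 : ((r.num.toNat : ℕ) : ℝ) * (r.den : ℝ)⁻¹ = (r : ℝ) := by
      rw [← Int.cast_natCast, hn, ← div_eq_mul_inv]
      exact_mod_cast Rat.num_div_den r
    have e2 : ((r.num.toNat : ℕ) : ℂ) * (r.den : ℂ)⁻¹ = ((r : ℝ) : ℂ) := by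
      rw [← e1]; push_cast; rfl
    rw [e1, e2] at h
    exact h
  rwa [hclosed.closure_eq] at hmem

end Polytopes

section Homogeneous

theorem Polynomial.natDegree_le_iff_degree_lt_succ (p : Polynomial ℂ) (n : ℕ) :
    p.natDegree ≤ n ↔ p.degree < ((n + 1 : ℕ) : WithBot ℕ) := by
  rw [Polynomial.natDegree_le_iff_coeff_eq_zero, Polynomial.degree_lt_iff_coeff_zero]
  rfl

variable {E : Type*} [NormedAddCommGroup E] [InnerProductSpace ℝ E]

theorem TVal.norm_eVal_le_of_slabs {φ : ConvexBody E → ℂ} (hφ : TVal φ) (f : E →L[ℝ] ℝ) (B : ℝ)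
    (k : ℕ) : ∀ (a : ℝ) (S : Set E), IsCompact S → Convex ℝ S →
      (∀ x ∈ S, a ≤ f x ∧ f x ≤ a + k) →
      (∀ S' ⊆ S, IsCompact S' → Convex ℝ S' → (∃ c, ∀ x ∈ S', c ≤ f x ∧ f x ≤ c + 1) →
        ‖eVal φ S'‖ ≤ B) → ‖eVal φ S‖ ≤ (2 * k + 1) * B := by
  induction k with
  | zero =>
    intro a S hS hS' h1 h2
    have := h2 S Subset.rfl hS hS' ⟨a, fun x hx => ⟨(h1 x hx).1, by
      have := (h1 x hx).2
      push_cast at this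
      linarith⟩⟩
    simpa using this
  | succ k ih =>
    intro a S hS hS' h1 h2
    have cle : IsClosed {x | f x ≤ a + k} := isClosed_le f.continuous continuous_const
    have cge : IsClosed {x | a + k ≤ f x} := isClosed_le continuous_const f.continuous
    have vle : Convex ℝ {x | f x ≤ a + k} := convex_halfSpace_le f.isBoundedLinearMap.toIsLinearMap _
    have vge : Convex ℝ {x | a + k ≤ f x} := convex_halfSpace_ge f.isBoundedLinearMap.toIsLinearMap _
    have e : S ∩ {x | f x ≤ a + k} ∪ S ∩ {x | a + k ≤ f x} = S := by
      rw [← inter_union_distrib_left, inter_eq_left]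
      intro x _
      exact le_total (f x) (a + k)
    have hu := hφ.eVal_union (hS.inter_right cle) (hS.inter_right cge) (hS'.inter vle)
      (hS'.inter vge) (by rw [e]; exact hS')
    rw [e] at hu
    have b1 := ih a _ (hS.inter_right cle) (hS'.inter vle)
      (fun x hx => ⟨(h1 x hx.1).1, hx.2⟩)
      (fun S' hS1 => h2 S' (hS1.trans inter_subset_left))
    have b2 := h2 (S ∩ {x | a + k ≤ f x}) inter_subset_left (hS.inter_right cge) (hS'.inter vge)
      ⟨a + k, fun x hx => ⟨hx.2, by have := (h1 x hx.1).2; push_cast at this; linarith⟩⟩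
    have b3 := h2 (S ∩ {x | f x ≤ a + k} ∩ (S ∩ {x | a + k ≤ f x}))
      (inter_subset_left.trans inter_subset_left) ((hS.inter_right cle).inter (hS.inter_right cge))
      ((hS'.inter vle).inter (hS'.inter vge))
      ⟨a + k, fun x hx => ⟨hx.2.2, by have : f x ≤ a + k := hx.1.2; linarith⟩⟩
    have : eVal φ S = eVal φ (S ∩ {x | f x ≤ a + k}) + eVal φ (S ∩ {x | a + k ≤ f x}) -
        eVal φ (S ∩ {x | f x ≤ a + k} ∩ (S ∩ {x | a + k ≤ f x})) := by
      linear_combination hu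
    rw [this]
    refine (norm_sub_le _ _).trans ((add_le_add (norm_add_le _ _) le_rfl).trans ?_)
    push_cast
    linarith

theorem ConvexBody.smul_subset_closedBall {K : ConvexBody E} {R : ℝ}
    (hK : (K : Set E) ⊆ closedBall 0 R) {t : ℝ} (ht : 0 ≤ t) :
    ((t • K : ConvexBody E) : Set E) ⊆ closedBall 0 (t * R) := by
  rw [ConvexBody.coe_smul]
  rintro _ ⟨x, hx, rfl⟩
  have h : ‖x‖ ≤ R := by simpa using hK hx
  simp only [mem_closedBall, dist_zero_right, norm_smul, Real.norm_of_nonneg ht]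
  gcongr

/-- A convex body spanned by finitely many points. -/
def IsVPolytope (P : ConvexBody E) : Prop :=
  ∃ s : Set E, s.Finite ∧ (P : Set E) = convexHull ℝ s

theorem ConvexBody.dense_isVPolytope : Dense {P : ConvexBody E | IsVPolytope P} := by
  intro K
  rw [Metric.mem_closure_iff]
  intro ε hε
  obtain ⟨s, hsK, hs, hcov⟩ := K.isCompact.finite_cover_balls (half_pos hε)
  have hne : s.Nonempty := by
    obtain ⟨x, hx⟩ := K.nonempty
    have := hcov hx
    simp only [mem_iUnion] at this
    obtain ⟨y, hy, -⟩ := this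
    exact ⟨y, hy⟩
  have hsub : convexHull ℝ s ⊆ K := convexHull_min hsK K.convex
  let P : ConvexBody E := ⟨convexHull ℝ s, convex_convexHull ℝ s, hs.isCompact_convexHull ℝ,
    hne.convexHull⟩
  refine ⟨P, ⟨s, hs, rfl⟩, lt_of_le_of_lt (ConvexBody.dist_le_of (half_pos hε).le
    (fun x hx => ?_) fun x hx => ⟨x, hsub hx, by simpa using (half_pos hε).le⟩) (half_lt_self hε)⟩
  have := hcov hx
  simp only [mem_iUnion] at this
  obtain ⟨y, hy, hxy⟩ := this
  exact ⟨y, subset_convexHull ℝ s hy, (mem_ball.mp hxy).le⟩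

open Module in
/-- The polynomial describing the dilates of a convex body. -/
def hpoly (φ : ConvexBody E → ℂ) (K : ConvexBody E) : Polynomial ℂ :=
  Lagrange.interpolate (Finset.range (finrank ℝ E + 1)) (fun m : ℕ => (m : ℂ))
    fun m => φ ((m : ℝ) • K)

open Module in
theorem natDegree_hpoly (φ : ConvexBody E → ℂ) (K : ConvexBody E) :
    (hpoly φ K).natDegree ≤ finrank ℝ E := by
  have := Lagrange.degree_interpolate_lt (s := Finset.range (finrank ℝ E + 1))
    (v := fun m : ℕ => (m : ℂ)) (fun m => φ ((m : ℝ) • K)) Nat.cast_injective.injOn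
  rw [Finset.card_range] at this
  exact (Polynomial.natDegree_le_iff_degree_lt_succ _ _).mpr this

open Module in
theorem hpoly_coeff (φ : ConvexBody E → ℂ) (K : ConvexBody E) (k : ℕ) :
    (hpoly φ K).coeff k = ∑ m ∈ Finset.range (finrank ℝ E + 1),
      φ ((m : ℝ) • K) * (Lagrange.basis (Finset.range (finrank ℝ E + 1))
        (fun m : ℕ => (m : ℂ)) m).coeff k := by
  rw [hpoly, Lagrange.interpolate_apply, Polynomial.finsetSum_coeff]
  simp only [Polynomial.coeff_C_mul]

theorem TVal.continuous_hpoly_coeff {φ : ConvexBody E → ℂ} (hφ : Continuous φ) (k : ℕ) :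
    Continuous fun K => (hpoly φ K).coeff k := by
  simp only [hpoly_coeff]
  exact continuous_finsetSum _ fun m _ =>
    (hφ.comp (ConvexBody.continuous_const_smul _)).mul continuous_const

open Module in
theorem eq_hpoly_of_eval (φ : ConvexBody E → ℂ) (K : ConvexBody E) (p : Polynomial ℂ)
    (hp : p.natDegree ≤ finrank ℝ E) (h : ∀ m : ℕ, φ ((m : ℝ) • K) = p.eval (m : ℂ)) :
    hpoly φ K = p := by
  rw [Lagrange.eq_interpolate (f := p) (s := Finset.range (finrank ℝ E + 1))
    (v := fun m : ℕ => (m : ℂ)) Nat.cast_injective.injOn]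
  · rw [hpoly]
    simp only [h]
  · rw [Finset.card_range]
    exact (Polynomial.natDegree_le_iff_degree_lt_succ _ _).mp hp

variable [FiniteDimensional ℝ E]

open Module in
theorem TVal.exists_norm_eVal_le_pow {φ : ConvexBody E → ℂ} (hφ : TVal φ) :
    ∃ M : ℝ, 0 ≤ M ∧ ∀ (N : ℕ) (S : Set E), IsCompact S → Convex ℝ S →
      S ⊆ closedBall 0 N → ‖eVal φ S‖ ≤ (4 * N + 1) ^ finrank ℝ E * M := by
  obtain ⟨M, hM, h⟩ := hφ.exists_bound (finrank ℝ E)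
  refine ⟨M, hM, fun N S hS hS' hSN => ?_⟩
  set b := stdOrthonormalBasis ℝ E
  have key : ∀ (n : ℕ) (J : Finset (Fin (finrank ℝ E))), Jᶜ.card = n → ∀ S ⊆ closedBall 0 (N : ℝ),
      IsCompact S → Convex ℝ S →
      (∀ i ∈ J, ∃ c, ∀ x ∈ S, c ≤ inner ℝ (b i) x ∧ inner ℝ (b i) x ≤ c + 1) →
      ‖eVal φ S‖ ≤ (4 * N + 1) ^ n * M := by
    intro n
    induction n with
    | zero =>
      intro J hJ S hSN hS hS' hc
      have hJ' : ∀ i, i ∈ J := by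
        intro i
        rw [Finset.card_eq_zero] at hJ
        by_contra hi
        exact absurd (Finset.mem_compl.mpr hi) (by simp [hJ])
      rw [pow_zero, one_mul]
      rcases S.eq_empty_or_nonempty with rfl | ⟨x, hx⟩
      · simpa using hM
      refine h x S fun y hy => ?_
      rw [mem_closedBall, dist_eq_norm, ← b.sum_repr' (y - x)]
      refine (norm_sum_le _ _).trans ?_
      refine (Finset.sum_le_sum (g := fun _ => (1 : ℝ)) fun i _ => ?_).trans (by simp)
      rw [norm_smul, b.norm_eq_one, mul_one, inner_sub_right, Real.norm_eq_abs, abs_le]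
      obtain ⟨c, hc⟩ := hc i (hJ' i)
      have h1 := hc x hx
      have h2 := hc y hy
      constructor <;> linarith
    | succ n ih =>
      intro J hJ S hSN hS hS' hc
      obtain ⟨i, hi⟩ : Jᶜ.Nonempty := by
        rw [← Finset.card_pos, hJ]; omega
      have := hφ.norm_eVal_le_of_slabs (innerSL ℝ (b i)) ((4 * N + 1) ^ n * M)
        (2 * N) (-N) S hS hS' (fun x hx => ?_) (fun S' hS1 hS2 hS3 hc' => ?_)
      · refine this.trans (le_of_eq ?_)
        push_cast
        ring
      · rw [innerSL_apply_apply]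
        have h1 : ‖x‖ ≤ N := by simpa using hSN hx
        have h2 := abs_real_inner_le_norm (b i) x
        rw [b.norm_eq_one, one_mul, abs_le] at h2
        push_cast
        constructor <;> linarith
      · refine ih (insert i J) ?_ S' (hS1.trans hSN) hS2 hS3 fun j hj => ?_
        · rw [Finset.compl_insert, Finset.card_erase_of_mem hi, hJ]
          rfl
        · rcases Finset.mem_insert.mp hj with rfl | hj
          · exact hc'
          · obtain ⟨c, hc⟩ := hc j hj
            exact ⟨c, fun x hx => hc x (hS1 hx)⟩
  exact key _ ∅ (by simp) S hSN hS hS' (by simp)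

open Module in
theorem TVal.growth {φ : ConvexBody E → ℂ} (hφ : TVal φ) (K : ConvexBody E) :
    ∃ B : ℝ, ∀ m : ℕ, 1 ≤ m → ‖φ ((m : ℝ) • K)‖ ≤ B * (m : ℝ) ^ finrank ℝ E := by
  obtain ⟨M, hM, h⟩ := hφ.exists_norm_eVal_le_pow
  obtain ⟨R, hR, hK⟩ := K.exists_bound
  obtain ⟨r, hr⟩ := exists_nat_ge R
  refine ⟨(4 * r + 1) ^ finrank ℝ E * M, fun m hm => ?_⟩
  rw [← eVal_coe φ]
  have hsub := ConvexBody.smul_subset_closedBall (hK.trans (closedBall_subset_closedBall hr))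
    (Nat.cast_nonneg (α := ℝ) m)
  refine (h (m * r) _ (ConvexBody.isCompact _) (ConvexBody.convex _)
    (by exact_mod_cast hsub)).trans ?_
  rw [mul_right_comm, ← mul_pow]
  gcongr
  push_cast
  have : (1 : ℝ) ≤ m := by exact_mod_cast hm
  nlinarith

/-- McMullen's polynomiality theorem. -/
theorem TVal.eval_hpoly {φ : ConvexBody E → ℂ} (hφ : TVal φ) (K : ConvexBody E) {t : ℝ}
    (ht : 0 ≤ t) : φ (t • K) = (hpoly φ K).eval (t : ℂ) := by
  classical
  have hcl : IsClosed {K : ConvexBody E | φ (t • K) = (hpoly φ K).eval (t : ℂ)} := by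
    refine isClosed_eq (hφ.cont.comp (ConvexBody.continuous_const_smul t)) ?_
    simp_rw [Polynomial.eval_eq_sum_range' (Nat.lt_succ_of_le (natDegree_hpoly φ _))]
    exact continuous_finsetSum _ fun k _ =>
      (TVal.continuous_hpoly_coeff hφ.cont k).mul continuous_const
  refine hcl.closure_subset_iff.mpr ?_ (ConvexBody.dense_isVPolytope K)
  rintro P ⟨s, hs, hP⟩
  let _ := hs.fintype
  rw [hs.convexHull_eq_image] at hP
  obtain ⟨p, hp⟩ := hφ.exists_poly_polytope (ι := s) P
    (LinearMap.toContinuousLinearMap (∑ x : s, (LinearMap.proj x : (s → ℝ) →ₗ[ℝ] ℝ).smulRight (x : E))) hP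
  obtain ⟨B, hB⟩ := hφ.growth P
  have hdeg := p.natDegree_le_of_growth _ B fun m hm => by
    have := hp m (Nat.cast_nonneg m)
    rw [Complex.ofReal_natCast] at this
    rw [← this]
    exact hB m hm
  have : hpoly φ P = p := eq_hpoly_of_eval φ P p hdeg fun m => by
    simpa using hp m (Nat.cast_nonneg m)
  change φ (t • P) = _
  rw [this]
  exact hp t ht

end Homogeneous

section Operations

variable {E : Type*} [NormedAddCommGroup E] [InnerProductSpace ℝ E]
variable {F : Type*} [NormedAddCommGroup F] [InnerProductSpace ℝ F]

theorem TVal.comp_mapBody {φ : ConvexBody E → ℂ} (hφ : TVal φ) (A : F →L[ℝ] E) :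
    TVal fun K => φ (mapBody A K) where
  val K L U I hU hI := by
    have := hφ.eVal_image_union A K.isCompact L.isCompact K.convex L.convex (hU ▸ U.convex)
    rw [← hU, ← hI] at this
    simpa only [← coe_mapBody, eVal_coe] using this
  cont := hφ.cont.comp (continuous_mapBody A)
  trans x K L h := by
    refine hφ.trans (A x) _ _ ?_
    rw [coe_mapBody, coe_mapBody, h, image_image, image_image]
    simp only [map_add]

theorem TVal.comp_smul {φ : ConvexBody E → ℂ} (hφ : TVal φ) (t : ℝ) :
    TVal fun K => φ (t • K) := by
  simp_rw [ConvexBody.smul_eq_mapBody]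
  exact hφ.comp_mapBody _

theorem TVal.comp_add_right {φ : ConvexBody E → ℂ} (hφ : TVal φ) (M : ConvexBody E) :
    TVal fun K => φ (K + M) where
  val K L U I hU hI := by
    have hp : ∀ K : ConvexBody E, (ContinuousLinearMap.fst ℝ E E + ContinuousLinearMap.snd ℝ E E) ''
        ((K : Set E) ×ˢ (M : Set E)) = ((K + M : ConvexBody E) : Set E) := by
      intro K
      rw [ConvexBody.coe_add, ← Set.add_image_prod]
      rfl
    have := hφ.eVal_image_union (ContinuousLinearMap.fst ℝ E E + ContinuousLinearMap.snd ℝ E E)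
      (K.isCompact.prod M.isCompact) (L.isCompact.prod M.isCompact) (K.convex.prod M.convex)
      (L.convex.prod M.convex) (by rw [← union_prod, ← hU]; exact U.convex.prod M.convex)
    rw [← union_prod, ← inter_prod, ← hU, ← hI] at this
    simpa only [hp, eVal_coe] using this
  cont := hφ.cont.comp (ConvexBody.continuous_add continuous_id continuous_const)
  trans x K L h := by
    refine hφ.trans x _ _ ?_
    rw [ConvexBody.coe_add, ConvexBody.coe_add, h]
    ext y
    simp only [Set.mem_add, mem_image]
    constructor
    · rintro ⟨_, ⟨a, ha, rfl⟩, b, hb, rfl⟩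
      exact ⟨a + b, ⟨a, ha, b, hb, rfl⟩, by rw [add_assoc]⟩
    · rintro ⟨_, ⟨a, ha, b, hb, rfl⟩, rfl⟩
      exact ⟨x + a, ⟨a, ha, rfl⟩, b, hb, by rw [add_assoc]⟩

theorem TVal.zero : TVal fun _ : ConvexBody E => (0 : ℂ) where
  val := by simp
  cont := continuous_const
  trans := by simp

theorem TVal.add {φ ψ : ConvexBody E → ℂ} (hφ : TVal φ) (hψ : TVal ψ) :
    TVal fun K => φ K + ψ K where
  val K L U I hU hI := by
    linear_combination hφ.val K L U I hU hI + hψ.val K L U I hU hI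
  cont := hφ.cont.add hψ.cont
  trans x K L h := by rw [hφ.trans x K L h, hψ.trans x K L h]

theorem TVal.mul_const {φ : ConvexBody E → ℂ} (hφ : TVal φ) (c : ℂ) :
    TVal fun K => φ K * c where
  val K L U I hU hI := by
    linear_combination c * hφ.val K L U I hU hI
  cont := hφ.cont.mul continuous_const
  trans x K L h := by rw [hφ.trans x K L h]

theorem TVal.sum {ι : Type*} (s : Finset ι) {φ : ι → ConvexBody E → ℂ}
    (h : ∀ i ∈ s, TVal (φ i)) : TVal fun K => ∑ i ∈ s, φ i K := by
  classical
  induction s using Finset.induction_on with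
  | empty => simpa using TVal.zero
  | insert i s hi ih =>
    simp only [Finset.sum_insert hi]
    exact (h i (Finset.mem_insert_self _ _)).add
      (ih fun j hj => h j (Finset.mem_insert_of_mem hj))

theorem TVal.hpoly_coeff {φ : ConvexBody E → ℂ} (hφ : TVal φ) (k : ℕ) :
    TVal fun K => (hpoly φ K).coeff k := by
  simp only [_root_.hpoly_coeff]
  exact TVal.sum _ fun m _ => (hφ.comp_smul m).mul_const _

end Operations

section SupportFunction

variable {E : Type*} [NormedAddCommGroup E] [InnerProductSpace ℝ E]

/-- The support function of a convex body. -/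
def suppFn (K : ConvexBody E) (x : E) : ℝ := sSup ((fun y => inner ℝ x y) '' (K : Set E))

theorem exists_suppFn (K : ConvexBody E) (x : E) : ∃ y ∈ K, inner ℝ x y = suppFn K x := by
  have hc : IsCompact ((fun y => inner ℝ x y) '' (K : Set E)) :=
    K.isCompact.image (by fun_prop)
  obtain ⟨y, hy, h⟩ := hc.sSup_mem (K.nonempty.image _)
  exact ⟨y, hy, h⟩

theorem le_suppFn {K : ConvexBody E} {y : E} (hy : y ∈ K) (x : E) : inner ℝ x y ≤ suppFn K x := by
  have hc : IsCompact ((fun y => inner ℝ x y) '' (K : Set E)) :=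
    K.isCompact.image (by fun_prop)
  exact le_csSup hc.bddAbove ⟨y, hy, rfl⟩

theorem suppFn_le {K : ConvexBody E} {x : E} {c : ℝ} (h : ∀ y ∈ K, inner ℝ x y ≤ c) :
    suppFn K x ≤ c := by
  obtain ⟨y, hy, h'⟩ := exists_suppFn K x
  exact h' ▸ h y hy

theorem suppFn_add_body (K L : ConvexBody E) (x : E) :
    suppFn (K + L) x = suppFn K x + suppFn L x := by
  apply le_antisymm
  · refine suppFn_le fun y hy => ?_
    obtain ⟨a, ha, b, hb, rfl⟩ : y ∈ (K : Set E) + L := by rw [← ConvexBody.coe_add]; exact hy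
    rw [inner_add_right]
    exact add_le_add (le_suppFn ha x) (le_suppFn hb x)
  · obtain ⟨a, ha, h1⟩ := exists_suppFn K x
    obtain ⟨b, hb, h2⟩ := exists_suppFn L x
    rw [← h1, ← h2, ← inner_add_right]
    apply le_suppFn
    change a + b ∈ ((K + L : ConvexBody E) : Set E)
    rw [ConvexBody.coe_add]
    exact add_mem_add ha hb

theorem suppFn_smul_body {t : ℝ} (ht : 0 ≤ t) (K : ConvexBody E) (x : E) :
    suppFn (t • K) x = t * suppFn K x := by
  apply le_antisymm
  · refine suppFn_le fun y hy => ?_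
    obtain ⟨a, ha, rfl⟩ : y ∈ t • (K : Set E) := by rw [← ConvexBody.coe_smul]; exact hy
    simp only [inner_smul_right]
    exact mul_le_mul_of_nonneg_left (le_suppFn ha x) ht
  · obtain ⟨a, ha, h1⟩ := exists_suppFn K x
    rw [← h1, ← inner_smul_right]
    apply le_suppFn
    change t • a ∈ ((t • K : ConvexBody E) : Set E)
    rw [ConvexBody.coe_smul]
    exact smul_mem_smul_set ha

theorem suppFn_smul {t : ℝ} (ht : 0 ≤ t) (K : ConvexBody E) (x : E) :
    suppFn K (t • x) = t * suppFn K x := by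
  apply le_antisymm
  · refine suppFn_le fun y hy => ?_
    rw [real_inner_smul_left]
    exact mul_le_mul_of_nonneg_left (le_suppFn hy x) ht
  · obtain ⟨a, ha, h1⟩ := exists_suppFn K x
    rw [← h1, ← real_inner_smul_left]
    exact le_suppFn ha _

theorem suppFn_add_le (K : ConvexBody E) (x y : E) :
    suppFn K (x + y) ≤ suppFn K x + suppFn K y := by
  refine suppFn_le fun z hz => ?_
  rw [inner_add_left]
  exact add_le_add (le_suppFn hz x) (le_suppFn hz y)

theorem suppFn_nonneg {K : ConvexBody E} (h : (0 : E) ∈ K) (x : E) : 0 ≤ suppFn K x := by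
  simpa using le_suppFn h x

theorem suppFn_zero (K : ConvexBody E) : suppFn K 0 = 0 := by
  have := suppFn_smul le_rfl K (0 : E)
  simpa using this

theorem suppFn_le_add_dist (K L : ConvexBody E) (x : E) :
    suppFn K x ≤ suppFn L x + dist K L * ‖x‖ := by
  refine suppFn_le fun y hy => ?_
  obtain ⟨z, hz, hyz⟩ := K.exists_near L hy
  have h1 : inner ℝ x y = inner ℝ x z + inner ℝ x (y - z) := by
    rw [← inner_add_right]; congr 1; abel
  have h2 := real_inner_le_norm x (y - z)
  rw [dist_eq_norm] at hyz
  have := le_suppFn hz x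
  nlinarith [norm_nonneg x, mul_le_mul_of_nonneg_left hyz (norm_nonneg x)]

theorem abs_suppFn_sub_le (K L : ConvexBody E) (x : E) :
    |suppFn K x - suppFn L x| ≤ dist K L * ‖x‖ := by
  have h1 := suppFn_le_add_dist K L x
  have h2 := suppFn_le_add_dist L K x
  rw [dist_comm] at h2
  rw [abs_le]; constructor <;> linarith

theorem suppFn_le_of_subset {K : ConvexBody E} {R : ℝ} (h : (K : Set E) ⊆ closedBall 0 R)
    (x : E) : suppFn K x ≤ R * ‖x‖ := by
  refine suppFn_le fun y hy => ?_
  have h1 := real_inner_le_norm x y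
  have h2 : ‖y‖ ≤ R := by simpa using h hy
  nlinarith [norm_nonneg x]

theorem abs_suppFn_sub_le' {K : ConvexBody E} {R : ℝ} (h : (K : Set E) ⊆ closedBall 0 R) (x y : E) :
    |suppFn K x - suppFn K y| ≤ R * ‖x - y‖ := by
  have h1 := suppFn_add_le K (x - y) y
  have h2 := suppFn_add_le K (y - x) x
  have h3 := suppFn_le_of_subset h (x - y)
  have h4 := suppFn_le_of_subset h (y - x)
  rw [sub_add_cancel] at h1 h2
  rw [norm_sub_rev y x] at h4
  rw [abs_le]; constructor <;> linarith

theorem continuous_suppFn (K : ConvexBody E) : Continuous (suppFn K) := by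
  obtain ⟨R, hR, h⟩ := K.exists_bound
  refine continuous_iff_continuousAt.2 fun x => ?_
  rw [ContinuousAt, tendsto_iff_dist_tendsto_zero]
  refine squeeze_zero (fun _ => dist_nonneg) (fun y => abs_suppFn_sub_le' h y x) ?_
  have : Continuous fun y : E => R * ‖y - x‖ := by fun_prop
  simpa using this.tendsto x

theorem ConvexBody.exists_dist_le_of_suppFn {K L : ConvexBody E} {ε : ℝ} 
    (h : ∀ x : E, ‖x‖ = 1 → suppFn K x ≤ suppFn L x + ε) (hε : 0 ≤ ε) {x : E} (hx : x ∈ K) :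
    ∃ y ∈ L, dist x y ≤ ε := by
  obtain ⟨y, hy, hmin⟩ := exists_norm_eq_iInf_of_complete_convex L.nonempty
    L.isCompact.isComplete L.convex x
  rw [norm_eq_iInf_iff_real_inner_le_zero L.convex hy] at hmin
  refine ⟨y, hy, ?_⟩
  rw [dist_eq_norm]
  rcases eq_or_ne (x - y) 0 with h0 | h0
  · simpa [h0] using hε
  have hn : 0 < ‖x - y‖ := norm_pos_iff.2 h0
  have h1 := h (‖x - y‖⁻¹ • (x - y)) (by
    rw [norm_smul, norm_inv, norm_norm, inv_mul_cancel₀ hn.ne'])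
  rw [suppFn_smul (by positivity), suppFn_smul (by positivity)] at h1
  have h2 : suppFn L (x - y) ≤ inner ℝ (x - y) y := suppFn_le fun z hz => by
    have := hmin z hz
    rw [inner_sub_right] at this
    linarith
  have h3 := le_suppFn hx (x - y)
  have h4 : inner ℝ (x - y) x - inner ℝ (x - y) y = ‖x - y‖ * ‖x - y‖ := by
    rw [← inner_sub_right, real_inner_self_eq_norm_mul_norm]
  have h5 := mul_le_mul_of_nonneg_left h1 hn.le
  rw [mul_add, mul_inv_cancel_left₀ hn.ne', mul_inv_cancel_left₀ hn.ne'] at h5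
  nlinarith

theorem ConvexBody.dist_le_of_suppFn {K L : ConvexBody E} {ε : ℝ} (hε : 0 ≤ ε)
    (h : ∀ x : E, ‖x‖ = 1 → |suppFn K x - suppFn L x| ≤ ε) : dist K L ≤ ε := by
  refine ConvexBody.dist_le_of hε (fun x hx => ?_) (fun x hx => ?_)
  · exact exists_dist_le_of_suppFn (fun x hx => by have := (abs_le.1 (h x hx)).2; linarith) hε hx
  · exact exists_dist_le_of_suppFn (fun x hx => by have := (abs_le.1 (h x hx)).1; linarith) hε hx

theorem suppFn_injective : Function.Injective (suppFn (E := E)) := fun K L h => by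
  have := ConvexBody.dist_le_of_suppFn (K := K) (L := L) le_rfl (by simp [h])
  exact dist_le_zero.1 this

/-- A sublinear function is a support function. -/
theorem exists_suppFn_eq [FiniteDimensional ℝ E] (h : E → ℝ) (hom : ∀ c : ℝ, 0 < c → ∀ x, h (c • x) = c * h x)
    (hadd : ∀ x y, h (x + y) ≤ h x + h y) {R : ℝ} (hR0 : 0 ≤ R) (hR : ∀ x, h x ≤ R * ‖x‖) :
    ∃ K : ConvexBody E, suppFn K = h := by
  have h0 : h 0 = 0 := by have := hom 2 (by norm_num) 0; rw [smul_zero] at this; linarith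
  have key : ∀ x0 : E, ∃ y : E, (∀ x, inner ℝ x y ≤ h x) ∧ inner ℝ x0 y = h x0 := by
    intro x0
    rcases eq_or_ne x0 0 with hx0 | hx0
    · obtain ⟨g, -, hg⟩ := exists_extension_of_le_sublinear (⊥ : E →ₗ.[ℝ] ℝ) h hom hadd (by
        rintro ⟨x, hx⟩
        obtain rfl : x = 0 := (Submodule.mem_bot ℝ).1 hx
        rw [h0]
        apply le_of_eq
        exact LinearPMap.map_zero _)
      refine ⟨(InnerProductSpace.toDual ℝ E).symm (LinearMap.toContinuousLinearMap g), fun x => ?_, ?_⟩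
      · rw [real_inner_comm, InnerProductSpace.toDual_symm_apply]; exact hg x
      · simp [hx0, h0]
    · obtain ⟨g, hg1, hg⟩ := exists_extension_of_le_sublinear
        (LinearPMap.mkSpanSingleton x0 (h x0) hx0) h hom hadd (by
        rintro ⟨x, hx⟩
        obtain ⟨c, rfl⟩ := Submodule.mem_span_singleton.1 hx
        rw [LinearPMap.mkSpanSingleton'_apply]
        simp only [smul_eq_mul, RingHom.id_apply]
        rcases lt_trichotomy c 0 with hc | hc | hc
        · have h1 := hom (-c) (by linarith) x0
          have h2 := hadd (c • x0) ((-c) • x0)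
          rw [← add_smul, add_neg_cancel, zero_smul, h0] at h2
          linarith
        · simp [hc, h0]
        · rw [hom c hc])
      refine ⟨(InnerProductSpace.toDual ℝ E).symm (LinearMap.toContinuousLinearMap g), fun x => ?_, ?_⟩
      · rw [real_inner_comm, InnerProductSpace.toDual_symm_apply]; exact hg x
      · rw [real_inner_comm, InnerProductSpace.toDual_symm_apply]
        have := hg1 ⟨x0, Submodule.mem_span_singleton_self x0⟩
        refine this.trans ?_
        exact LinearPMap.mkSpanSingleton'_apply_self _ _ _ _
  let S : Set E := {y | ∀ x, inner ℝ x y ≤ h x}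
  have hconv : Convex ℝ S := by
    intro y hy z hz a b ha hb hab x
    have h1 := mul_le_mul_of_nonneg_left (hy x) ha
    have h2 := mul_le_mul_of_nonneg_left (hz x) hb
    rw [inner_add_right, inner_smul_right, inner_smul_right]
    have : h x = a * h x + b * h x := by rw [← add_mul, hab, one_mul]
    linarith
  have hclosed : IsClosed S := by
    have : S = ⋂ x, {y | inner ℝ x y ≤ h x} := by ext; simp [S]
    rw [this]
    exact isClosed_iInter fun x => isClosed_le (by fun_prop) continuous_const
  have hbdd : S ⊆ closedBall 0 R := by
    intro y hy
    have h1 := (hy y).trans (hR y)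
    rw [real_inner_self_eq_norm_mul_norm] at h1
    rw [mem_closedBall_zero_iff]
    rcases eq_or_lt_of_le (norm_nonneg y) with h2 | h2
    · rw [← h2]; exact hR0
    · nlinarith
  let K : ConvexBody E := ⟨S, hconv, (isCompact_closedBall 0 R).of_isClosed_subset hclosed hbdd,
    (key 0).imp fun y hy => hy.1⟩
  refine ⟨K, funext fun x => le_antisymm (suppFn_le fun y hy => hy x) ?_⟩
  obtain ⟨y, hy, hxy⟩ := key x
  rw [← hxy]
  exact le_suppFn (K := K) hy x

end SupportFunction

section Smoothing

variable {E : Type*} [NormedAddCommGroup E] [InnerProductSpace ℝ E]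

/-- The zonal kernel `max 0 (s⟨x,u⟩ - |x||u|)`. -/
def zker (s : ℝ) (x u : E) : ℝ := max 0 (s * inner ℝ x u - ‖x‖ * ‖u‖)

theorem zker_nonneg (s : ℝ) (x u : E) : 0 ≤ zker s x u := le_max_left _ _

theorem zker_isometry (s : ℝ) (R : E ≃ₗᵢ[ℝ] E) (x u : E) : zker s (R x) (R u) = zker s x u := by
  simp [zker]

theorem zker_smul (s : ℝ) {t : ℝ} (ht : 0 ≤ t) (x u : E) : zker s (t • x) u = t * zker s x u := by
  rw [zker, zker, norm_smul, Real.norm_of_nonneg ht, real_inner_smul_left, mul_max_of_nonneg _ _ ht]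
  congr 1
  · simp
  · ring

theorem continuous_zker (s : ℝ) : Continuous fun p : E × E => zker s p.1 p.2 := by
  unfold zker; fun_prop

theorem continuous_zker_right (s : ℝ) (x : E) : Continuous fun u => zker s x u :=
  (continuous_zker s).comp (by fun_prop : Continuous fun u : E => (x, u))

/-- The linear algebra behind the convexity of the smoothed function. -/
theorem reflection_identity [FiniteDimensional ℝ E] {a b e a' b' : E} {c : ℝ} (he : ‖e‖ = 1)
    (ha' : ‖a'‖ = 1)
    (hb' : ‖b'‖ = 1) (ha : a = ‖a‖ • a') (hb : b = ‖b‖ • b') (hc : a + b = c • e) :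
    ∃ s₁ s₂ T σ : E ≃ₗᵢ[ℝ] E, s₁ e = a' ∧ s₂ e = b' ∧ T e = e ∧ σ e = e ∧
      ∀ p, (2 * (‖a‖ + ‖b‖) * c) • T p =
        (‖a‖ + ‖b‖ + c) • (‖a‖ • s₁ p + ‖b‖ • s₂ p)
          + (‖a‖ + ‖b‖ - c) • (‖a‖ • s₁ (σ p) + ‖b‖ • s₂ (σ p)) := by
  set α := inner ℝ a e with hα
  set β := inner ℝ b e with hβ
  obtain ⟨w, hw⟩ : ∃ w, w = a - α • e := ⟨_, rfl⟩
  have hee : inner ℝ e e = (1 : ℝ) := by rw [real_inner_self_eq_norm_sq, he]; norm_num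
  have hαβ : α + β = c := by
    rw [hα, hβ, ← inner_add_left, hc, real_inner_smul_left, hee, mul_one]
  have haw : a = α • e + w := by rw [hw]; abel
  have hbw : b = β • e - w := by
    have h : b = c • e - a := by rw [← hc]; abel
    rw [h, hw, ← hαβ, add_smul]; abel
  have hwe : inner ℝ w e = (0 : ℝ) := by
    rw [hw, inner_sub_left, real_inner_smul_left, hee, ← hα]; ring
  have hna : ‖a‖ ^ 2 = α ^ 2 + ‖w‖ ^ 2 := by
    rw [← real_inner_self_eq_norm_sq, ← real_inner_self_eq_norm_sq]
    conv_lhs => rw [haw]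
    simp only [inner_add_left, inner_add_right, real_inner_smul_left, real_inner_smul_right, hee,
      hwe, real_inner_comm w e]
    ring
  have hnb : ‖b‖ ^ 2 = β ^ 2 + ‖w‖ ^ 2 := by
    rw [← real_inner_self_eq_norm_sq, ← real_inner_self_eq_norm_sq]
    conv_lhs => rw [hbw]
    simp only [inner_sub_left, inner_sub_right, real_inner_smul_left, real_inner_smul_right, hee,
      hwe, real_inner_comm w e]
    ring
  set s₁ : E ≃ₗᵢ[ℝ] E := Submodule.reflection (Submodule.span ℝ {e - a'})ᗮ with hs₁
  set s₂ : E ≃ₗᵢ[ℝ] E := Submodule.reflection (Submodule.span ℝ {e - b'})ᗮ with hs₂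
  set T : E ≃ₗᵢ[ℝ] E := Submodule.reflection (Submodule.span ℝ {w})ᗮ with hT
  set V : Submodule ℝ E := Submodule.span ℝ {e, w} with hV
  set σ : E ≃ₗᵢ[ℝ] E := Submodule.reflection V with hσ
  have h1 : s₁ e = a' := Submodule.reflection_sub (he.trans ha'.symm)
  have h2 : s₂ e = b' := Submodule.reflection_sub (he.trans hb'.symm)
  have h1' : s₁ a' = e := by rw [← h1, hs₁, Submodule.reflection_reflection]
  have h2' : s₂ b' = e := by rw [← h2, hs₂, Submodule.reflection_reflection]
  have hTe : T e = e := by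
    apply Submodule.reflection_mem_subspace_eq_self
    rw [Submodule.mem_orthogonal_singleton_iff_inner_right]; exact hwe
  have hTw : T w = -w := Submodule.reflection_orthogonalComplement_singleton_eq_neg w
  have heV : e ∈ V := Submodule.subset_span (by simp)
  have hwV : w ∈ V := Submodule.subset_span (by simp)
  have hσe : σ e = e := Submodule.reflection_mem_subspace_eq_self heV
  have hMe : ‖a‖ • s₁ e + ‖b‖ • s₂ e = c • T e := by rw [h1, h2, ← ha, ← hb, hc, hTe]
  have hMw : ‖a‖ • s₁ w + ‖b‖ • s₂ w = c • T w := by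
    have e1 : ‖a‖ • s₁ w = (‖a‖ ^ 2) • e - α • a := by
      have : s₁ a = ‖a‖ • e := by rw [ha, map_smul, h1', ← ha]
      rw [hw, map_sub, map_smul, h1, this]
      nth_rewrite 4 [ha]
      module
    have e2 : ‖b‖ • s₂ w = β • b - (‖b‖ ^ 2) • e := by
      have : s₂ b = ‖b‖ • e := by rw [hb, map_smul, h2', ← hb]
      have hw' : w = β • e - b := by rw [hbw]; abel
      rw [hw', map_sub, map_smul, h2, this]
      nth_rewrite 3 [hb]
      module
    rw [e1, e2, hna, hnb, hTw, ← hαβ]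
    nth_rewrite 1 [haw]
    nth_rewrite 1 [hbw]
    module
  refine ⟨s₁, s₂, T, σ, h1, h2, hTe, hσe, fun p => ?_⟩
  obtain ⟨v, hv, q, hq, rfl⟩ := Submodule.exists_add_mem_mem_orthogonal (K := V) p
  have hσv : σ v = v := Submodule.reflection_mem_subspace_eq_self hv
  have hσq : σ q = -q := Submodule.reflection_mem_subspace_orthogonalComplement_eq_neg hq
  have hqe : inner ℝ e q = (0 : ℝ) := hq e heV
  have hqw : inner ℝ w q = (0 : ℝ) := hq w hwV
  have hMv : ‖a‖ • s₁ v + ‖b‖ • s₂ v = c • T v := by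
    obtain ⟨x, y, rfl⟩ := Submodule.mem_span_pair.1 hv
    simp only [map_add, map_smul]
    linear_combination (norm := module) x • hMe + y • hMw
  have hTq : T q = q := by
    apply Submodule.reflection_mem_subspace_eq_self
    rw [Submodule.mem_orthogonal_singleton_iff_inner_right]; exact hqw
  have haq : ‖a‖ • s₁ q = ‖a‖ • q := by
    rcases eq_or_ne ‖a‖ 0 with h0 | h0
    · simp [h0]
    · congr 1
      apply Submodule.reflection_mem_subspace_eq_self
      rw [Submodule.mem_orthogonal_singleton_iff_inner_right, inner_sub_left, hqe]
      have : inner ℝ a q = (0 : ℝ) := by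
        rw [haw, inner_add_left, real_inner_smul_left, hqe, hqw]; simp
      rw [ha, real_inner_smul_left] at this
      rcases mul_eq_zero.1 this with h | h
      · exact absurd h h0
      · rw [h, sub_zero]
  have hbq : ‖b‖ • s₂ q = ‖b‖ • q := by
    rcases eq_or_ne ‖b‖ 0 with h0 | h0
    · simp [h0]
    · congr 1
      apply Submodule.reflection_mem_subspace_eq_self
      rw [Submodule.mem_orthogonal_singleton_iff_inner_right, inner_sub_left, hqe]
      have : inner ℝ b q = (0 : ℝ) := by
        rw [hbw, inner_sub_left, real_inner_smul_left, hqe, hqw]; simp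
      rw [hb, real_inner_smul_left] at this
      rcases mul_eq_zero.1 this with h | h
      · exact absurd h h0
      · rw [h, sub_zero]
  rw [map_add σ, hσv, hσq]
  simp only [map_add, map_neg, smul_add, smul_neg, haq, hbq, hTq]
  have hMv' := hMv
  rw [← eq_sub_iff_add_eq] at hMv'
  rw [hMv']
  module

variable [FiniteDimensional ℝ E] [MeasurableSpace E] [BorelSpace E]

theorem setIntegral_ball_isometry (R : E ≃ₗᵢ[ℝ] E) (g : E → ℝ) :
    ∫ u in closedBall (0 : E) 1, g (R u) = ∫ u in closedBall (0 : E) 1, g u := by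
  have h := (R.measurePreserving).setIntegral_preimage_emb
    R.toHomeomorph.measurableEmbedding g (closedBall 0 1)
  rw [← h]
  congr 2
  ext u
  simp

/-- Zonal smoothing of a function. -/
def zsmooth (f : E → ℝ) (s : ℝ) (x : E) : ℝ := ∫ u in closedBall (0 : E) 1, f u * zker s x u

theorem integrableOn_ball {g : E → ℝ} (hg : Continuous g) :
    IntegrableOn g (closedBall (0 : E) 1) :=
  hg.continuousOn.integrableOn_compact (isCompact_closedBall 0 1)

theorem zsmooth_smul (f : E → ℝ) (s : ℝ) {t : ℝ} (ht : 0 ≤ t) (x : E) :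
    zsmooth f s (t • x) = t * zsmooth f s x := by
  rw [zsmooth, zsmooth, ← integral_const_mul]
  congr 1; ext u
  rw [zker_smul s ht]; ring

theorem zsmooth_isometry (f : E → ℝ) (s : ℝ) (R : E ≃ₗᵢ[ℝ] E) (x : E) :
    zsmooth f s (R x) = ∫ u in closedBall (0 : E) 1, f (R u) * zker s x u := by
  rw [zsmooth, ← setIntegral_ball_isometry R]
  simp only [zker_isometry]

theorem zsmooth_nonneg {f : E → ℝ} (hf : ∀ x, 0 ≤ f x) (s : ℝ) (x : E) : 0 ≤ zsmooth f s x :=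
  integral_nonneg fun u => mul_nonneg (hf u) (zker_nonneg s x u)

theorem zsmooth_add_le {f : E → ℝ} (hc : Continuous f) (h0 : ∀ x, 0 ≤ f x)
    (hadd : ∀ x y, f (x + y) ≤ f x + f y) (hom : ∀ t : ℝ, 0 ≤ t → ∀ x, f (t • x) = t * f x)
    (s : ℝ) (a b : E) : zsmooth f s (a + b) ≤ zsmooth f s a + zsmooth f s b := by
  have hz : zsmooth f s 0 = 0 := by
    have := zsmooth_smul f s le_rfl (0 : E)
    simpa using this
  rcases eq_or_ne a 0 with rfl | ha
  · simp [hz]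
  rcases eq_or_ne b 0 with rfl | hb
  · simp [hz]
  rcases eq_or_ne (a + b) 0 with hab | hab
  · rw [hab, hz]; exact add_nonneg (zsmooth_nonneg h0 s a) (zsmooth_nonneg h0 s b)
  have unit : ∀ x : E, x ≠ 0 → ∃ x' : E, ‖x'‖ = 1 ∧ x = ‖x‖ • x' := fun x hx =>
    ⟨‖x‖⁻¹ • x, by rw [norm_smul, norm_inv, norm_norm, inv_mul_cancel₀ (norm_ne_zero_iff.2 hx)],
      by rw [smul_inv_smul₀ (norm_ne_zero_iff.2 hx)]⟩
  obtain ⟨a', ha1, ha2⟩ := unit a ha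
  obtain ⟨b', hb1, hb2⟩ := unit b hb
  obtain ⟨e, he1, he2⟩ := unit _ hab
  obtain ⟨s₁, s₂, T, σ, h1, h2, hT, hσ, key⟩ := reflection_identity he1 ha1 hb1 ha2 hb2 he2
  set m := ‖a‖ + ‖b‖ with hm
  set c := ‖a + b‖ with hcdef
  have hcm : c ≤ m := norm_add_le a b
  have hc0 : 0 < c := norm_pos_iff.2 hab
  have hm0 : 0 < m := hc0.trans_le hcm
  set M : E → E := fun p => ‖a‖ • s₁ p + ‖b‖ • s₂ p with hM
  have hMc : Continuous M := by fun_prop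
  have hzc := continuous_zker_right s e
  have i1 : IntegrableOn (fun p => f (M p) * zker s e p) (closedBall (0 : E) 1) :=
    integrableOn_ball ((hc.comp hMc).mul hzc)
  have i2 : IntegrableOn (fun p => f (M (σ p)) * zker s e p) (closedBall (0 : E) 1) :=
    integrableOn_ball ((hc.comp (hMc.comp σ.continuous)).mul hzc)
  have i3 : IntegrableOn (fun p => f (T p) * zker s e p) (closedBall (0 : E) 1) :=
    integrableOn_ball ((hc.comp T.continuous).mul hzc)
  have i4 : IntegrableOn (fun p => f (s₁ p) * zker s e p) (closedBall (0 : E) 1) :=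
    integrableOn_ball ((hc.comp s₁.continuous).mul hzc)
  have i5 : IntegrableOn (fun p => f (s₂ p) * zker s e p) (closedBall (0 : E) 1) :=
    integrableOn_ball ((hc.comp s₂.continuous).mul hzc)
  have e1 : ∫ p in closedBall (0 : E) 1, f (M (σ p)) * zker s e p
      = ∫ p in closedBall (0 : E) 1, f (M p) * zker s e p := by
    rw [← setIntegral_ball_isometry σ (fun p => f (M p) * zker s e p)]
    congr 1; ext p
    rw [← zker_isometry s σ e p, hσ]
  have e2 : zsmooth f s (a + b) = c * ∫ p in closedBall (0 : E) 1, f (T p) * zker s e p := by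
    rw [← zsmooth_isometry, hT, ← zsmooth_smul f s hc0.le, ← he2]
  have e3 : zsmooth f s a + zsmooth f s b
      = ∫ p in closedBall (0 : E) 1, (‖a‖ * (f (s₁ p) * zker s e p)
        + ‖b‖ * (f (s₂ p) * zker s e p)) := by
    rw [integral_add (i4.const_mul _) (i5.const_mul _), integral_const_mul, integral_const_mul,
      ← zsmooth_isometry, ← zsmooth_isometry, h1, h2, ← zsmooth_smul f s (norm_nonneg a),
      ← zsmooth_smul f s (norm_nonneg b), ← ha2, ← hb2]
  have e4 : ∫ p in closedBall (0 : E) 1, f (M p) * zker s e p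
      ≤ zsmooth f s a + zsmooth f s b := by
    rw [e3]
    refine integral_mono i1 ((i4.const_mul _).add (i5.const_mul _)) fun p => ?_
    have := hadd (‖a‖ • s₁ p) (‖b‖ • s₂ p)
    rw [hom _ (norm_nonneg a), hom _ (norm_nonneg b)] at this
    have := mul_le_mul_of_nonneg_right this (zker_nonneg s e p)
    simp only [hM]
    linarith
  have e5 : (2 * m * c) * ∫ p in closedBall (0 : E) 1, f (T p) * zker s e p
      ≤ (m + c) * (∫ p in closedBall (0 : E) 1, f (M p) * zker s e p)
        + (m - c) * ∫ p in closedBall (0 : E) 1, f (M (σ p)) * zker s e p := by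
    rw [← integral_const_mul, ← integral_const_mul, ← integral_const_mul,
      ← integral_add (i1.const_mul _) (i2.const_mul _)]
    refine integral_mono (i3.const_mul _) ((i1.const_mul _).add (i2.const_mul _)) fun p => ?_
    have h := hadd ((m + c) • M p) ((m - c) • M (σ p))
    have hk := key p
    rw [← hk, hom _ (by positivity), hom _ (by linarith), hom _ (by linarith)] at h
    have := mul_le_mul_of_nonneg_right h (zker_nonneg s e p)
    simp only
    linarith
  rw [e1, ← add_mul] at e5
  have e6 : m + c + (m - c) = 2 * m := by ring
  rw [e6, mul_assoc (2 * m) c] at e5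
  rw [e2]
  exact (le_of_mul_le_mul_left e5 (by positivity)).trans e4

/-- The smoothing of the norm. -/
theorem zsmooth_norm (s : ℝ) {x y : E} (hx : ‖x‖ = 1) (hy : ‖y‖ = 1) :
    zsmooth (fun u => ‖u‖) s x = zsmooth (fun u => ‖u‖) s y := by
  have h1 : Submodule.reflection (Submodule.span ℝ {x - y})ᗮ x = y :=
    Submodule.reflection_sub (hx.trans hy.symm)
  rw [← h1, zsmooth_isometry]
  simp [zsmooth]

theorem zsmooth_norm_pos {s : ℝ} (hs : 1 < s) {x : E} (hx : ‖x‖ = 1) :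
    0 < zsmooth (fun u => ‖u‖) s x := by
  have hcont : Continuous fun u => ‖u‖ * zker s x u :=
    continuous_norm.mul (continuous_zker_right s x)
  set U : Set E := {u | 0 < ‖u‖ * zker s x u} ∩ ball 0 1 with hU
  have hUo : IsOpen U := (isOpen_lt continuous_const hcont).inter isOpen_ball
  have hUn : U.Nonempty := by
    refine ⟨(2 : ℝ)⁻¹ • x, ?_, ?_⟩
    · have h1 : ‖(2 : ℝ)⁻¹ • x‖ = 2⁻¹ := by rw [norm_smul, hx]; norm_num
      have h2 : 0 < zker s x ((2 : ℝ)⁻¹ • x) := by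
        rw [zker, lt_max_iff]; right
        rw [h1, hx, real_inner_smul_right, real_inner_self_eq_norm_sq, hx]; nlinarith
      change 0 < ‖(2 : ℝ)⁻¹ • x‖ * zker s x ((2 : ℝ)⁻¹ • x)
      rw [h1]; positivity
    · rw [mem_ball_zero_iff, norm_smul, hx]; norm_num
  rw [zsmooth, setIntegral_pos_iff_support_of_nonneg_ae
    (Eventually.of_forall fun u => mul_nonneg (norm_nonneg u) (zker_nonneg s x u))
    (integrableOn_ball hcont)]
  refine (hUo.measure_pos volume hUn).trans_le (measure_mono fun u hu => ⟨?_, ?_⟩)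
  · exact (hu.1 : 0 < ‖u‖ * zker s x u).ne'
  · exact ball_subset_closedBall hu.2

theorem abs_zsmooth_sub_le {f : E → ℝ} (hc : Continuous f) {R : ℝ} (hR0 : 0 ≤ R)
    (hR : ∀ x y, |f x - f y| ≤ R * ‖x - y‖) (hom : ∀ t : ℝ, 0 ≤ t → ∀ x, f (t • x) = t * f x)
    {s : ℝ} (hs : 1 < s) {x : E} (hx : ‖x‖ = 1) :
    |zsmooth f s x - zsmooth (fun u => ‖u‖) s x * f x|
      ≤ R * √(2 * (1 - 1 / s)) * zsmooth (fun u => ‖u‖) s x := by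
  have hz := continuous_zker_right s x
  have i1 : IntegrableOn (fun u => f u * zker s x u) (closedBall (0 : E) 1) :=
    integrableOn_ball (hc.mul hz)
  have i2 : IntegrableOn (fun u => ‖u‖ * zker s x u) (closedBall (0 : E) 1) :=
    integrableOn_ball (continuous_norm.mul hz)
  have e : zsmooth f s x - zsmooth (fun u => ‖u‖) s x * f x
      = ∫ u in closedBall (0 : E) 1, (f u * zker s x u - (‖u‖ * zker s x u) * f x) := by
    rw [integral_sub i1 (i2.mul_const _), integral_mul_const]; rfl
  rw [e, ← Real.norm_eq_abs, zsmooth, ← integral_const_mul]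
  refine norm_integral_le_of_norm_le (i2.const_mul _) (Eventually.of_forall fun u => ?_)
  rw [Real.norm_eq_abs]
  have hk := zker_nonneg s x u
  rw [show f u * zker s x u - ‖u‖ * zker s x u * f x = (f u - ‖u‖ * f x) * zker s x u by ring,
    abs_mul, abs_of_nonneg hk]
  rcases eq_or_lt_of_le hk with h0 | h0
  · simp [← h0]
  have h1 : 0 < s * inner ℝ x u - ‖x‖ * ‖u‖ := by
    rw [zker, lt_max_iff] at h0
    exact h0.resolve_left (lt_irrefl _)
  rw [hx, one_mul] at h1
  have h2 : |f u - ‖u‖ * f x| ≤ R * (‖u‖ * √(2 * (1 - 1 / s))) := by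
    rw [← hom _ (norm_nonneg u)]
    refine (hR _ _).trans (mul_le_mul_of_nonneg_left ?_ hR0)
    rw [← Real.sqrt_sq (norm_nonneg u), ← Real.sqrt_mul (sq_nonneg _),
      Real.sqrt_sq (norm_nonneg u)]
    apply Real.le_sqrt_of_sq_le
    rw [norm_sub_sq_real, norm_smul, hx, real_inner_smul_right, real_inner_comm, norm_norm]
    have hu : 0 ≤ ‖u‖ := norm_nonneg u
    have hsu : ‖u‖ / s ≤ inner ℝ x u := by
      rw [div_le_iff₀ (by linarith)]; linarith
    have := mul_le_mul_of_nonneg_left hsu hu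
    have e3 : ‖u‖ ^ 2 * (2 * (1 - 1 / s)) = 2 * ‖u‖ ^ 2 - 2 * (‖u‖ * (‖u‖ / s)) := by ring
    rw [e3]; nlinarith
  calc _ ≤ R * (‖u‖ * √(2 * (1 - 1 / s))) * zker s x u := mul_le_mul_of_nonneg_right h2 hk
    _ = _ := by ring

end Smoothing

section Density

variable {E : Type*} [NormedAddCommGroup E] [InnerProductSpace ℝ E]

/-- The support function as a continuous function on the unit ball. -/
def suppMap (K : ConvexBody E) : C(closedBall (0 : E) 1, ℝ) :=
  ⟨fun x => suppFn K x, (continuous_suppFn K).comp continuous_subtype_val⟩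

theorem suppMap_add (K L : ConvexBody E) : suppMap (K + L) = suppMap K + suppMap L := by
  ext x; exact suppFn_add_body K L x

theorem suppMap_smul {t : ℝ} (ht : 0 ≤ t) (K : ConvexBody E) : suppMap (t • K) = t • suppMap K := by
  ext x; exact suppFn_smul_body ht K x

variable [FiniteDimensional ℝ E]

/-- The closed convex hull of a centred ball and a point. -/
def capBody (r : ℝ) (v : E) : ConvexBody E :=
  ⟨closure (convexHull ℝ (closedBall 0 r ∪ {v})), (convex_convexHull _ _).closure,
    (isBounded_convexHull.2 (isBounded_closedBall.union Bornology.isBounded_singleton)).isCompact_closure,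
    ⟨v, subset_closure (subset_convexHull ℝ _ (Or.inr rfl))⟩⟩

theorem suppFn_capBody {r : ℝ} (hr : 0 ≤ r) (v x : E) :
    suppFn (capBody r v) x = max (‖x‖ * r) (inner ℝ x v) := by
  apply le_antisymm
  · refine suppFn_le fun y hy => ?_
    have h : closure (convexHull ℝ (closedBall 0 r ∪ {v}))
        ⊆ {y : E | inner ℝ x y ≤ max (‖x‖ * r) (inner ℝ x v)} := by
      have hcl : IsClosed {y : E | inner ℝ x y ≤ max (‖x‖ * r) (inner ℝ x v)} :=
        isClosed_le (by fun_prop) (by fun_prop)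
      refine closure_minimal (convexHull_min ?_ ?_) hcl
      · rintro y (hy | hy)
        · exact le_max_of_le_left ((real_inner_le_norm x y).trans
            (mul_le_mul_of_nonneg_left (mem_closedBall_zero_iff.1 hy) (norm_nonneg x)))
        · obtain rfl : y = v := hy
          exact le_max_right (‖x‖ * r) (inner ℝ x y)
      · exact convex_halfSpace_le (𝕜 := ℝ) (f := fun y => inner ℝ x y)
          ⟨fun _ _ => inner_add_right _ _ _, fun _ _ => inner_smul_right _ _ _⟩ _
    exact h hy
  · have hv : v ∈ capBody r v := subset_closure (subset_convexHull ℝ _ (Or.inr rfl))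
    refine max_le ?_ (le_suppFn hv x)
    rcases eq_or_ne x 0 with rfl | hx
    · rw [suppFn_zero, norm_zero, zero_mul]
    have hn : ‖x‖ ≠ 0 := norm_ne_zero_iff.2 hx
    have : inner ℝ x ((r * ‖x‖⁻¹) • x) = ‖x‖ * r := by
      rw [real_inner_smul_right, real_inner_self_eq_norm_sq]; field_simp
    have hb : (r * ‖x‖⁻¹) • x ∈ closedBall (0 : E) r := by
      rw [mem_closedBall_zero_iff, norm_smul, Real.norm_of_nonneg (by positivity), mul_assoc,
        inv_mul_cancel₀ hn, mul_one]
    have hm : (r * ‖x‖⁻¹) • x ∈ capBody r v :=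
      subset_closure (subset_convexHull ℝ _ (Or.inl hb))
    exact this ▸ le_suppFn hm x

theorem isometry_suppMap : Isometry (suppMap (E := E)) := by
  refine Isometry.of_dist_eq fun K L => le_antisymm ?_ ?_
  · refine (ContinuousMap.dist_le dist_nonneg).2 fun x => ?_
    refine (abs_suppFn_sub_le K L x).trans (mul_le_of_le_one_right dist_nonneg ?_)
    exact mem_closedBall_zero_iff.1 x.2
  · refine ConvexBody.dist_le_of_suppFn dist_nonneg fun x hx => ?_
    exact ContinuousMap.dist_apply_le_dist (f := suppMap K) (g := suppMap L)
      ⟨x, by simp [hx]⟩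

theorem ConvexBody.completeSpace : CompleteSpace (ConvexBody E) := by
  rw [completeSpace_iff_isComplete_range ConvexBody.isometry_toNC.isUniformInducing]
  exact ConvexBody.isClosedEmbedding_toNC.isClosed_range.isComplete

variable [MeasurableSpace E] [BorelSpace E]

/-- The zero set of a continuous additive functional is closed under averaging. -/
theorem exists_average_body {Λ : ConvexBody E → ℂ} (hc : Continuous Λ)
    (hadd : ∀ K L, Λ (K + L) = Λ K + Λ L) (hsmul : ∀ t : ℝ, 0 ≤ t → ∀ K, Λ (t • K) = t * Λ K)
    (G : E → ConvexBody E) (hG : ∀ u, Λ (G u) = 0)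
    (hGc : Continuous fun p : E × E => suppFn (G p.1) p.2) :
    ∃ M : ConvexBody E, Λ M = 0 ∧
      ∀ x, suppFn M x = ∫ u in closedBall (0 : E) 1, suppFn (G u) x := by
  let _ := ConvexBody.completeSpace (E := E)
  set C : Set C(closedBall (0 : E) 1, ℝ) := suppMap '' {M | Λ M = 0} with hC
  have hclosed : IsClosed C :=
    isometry_suppMap.isClosedEmbedding.isClosedMap _ (isClosed_eq hc continuous_const)
  have hconv : Convex ℝ C := by
    rintro _ ⟨M, hM, rfl⟩ _ ⟨N, hN, rfl⟩ a b ha hb -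
    refine ⟨a • M + b • N, ?_, ?_⟩
    · change Λ _ = 0
      rw [hadd, hsmul a ha, hsmul b hb, (hM : Λ M = 0), (hN : Λ N = 0)]; simp
    · rw [suppMap_add, suppMap_smul ha, suppMap_smul hb]
  have hcont : Continuous fun u => suppMap (G u) := by
    have : Continuous fun p : E × closedBall (0 : E) 1 => suppFn (G p.1) p.2 :=
      hGc.comp (continuous_id.prodMap continuous_subtype_val)
    exact (ContinuousMap.curry ⟨_, this⟩).continuous
  have hInt : IntegrableOn (fun u => suppMap (G u)) (closedBall (0 : E) 1) :=
    hcont.continuousOn.integrableOn_compact (isCompact_closedBall 0 1)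
  have hpos : 0 < volume (closedBall (0 : E) 1) :=
    (isOpen_ball.measure_pos volume ⟨0, mem_ball_self one_pos⟩).trans_le
      (measure_mono ball_subset_closedBall)
  have hfin : volume (closedBall (0 : E) 1) ≠ ⊤ := (isCompact_closedBall 0 1).measure_ne_top
  obtain ⟨M, hM, hMeq⟩ := hconv.set_average_mem hclosed hpos.ne' hfin
    (Eventually.of_forall fun u => ⟨G u, hG u, rfl⟩) hInt
  set V := volume.real (closedBall (0 : E) 1) with hV
  have hV0 : 0 < V := ENNReal.toReal_pos hpos.ne' hfin
  have hball : ∀ x : E, ‖x‖ ≤ 1 → V * suppFn M x = ∫ u in closedBall (0 : E) 1, suppFn (G u) x := by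
    intro x hx
    have h1 : suppMap M ⟨x, by simpa using hx⟩ = suppFn M x := rfl
    rw [← h1, hMeq, setAverage_eq]
    simp only [ContinuousMap.smul_apply, smul_eq_mul]
    rw [← hV, mul_inv_cancel_left₀ hV0.ne', ContinuousMap.integral_apply hInt]
    rfl
  refine ⟨V • M, by rw [hsmul V hV0.le, (hM : Λ M = 0), mul_zero], fun x => ?_⟩
  rw [suppFn_smul_body hV0.le]
  rcases eq_or_ne x 0 with rfl | hx
  · exact hball 0 (by simp)
  have hn : 0 < ‖x‖ := norm_pos_iff.2 hx
  have h := hball (‖x‖⁻¹ • x) (by rw [norm_smul, norm_inv, norm_norm, inv_mul_cancel₀ hn.ne'])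
  simp only [suppFn_smul (inv_nonneg.2 hn.le)] at h
  rw [integral_const_mul, mul_left_comm] at h
  exact mul_left_cancel₀ (inv_ne_zero hn.ne') h

/-- A continuous additive functional vanishing on all cap bodies vanishes. -/
theorem eq_zero_of_capBody {Λ : ConvexBody E → ℂ} (hc : Continuous Λ)
    (hadd : ∀ K L, Λ (K + L) = Λ K + Λ L) (hsmul : ∀ t : ℝ, 0 ≤ t → ∀ K, Λ (t • K) = t * Λ K)
    (hcap : ∀ r : ℝ, 0 ≤ r → ∀ v, Λ (capBody r v) = 0) {K : ConvexBody E} (hK : (0 : E) ∈ K) :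
    Λ K = 0 := by
  by_cases hE : ∃ x : E, ‖x‖ = 1
  swap
  · have : K = capBody 0 0 := dist_le_zero.1
      (ConvexBody.dist_le_of_suppFn le_rfl fun x hx => absurd ⟨x, hx⟩ hE)
    rw [this]; exact hcap 0 le_rfl 0
  obtain ⟨e, he⟩ := hE
  obtain ⟨R, hR, hKR⟩ := K.exists_bound
  set f := suppFn K with hf
  have hfc : Continuous f := continuous_suppFn K
  have hf0 : ∀ x, 0 ≤ f x := suppFn_nonneg hK
  have key : ∀ s : ℝ, 1 < s → ∃ N : ConvexBody E, Λ N = 0 ∧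
      dist N K ≤ R * √(2 * (1 - 1 / s)) := by
    intro s hs
    have hG : ∀ u x : E, suppFn (f u • capBody ‖u‖ (s • u)) x
        = f u * (‖x‖ * ‖u‖ + zker s x u) := by
      intro u x
      rw [suppFn_smul_body (hf0 u), suppFn_capBody (norm_nonneg u), zker, real_inner_smul_right,
        ← max_add_add_left, add_zero, add_sub_cancel]
    obtain ⟨M, hM0, hM⟩ := exists_average_body hc hadd hsmul
      (fun u => f u • capBody ‖u‖ (s • u))
      (fun u => by rw [hsmul _ (hf0 u), hcap _ (norm_nonneg u), mul_zero]) (by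
        simp only [hG]
        have h1 : Continuous fun p : E × E => zker s p.2 p.1 :=
          (continuous_zker s).comp continuous_swap
        have h2 : Continuous fun p : E × E => f p.1 := hfc.comp continuous_fst
        fun_prop)
    set c := ∫ u in closedBall (0 : E) 1, f u * ‖u‖ with hcdef
    have hc0 : 0 ≤ c := integral_nonneg fun u => mul_nonneg (hf0 u) (norm_nonneg u)
    have hMeq : ∀ x, suppFn M x = zsmooth f s x + c * ‖x‖ := by
      intro x
      have i1 : IntegrableOn (fun u => f u * zker s x u) (closedBall (0 : E) 1) :=
        integrableOn_ball (hfc.mul (continuous_zker_right s x))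
      have i2 : IntegrableOn (fun u => f u * ‖u‖) (closedBall (0 : E) 1) :=
        integrableOn_ball (hfc.mul continuous_norm)
      rw [hM, zsmooth, hcdef, ← integral_mul_const, ← integral_add i1 (i2.mul_const _)]
      congr 1; ext u
      rw [hG]; ring
    obtain ⟨R', hR', hMR⟩ := M.exists_bound
    obtain ⟨L, hL⟩ := exists_suppFn_eq (zsmooth f s) (fun t ht x => zsmooth_smul f s ht.le x)
      (zsmooth_add_le hfc hf0 (suppFn_add_le K) (fun t ht x => suppFn_smul ht K x) s)
      hR'.le (fun x => by
        have h1 := suppFn_le_of_subset hMR x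
        rw [hMeq] at h1
        have := mul_nonneg hc0 (norm_nonneg x)
        linarith)
    have hLM : L + c • capBody 1 0 = M := by
      apply suppFn_injective
      ext x
      rw [suppFn_add_body, hL, hMeq, suppFn_smul_body hc0, suppFn_capBody zero_le_one]
      simp
    have hL0 : Λ L = 0 := by
      have := hadd L (c • capBody 1 0)
      rw [hLM, hM0, hsmul c hc0, hcap 1 zero_le_one, mul_zero, add_zero] at this
      exact this.symm
    have hCp := zsmooth_norm_pos hs he
    set C := zsmooth (fun u => ‖u‖) s e with hC
    refine ⟨C⁻¹ • L, by rw [hsmul _ (inv_nonneg.2 hCp.le), hL0, mul_zero], ?_⟩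
    refine ConvexBody.dist_le_of_suppFn (by positivity) fun x hx => ?_
    rw [suppFn_smul_body (inv_nonneg.2 hCp.le), hL]
    have h := abs_zsmooth_sub_le hfc hR.le (abs_suppFn_sub_le' hKR)
      (fun t ht x => suppFn_smul ht K x) hs hx
    rw [zsmooth_norm s hx he, ← hC] at h
    have e1 : C⁻¹ * zsmooth f s x - suppFn K x = C⁻¹ * (zsmooth f s x - C * f x) := by
      field_simp; rfl
    rw [e1, abs_mul, abs_of_pos (inv_pos.2 hCp), inv_mul_le_iff₀ hCp, mul_comm C (R * _)]
    exact h
  have hs : ∀ k : ℕ, (1 : ℝ) < 1 + 1 / ((k : ℝ) + 1) := fun k => by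
    have : (0 : ℝ) < 1 / ((k : ℝ) + 1) := by positivity
    linarith
  choose N hN0 hN using fun k : ℕ => key _ (hs k)
  have hlim : Tendsto N atTop (𝓝 K) := by
    rw [tendsto_iff_dist_tendsto_zero]
    refine squeeze_zero (fun _ => dist_nonneg) hN ?_
    have h1 : Tendsto (fun k : ℕ => 1 + 1 / ((k : ℝ) + 1)) atTop (𝓝 (1 + 0)) :=
      tendsto_one_div_add_atTop_nhds_zero_nat.const_add 1
    have h2 : ContinuousAt (fun t : ℝ => R * √(2 * (1 - 1 / t))) (1 + 0) := by
      have : (1 + 0 : ℝ) ≠ 0 := by norm_num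
      fun_prop (disch := assumption)
    have h3 := h2.tendsto.comp h1
    simpa [Function.comp_def] using h3
  have h4 := (hc.tendsto K).comp hlim
  have h5 : (Λ ∘ N) = fun _ => 0 := funext hN0
  rw [h5] at h4
  exact (tendsto_nhds_unique tendsto_const_nhds h4).symm

end Density

section LinearPart

open Polynomial

variable {E : Type*} [NormedAddCommGroup E] [InnerProductSpace ℝ E]

theorem ConvexBody.zero_smul_eq (K : ConvexBody E) : (0 : ℝ) • K = 0 := by
  apply ConvexBody.ext
  rw [ConvexBody.coe_smul, ConvexBody.coe_zero, Set.zero_smul_set K.nonempty]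

theorem TVal.comp_add_hpoly_coeff {φ : ConvexBody E → ℂ} (hφ : TVal φ) (K : ConvexBody E) (k : ℕ) :
    TVal fun M => (hpoly (fun N => φ (N + M)) K).coeff k := by
  simp only [_root_.hpoly_coeff]
  refine TVal.sum _ fun m _ => TVal.mul_const ?_ _
  simp only [add_comm ((m : ℝ) • K)]
  exact hφ.comp_add_right _

variable [FiniteDimensional ℝ E]

theorem hpoly_eq_of_eval {φ : ConvexBody E → ℂ} (hφ : TVal φ) (K : ConvexBody E) (p : ℂ[X])
    (h : ∀ t : ℝ, 0 ≤ t → φ (t • K) = p.eval (t : ℂ)) : hpoly φ K = p :=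
  Polynomial.eq_of_eval_nat 0 fun m _ => by
    have h1 := hφ.eval_hpoly K (t := (m : ℝ)) (Nat.cast_nonneg m)
    rw [h _ (Nat.cast_nonneg m)] at h1
    simpa using h1.symm

theorem hpoly_coeff_zero {φ : ConvexBody E → ℂ} (hφ : TVal φ) (K : ConvexBody E) :
    (hpoly φ K).coeff 0 = φ 0 := by
  have := hφ.eval_hpoly K le_rfl
  rw [ConvexBody.zero_smul_eq, Complex.ofReal_zero, ← Polynomial.coeff_zero_eq_eval_zero] at this
  exact this.symm

theorem hpoly_smul {φ : ConvexBody E → ℂ} (hφ : TVal φ) (K : ConvexBody E) {t : ℝ} (ht : 0 ≤ t) :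
    hpoly φ (t • K) = (hpoly φ K).comp (C (t : ℂ) * X) := by
  refine hpoly_eq_of_eval hφ _ _ fun s hs => ?_
  rw [smul_smul, hφ.eval_hpoly K (mul_nonneg hs ht), Polynomial.eval_comp, Polynomial.eval_mul,
    Polynomial.eval_C, Polynomial.eval_X, Complex.ofReal_mul, mul_comm (s : ℂ)]

theorem hpoly_coeff_smul {φ : ConvexBody E → ℂ} (hφ : TVal φ) (k : ℕ) (K : ConvexBody E) {t : ℝ}
    (ht : 0 ≤ t) : (hpoly φ (t • K)).coeff k = (t : ℂ) ^ k * (hpoly φ K).coeff k := by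
  rw [hpoly_smul hφ K ht, Polynomial.comp_C_mul_X_coeff, mul_comm]

theorem hpoly_coeff_one_add {φ : ConvexBody E → ℂ} (hφ : TVal φ) (K L : ConvexBody E) :
    (hpoly φ (K + L)).coeff 1 = (hpoly φ K).coeff 1 + (hpoly φ L).coeff 1 := by
  set d := Module.finrank ℝ E
  let T : ℕ → ConvexBody E → ℂ := fun k M => (hpoly (fun N => φ (N + M)) K).coeff k
  have hT : ∀ k, TVal (T k) := fun k => hφ.comp_add_hpoly_coeff K k
  have hQ : hpoly φ (K + L) = ∑ k ∈ Finset.range (d + 2), hpoly (T k) L * X ^ k := by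
    refine hpoly_eq_of_eval hφ _ _ fun t ht => ?_
    rw [smul_add, (hφ.comp_add_right (t • L)).eval_hpoly K ht,
      Polynomial.eval_eq_sum_range' (n := d + 2)
        ((natDegree_hpoly _ _).trans_lt (by omega)), Polynomial.eval_finsetSum]
    refine Finset.sum_congr rfl fun k _ => ?_
    rw [Polynomial.eval_mul, ← (hT k).eval_hpoly L ht]
    simp [T]
  have h0 : T 0 = φ := by
    ext M
    simp only [T]
    rw [hpoly_coeff_zero (hφ.comp_add_right M), zero_add]
  have h1 : (hpoly (T 1) L).coeff 0 = (hpoly φ K).coeff 1 := by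
    rw [hpoly_coeff_zero (hT 1)]
    simp [T]
  rw [hQ, Polynomial.finsetSum_coeff, Finset.sum_range_succ', Finset.sum_range_succ']
  rw [Finset.sum_eq_zero fun k _ => by
    rw [Polynomial.coeff_mul_X_pow', if_neg (by omega)]]
  rw [Polynomial.coeff_mul_X_pow', Polynomial.coeff_mul_X_pow', if_pos (by omega),
    if_pos (by omega), h0]
  simp only [zero_add, Nat.sub_self, Nat.sub_zero]
  rw [h1]

variable [MeasurableSpace E] [BorelSpace E]

/-- If the degree `j` part of `φ(· + tL)` vanishes for all cap bodies `L`, then so does the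
degree `j + 1` part of `φ`. -/
theorem hpoly_coeff_succ_eq_zero {φ : ConvexBody E → ℂ} (hφ : TVal φ) (j : ℕ)
    (h : ∀ r : ℝ, 0 ≤ r → ∀ v : E, ∀ t : ℝ, 0 ≤ t → ∀ K,
      (hpoly (fun N => φ (N + t • capBody r v)) K).coeff j = 0) (K : ConvexBody E) :
    (hpoly φ K).coeff (j + 1) = 0 := by
  have key : ∀ K : ConvexBody E, (0 : E) ∈ K → (hpoly φ K).coeff (j + 1) = 0 := by
    intro K hK
    set ψ : ConvexBody E → ℂ := fun M => (hpoly (fun N => φ (N + M)) K).coeff j with hψdef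
    have hψ : TVal ψ := hφ.comp_add_hpoly_coeff K j
    have h1 : (hpoly ψ K).coeff 1 = 0 := by
      refine eq_zero_of_capBody (Λ := fun L => (hpoly ψ L).coeff 1) (hψ.hpoly_coeff 1).cont
        (hpoly_coeff_one_add hψ) (fun t ht L => ?_) (fun r hr v => ?_) hK
      · rw [hpoly_coeff_smul hψ 1 L ht, pow_one]
      · have : hpoly ψ (capBody r v) = 0 :=
          hpoly_eq_of_eval hψ _ _ fun t ht => by
            rw [Polynomial.eval_zero]; exact h r hr v t ht K
        simp only [this, Polynomial.coeff_zero]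
    have h2 : hpoly ψ K = hasseDeriv j (hpoly φ K) := by
      refine hpoly_eq_of_eval hψ _ _ fun t ht => ?_
      rw [← Polynomial.taylor_coeff]
      simp only [hψdef]
      congr 1
      refine hpoly_eq_of_eval (hφ.comp_add_right (t • K)) _ _ fun s hs => ?_
      rw [← ConvexBody.add_smul_of_nonneg hs ht, hφ.eval_hpoly K (add_nonneg hs ht),
        Polynomial.taylor_eval, Complex.ofReal_add]
    rw [h2, Polynomial.hasseDeriv_coeff, add_comm 1 j] at h1
    refine (mul_eq_zero.1 h1).resolve_left ?_
    exact_mod_cast (Nat.choose_pos (Nat.le_succ j)).ne'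
  obtain ⟨x, hx⟩ := K.nonempty
  have h2 := (hφ.hpoly_coeff (j + 1)).transBody (-x) K
  rw [← h2]
  refine key _ ?_
  change (0 : E) ∈ ((transBody (-x) K : ConvexBody E) : Set E)
  rw [coe_transBody]
  exact ⟨x, hx, by simp⟩

end LinearPart

section UnitaryAction

variable {n : ℕ}

abbrev Ugrp (n : ℕ) := ↥(Matrix.unitaryGroup (Fin n) ℂ)

/-- The determinant of a unitary matrix. -/
def udet (g : Ugrp n) : ℂ := Matrix.det (g : Matrix (Fin n) (Fin n) ℂ)

theorem udet_mul (g h : Ugrp n) : udet (g * h) = udet g * udet h := by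
  simp [udet]

theorem udet_one : udet (1 : Ugrp n) = 1 := by simp [udet]

/-- The real linear map of `ℂⁿ` given by a unitary matrix. -/
def uMap (g : Ugrp n) : Cn n →L[ℝ] Cn n :=
  (Matrix.toEuclideanCLM (n := Fin n) (𝕜 := ℂ) (g : Matrix (Fin n) (Fin n) ℂ)).restrictScalars ℝ

theorem uMap_mul (g h : Ugrp n) : uMap (g * h) = (uMap g).comp (uMap h) := by
  ext1 x
  simp [uMap]

theorem uMap_mul_apply (g h : Ugrp n) (x : Cn n) : uMap (g * h) x = uMap g (uMap h x) := by
  rw [uMap_mul]; rfl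

theorem uMap_one : uMap (1 : Ugrp n) = ContinuousLinearMap.id ℝ _ := by
  ext1 x
  simp [uMap]

@[simp] theorem uMap_inv_apply_apply (g : Ugrp n) (x : Cn n) : uMap g⁻¹ (uMap g x) = x := by
  rw [← uMap_mul_apply, inv_mul_cancel, uMap_one]; rfl

@[simp] theorem uMap_apply_inv_apply (g : Ugrp n) (x : Cn n) : uMap g (uMap g⁻¹ x) = x := by
  rw [← uMap_mul_apply, mul_inv_cancel, uMap_one]; rfl

theorem toEuclideanCLM_mem_unitary (g : Ugrp n) :
    Matrix.toEuclideanCLM (n := Fin n) (𝕜 := ℂ) (g : Matrix (Fin n) (Fin n) ℂ) ∈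
      unitary (Cn n →L[ℂ] Cn n) := Unitary.map_mem _ g.2

@[simp] theorem norm_uMap (g : Ugrp n) (x : Cn n) : ‖uMap g x‖ = ‖x‖ :=
  ContinuousLinearMap.norm_map_of_mem_unitary (toEuclideanCLM_mem_unitary g) x

theorem Cn.inner_eq_re (x y : Cn n) : inner ℝ x y = (inner ℂ x y).re := by
  rw [PiLp.inner_apply, PiLp.inner_apply, Complex.re_sum]; rfl

theorem inner_uMap (g : Ugrp n) (x y : Cn n) : inner ℝ (uMap g x) (uMap g y) = inner ℝ x y := by
  rw [Cn.inner_eq_re, Cn.inner_eq_re]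
  exact congrArg _
    (ContinuousLinearMap.inner_map_map_of_mem_unitary (toEuclideanCLM_mem_unitary g) x y)

theorem inner_uMap_left (g : Ugrp n) (x y : Cn n) :
    inner ℝ (uMap g⁻¹ x) y = inner ℝ x (uMap g y) := by
  rw [← inner_uMap g, uMap_apply_inv_apply]

/-- A unitary matrix as a real linear isometry. -/
def uIso (g : Ugrp n) : Cn n ≃ₗᵢ[ℝ] Cn n where
  toFun := uMap g
  invFun := uMap g⁻¹
  map_add' := map_add _
  map_smul' := map_smul _
  left_inv := uMap_inv_apply_apply g
  right_inv := uMap_apply_inv_apply g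
  norm_map' := norm_uMap g

theorem continuous_uMap : Continuous (uMap (n := n)) := by
  have h1 : Continuous fun A : Matrix (Fin n) (Fin n) ℂ =>
      Matrix.toEuclideanCLM (n := Fin n) (𝕜 := ℂ) A :=
    LinearMap.continuous_of_finiteDimensional
      (Matrix.toEuclideanCLM (n := Fin n) (𝕜 := ℂ)).toAlgEquiv.toLinearMap
  exact (ContinuousLinearMap.restrictScalarsL ℂ (Cn n) (Cn n) ℝ ℝ).continuous.comp
    (h1.comp continuous_subtype_val)

theorem continuous_udet : Continuous (udet (n := n)) :=
  continuous_subtype_val.matrix_det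

theorem suppFn_mapBody_uMap (g : Ugrp n) (K : ConvexBody (Cn n)) (x : Cn n) :
    suppFn (mapBody (uMap g) K) x = suppFn K (uMap g⁻¹ x) := by
  apply le_antisymm
  · refine suppFn_le ?_
    rintro _ ⟨y, hy, rfl⟩
    rw [← inner_uMap_left]
    exact le_suppFn hy _
  · refine suppFn_le fun y hy => ?_
    rw [inner_uMap_left]
    exact le_suppFn (show uMap g y ∈ mapBody (uMap g) K from ⟨y, hy, rfl⟩) _

theorem mapBody_uMap_capBody (g : Ugrp n) {r : ℝ} (hr : 0 ≤ r) {v : Cn n} (hv : uMap g v = v) :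
    mapBody (uMap g) (capBody r v) = capBody r v := by
  apply suppFn_injective
  ext x
  rw [suppFn_mapBody_uMap, suppFn_capBody hr, suppFn_capBody hr, norm_uMap, inner_uMap_left, hv]

/-- Unitary maps fixing a proper complex subspace can have any determinant of modulus one. -/
theorem exists_unitary_fixing {l : ℤ} (hl : l ≠ 0) {W : Submodule ℂ (Cn n)} (hW : W ≠ ⊤) :
    ∃ g : Ugrp n, (∀ w ∈ W, uMap g w = w) ∧ udet g ^ l ≠ 1 := by
  obtain ⟨v, hv, hv1⟩ : ∃ v ∈ Wᗮ, ‖v‖ = 1 := by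
    obtain ⟨v, hv, hv0⟩ := Submodule.exists_mem_ne_zero_of_ne_bot
      (mt Submodule.orthogonal_eq_bot_iff.1 hW)
    refine ⟨((‖v‖⁻¹ : ℝ) : ℂ) • v, Submodule.smul_mem _ _ hv, ?_⟩
    rw [norm_smul, Complex.norm_real, norm_inv, norm_norm, inv_mul_cancel₀ (norm_ne_zero_iff.2 hv0)]
  set ζ : ℂ := Complex.exp ((Real.pi / l : ℝ) * Complex.I) with hζ
  have hζ1 : ζ * star ζ = 1 := by
    have : ‖ζ‖ = 1 := Complex.norm_exp_ofReal_mul_I _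
    rw [Complex.star_def, Complex.mul_conj, Complex.normSq_eq_norm_sq, this]; simp
  have hζl : ζ ^ l = -1 := by
    rw [hζ, ← Complex.exp_int_mul]
    have : (l : ℂ) * (((Real.pi / l : ℝ) : ℂ) * Complex.I) = Real.pi * Complex.I := by
      have : (l : ℂ) ≠ 0 := Int.cast_ne_zero.2 hl
      push_cast
      field_simp
    rw [this, Complex.exp_pi_mul_I]
  have hvv : star v.ofLp ⬝ᵥ v.ofLp = 1 := by
    have h2 := inner_self_eq_norm_sq_to_K (𝕜 := ℂ) v
    rw [hv1] at h2
    rw [PiLp.inner_apply] at h2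
    simp only [RCLike.inner_apply'] at h2
    simpa [dotProduct] using h2
  set V : Matrix (Fin n) (Fin n) ℂ := Matrix.vecMulVec v.ofLp (star v.ofLp) with hV
  have hVV : V * V = V := by
    rw [hV, Matrix.vecMulVec_mul_vecMulVec, hvv]; simp
  have hVs : star V = V := by
    rw [hV, Matrix.star_eq_conjTranspose, Matrix.conjTranspose_vecMulVec, star_star]
  set G : Matrix (Fin n) (Fin n) ℂ := 1 + (ζ - 1) • V with hG
  have hGu : G ∈ Matrix.unitaryGroup (Fin n) ℂ := by
    rw [Matrix.mem_unitaryGroup_iff, hG, star_add, star_smul, star_one, hVs, mul_add, add_mul,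
      add_mul, one_mul, mul_one, one_mul, smul_mul_assoc, mul_smul_comm, hVV, star_sub, star_one]
    linear_combination (norm := module) hζ1 • V
  have hdet : G.det = ζ := by
    have := Matrix.det_one_add_replicateCol_mul_replicateRow (ι := Unit) ((ζ - 1) • v.ofLp)
      (star v.ofLp)
    rw [dotProduct_smul, hvv] at this
    rw [← Matrix.vecMulVec_eq, Matrix.smul_vecMulVec] at this
    rw [hG, this]; simp
  refine ⟨⟨G, hGu⟩, fun w hw => ?_, ?_⟩
  · have h0 : star v.ofLp ⬝ᵥ w.ofLp = 0 := by
      have h2 := Submodule.inner_left_of_mem_orthogonal hw hv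
      rw [PiLp.inner_apply] at h2
      simp only [RCLike.inner_apply'] at h2
      simpa [dotProduct] using h2
    have : G.mulVec w.ofLp = w.ofLp := by
      rw [hG, Matrix.add_mulVec, Matrix.smul_mulVec, hV, Matrix.vecMulVec_mulVec, h0]
      simp
    exact congrArg (WithLp.toLp 2) this
  · change G.det ^ l ≠ 1
    rw [hdet, hζl]
    norm_num

end UnitaryAction

section LowDegree

variable {n : ℕ}

theorem Cn.finrank_real : Module.finrank ℝ (Cn n) = 2 * n := by
  rw [finrank_real_of_complex, finrank_euclideanSpace]; simp

theorem mapBody_zero (A : Cn n →L[ℝ] Cn n) : mapBody A 0 = 0 := by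
  apply ConvexBody.ext
  simp [Set.singleton_zero]

theorem hpoly_coeff_eq_zero_of_fixing {l : ℤ} (hl : l ≠ 0) (j : ℕ) :
    ∀ (W : Submodule ℂ (Cn n)) (φ : ConvexBody (Cn n) → ℂ), TVal φ →
      (∀ g : Ugrp n, (∀ w ∈ W, uMap g w = w) → ∀ K, φ (mapBody (uMap g) K) = udet g ^ l * φ K) →
      Module.finrank ℂ W + j + 1 ≤ n → ∀ K, (hpoly φ K).coeff j = 0 := by
  induction j with
  | zero =>
    intro W φ hφ hg hW K
    have hW' : W ≠ ⊤ := by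
      rintro rfl
      rw [finrank_top, finrank_euclideanSpace, Fintype.card_fin] at hW
      omega
    obtain ⟨g, hgW, hgl⟩ := exists_unitary_fixing hl hW'
    rw [hpoly_coeff_zero hφ]
    have := hg g hgW 0
    rw [mapBody_zero] at this
    by_contra h0
    exact hgl (mul_right_cancel₀ h0 (by rw [one_mul, ← this]))
  | succ j ih =>
    intro W φ hφ hg hW K
    refine hpoly_coeff_succ_eq_zero hφ j (fun r hr v t ht K => ?_) K
    refine ih (W ⊔ Submodule.span ℂ {v}) _ (hφ.comp_add_right _) (fun g hgW N => ?_) ?_ K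
    · have hgv : uMap g v = v :=
        hgW v (Submodule.mem_sup_right (Submodule.mem_span_singleton_self v))
      rw [← hg g (fun w hw => hgW w (Submodule.mem_sup_left hw)), mapBody_add, mapBody_smul,
        mapBody_uMap_capBody g hr hgv]
    · have h1 := Submodule.finrank_add_le_finrank_add_finrank W (Submodule.span ℂ {v})
      have h2 := finrank_span_le_card (R := ℂ) ({v} : Set (Cn n))
      rw [Set.toFinset_singleton, Finset.card_singleton] at h2
      omega

/-- A valuation has weight `l` under the unitary group. -/
def HasWt (l : ℤ) (φ : ConvexBody (Cn n) → ℂ) : Prop :=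
  ∀ (g : Ugrp n) K, φ (mapBody (uMap g) K) = udet g ^ l * φ K

theorem HasWt.coeff_eq_zero_of_lt {l : ℤ} (hl : l ≠ 0) {φ : ConvexBody (Cn n) → ℂ} (hφ : TVal φ)
    (h : HasWt l φ) {j : ℕ} (hj : j < n) (K : ConvexBody (Cn n)) : (hpoly φ K).coeff j = 0 := by
  refine hpoly_coeff_eq_zero_of_fixing hl j ⊥ φ hφ (fun g _ => h g) ?_ K
  rw [finrank_bot]
  omega

end LowDegree

section Intersection

variable {E : Type*} [NormedAddCommGroup E] [InnerProductSpace ℝ E]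

/-- The difference body `K - M`. -/
def diffBody (K M : ConvexBody E) : ConvexBody E := K + (-1 : ℝ) • M

theorem coe_diffBody (K M : ConvexBody E) : (diffBody K M : Set E) = (K : Set E) - (M : Set E) := by
  rw [diffBody, ConvexBody.coe_add, ConvexBody.coe_smul, sub_eq_add_neg, Set.neg_smul_set,
    one_smul]

theorem mem_diffBody {K M : ConvexBody E} {z : E} :
    z ∈ (diffBody K M : Set E) ↔ ∃ k ∈ K, ∃ m ∈ M, k - m = z := by
  rw [coe_diffBody, Set.mem_sub]; rfl

theorem dist_diffBody_le (K M M' : ConvexBody E) :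
    dist (diffBody K M) (diffBody K M') ≤ dist M M' := by
  refine (ConvexBody.dist_add_le _ _ _ _).trans ?_
  rw [dist_self, zero_add, ConvexBody.smul_eq_mapBody, ConvexBody.smul_eq_mapBody]
  refine (dist_mapBody_le _ _ _).trans ?_
  have : ‖(-1 : ℝ) • ContinuousLinearMap.id ℝ E‖ ≤ 1 := by
    rw [norm_smul, norm_neg, norm_one, one_mul]
    exact ContinuousLinearMap.norm_id_le
  exact mul_le_of_le_one_left dist_nonneg this

theorem closedBall_subset_of_dist_le [FiniteDimensional ℝ E] {N N' : ConvexBody E} {ρ ε : ℝ}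
    (hρ : 0 ≤ ρ) (hN : closedBall (0 : E) ρ ⊆ N) (hε : ε ≤ ρ) (h : dist N N' ≤ ε) :
    closedBall (0 : E) (ρ - ε) ⊆ N' := by
  let B : ConvexBody E := ⟨closedBall 0 (ρ - ε), convex_closedBall _ _, isCompact_closedBall _ _,
    nonempty_closedBall.2 (sub_nonneg.2 hε)⟩
  intro x hx
  obtain ⟨y, hy, hxy⟩ := ConvexBody.exists_dist_le_of_suppFn (K := B) (L := N') (ε := 0)
    (fun x hx => by
      have h1 : suppFn B x ≤ ρ - ε := suppFn_le fun y hy => by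
        have h2 := real_inner_le_norm x y
        rw [hx, one_mul] at h2
        exact h2.trans (mem_closedBall_zero_iff.1 hy)
      have h3 : ρ ≤ suppFn N x := by
        have := le_suppFn (K := N) (y := ρ • x)
          (hN (by rw [mem_closedBall_zero_iff, norm_smul, hx, mul_one, Real.norm_of_nonneg hρ])) x
        rwa [inner_smul_right, real_inner_self_eq_norm_sq, hx, one_pow, mul_one] at this
      have h4 := suppFn_le_add_dist N N' x
      rw [hx] at h4
      linarith) le_rfl hx
  rw [dist_le_zero.1 hxy]
  exact hy

/-- If `K - M` contains a ball around the origin, points of `K` close to `M` are close to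
`K ∩ M`. -/
theorem exists_near_inter {K M : ConvexBody E} {ρ ε D : ℝ} (hρ : 0 < ρ) (hε : 0 < ε)
    (hD : ∀ y ∈ K, ∀ z ∈ K, dist y z ≤ D) (hN : closedBall (0 : E) ρ ⊆ diffBody K M) {y m : E}
    (hy : y ∈ K) (hm : m ∈ M) (hym : dist y m ≤ ε) :
    ∃ z, z ∈ K ∧ z ∈ M ∧ dist y z ≤ ε / ρ * D := by
  have h1 : (ρ / ε) • (m - y) ∈ closedBall (0 : E) ρ := by
    rw [mem_closedBall_zero_iff, norm_smul, Real.norm_of_nonneg (by positivity), norm_sub_rev,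
      ← dist_eq_norm, div_mul_eq_mul_div, div_le_iff₀ hε]
    exact mul_le_mul_of_nonneg_left hym hρ.le
  obtain ⟨k, hk, m', hm', hkm⟩ := mem_diffBody.1 (hN h1)
  have hs : 0 < ε + ρ := by positivity
  have e1 : ρ / (ε + ρ) + ε / (ε + ρ) = 1 := by field_simp; ring
  refine ⟨(ρ / (ε + ρ)) • y + (ε / (ε + ρ)) • k,
    K.convex hy hk (by positivity) (by positivity) e1, ?_, ?_⟩
  · have : (ρ / (ε + ρ)) • y + (ε / (ε + ρ)) • k = (ρ / (ε + ρ)) • m + (ε / (ε + ρ)) • m' := by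
      have e2 : (ε / (ε + ρ)) * (ρ / ε) = ρ / (ε + ρ) := by field_simp
      have h3 := congrArg (fun z => (ε / (ε + ρ)) • z) hkm
      simp only [smul_smul, e2] at h3
      linear_combination (norm := module) h3
    rw [this]
    exact M.convex hm hm' (by positivity) (by positivity) e1
  · have : y - ((ρ / (ε + ρ)) • y + (ε / (ε + ρ)) • k) = (ε / (ε + ρ)) • (y - k) := by
      have : ((ρ / (ε + ρ) + ε / (ε + ρ)) • y) = y := by rw [e1, one_smul]
      linear_combination (norm := module) -this
    have hD0 : 0 ≤ D := dist_nonneg.trans (hD y hy y hy)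
    rw [dist_eq_norm, this, norm_smul, Real.norm_of_nonneg (by positivity), ← dist_eq_norm]
    refine mul_le_mul ?_ (hD y hy k hk) dist_nonneg (by positivity)
    gcongr
    linarith

theorem continuousAt_eVal_inter [FiniteDimensional ℝ E] {μ : ConvexBody E → ℂ} (hμ : Continuous μ)
    {K M : ConvexBody E} (h : (0 : E) ∉ frontier (diffBody K M : Set E)) :
    ContinuousAt (fun N : ConvexBody E => eVal μ ((K : Set E) ∩ N)) M := by
  by_cases h0 : (0 : E) ∈ (diffBody K M : Set E)
  · have hInt : (0 : E) ∈ interior (diffBody K M : Set E) := by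
      by_contra hi
      exact h ⟨subset_closure h0, hi⟩
    obtain ⟨ρ, hρ, hball⟩ := nhds_basis_closedBall.mem_iff.1 (mem_interior_iff_mem_nhds.1 hInt)
    obtain ⟨R, hR, hK⟩ := K.exists_bound
    have hD : ∀ y ∈ K, ∀ z ∈ K, dist y z ≤ 2 * R := fun y hy z hz => by
      have h1 : dist y 0 ≤ R := hK hy
      have h2 : dist z 0 ≤ R := hK hz
      have := dist_triangle_right y z 0
      linarith
    have hne : ∀ N : ConvexBody E, dist N M ≤ ρ / 2 → ((K : Set E) ∩ N).Nonempty := by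
      intro N hN
      have h1 := closedBall_subset_of_dist_le hρ.le hball (ε := ρ / 2) (by linarith)
        ((dist_diffBody_le K M N).trans (by rwa [dist_comm]))
      obtain ⟨k, hk, m, hm, hkm⟩ := mem_diffBody.1 (h1 (mem_closedBall_self (by linarith)))
      exact ⟨k, hk, by rwa [sub_eq_zero.1 hkm]⟩
    have hI : ∀ N : ConvexBody E, ∀ hN : dist N M ≤ ρ / 2,
        eVal μ ((K : Set E) ∩ N) = μ ⟨_, K.convex.inter N.convex, K.isCompact.inter N.isCompact,
          hne N hN⟩ := fun N hN => eVal_of _ _ _ _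
    have hMM : dist M M ≤ ρ / 2 := by rw [dist_self]; positivity
    rw [Metric.continuousAt_iff]
    intro η hη
    obtain ⟨δ, hδ, hμδ⟩ := Metric.continuous_iff.1 hμ
      ⟨_, K.convex.inter M.convex, K.isCompact.inter M.isCompact, hne M hMM⟩ η hη
    set ε : ℝ := min (ρ / 2) (δ * ρ / (8 * R)) with hεdef
    have hε : 0 < ε := by positivity
    have hερ : ε ≤ ρ / 2 := min_le_left _ _
    have hεδ : ε / (ρ / 2) * (2 * R) ≤ δ / 2 := by
      have : ε ≤ δ * ρ / (8 * R) := min_le_right _ _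
      rw [le_div_iff₀ (by positivity)] at this
      rw [div_mul_eq_mul_div, div_le_iff₀ (by positivity)]
      nlinarith
    refine ⟨ε, hε, fun {N} hN => ?_⟩
    have hNρ : dist N M ≤ ρ / 2 := hN.le.trans hερ
    rw [hI N hNρ, hI M hMM]
    refine hμδ _ (lt_of_le_of_lt (ConvexBody.dist_le_of (r := δ / 2) (by positivity) ?_ ?_)
      (half_lt_self hδ))
    · rintro y ⟨hyK, hyN⟩
      obtain ⟨m, hm, hym⟩ := ConvexBody.exists_near N M hyN
      obtain ⟨z, hz1, hz2, hyz⟩ := exists_near_inter (half_pos hρ) hε hD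
        ((closedBall_subset_closedBall (half_le_self hρ.le)).trans hball) hyK hm
        (hym.trans hN.le)
      exact ⟨z, ⟨hz1, hz2⟩, hyz.trans hεδ⟩
    · rintro y ⟨hyK, hyM⟩
      obtain ⟨m, hm, hym⟩ := ConvexBody.exists_near M N hyM
      have h1 := closedBall_subset_of_dist_le hρ.le hball (ε := ρ / 2) (by linarith)
        ((dist_diffBody_le K M N).trans (by rwa [dist_comm]))
      rw [sub_half] at h1
      obtain ⟨z, hz1, hz2, hyz⟩ := exists_near_inter (half_pos hρ) hε hD h1 hyK hm
        (hym.trans (by rw [dist_comm]; exact hN.le))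
      exact ⟨z, ⟨hz1, hz2⟩, hyz.trans hεδ⟩
  · have hev : ∀ᶠ N in 𝓝 M, (0 : E) ∉ (diffBody K N : Set E) := by
      obtain ⟨δ, hδ, hball⟩ := Metric.isOpen_iff.1
        (diffBody K M).isClosed.isOpen_compl 0 h0
      filter_upwards [Metric.ball_mem_nhds M hδ] with N hN h1
      obtain ⟨y, hy, h2⟩ := ConvexBody.exists_near (diffBody K N) (diffBody K M) h1
      refine hball ?_ hy
      rw [mem_ball, dist_comm]
      exact h2.trans_lt ((dist_diffBody_le K N M).trans_lt hN)
    have hz : ∀ N : ConvexBody E, (0 : E) ∉ (diffBody K N : Set E) →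
        eVal μ ((K : Set E) ∩ N) = 0 := fun N hN => by
      have : ((K : Set E) ∩ N) = ∅ := by
        rw [← Set.not_nonempty_iff_eq_empty]
        rintro ⟨y, hy1, hy2⟩
        exact hN (mem_diffBody.2 ⟨y, hy1, y, hy2, sub_self y⟩)
      rw [this, eVal_empty]
    exact (continuousAt_const (y := (0 : ℂ))).congr (hev.mono fun N hN => (hz N hN).symm)

end Intersection

section KinematicIntegral

variable {E : Type*} [NormedAddCommGroup E] [InnerProductSpace ℝ E]

theorem dist_transBody_le (x y : E) (K L : ConvexBody E) :
    dist (transBody x K) (transBody y L) ≤ dist x y + dist K L := by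
  have key : ∀ (x y : E) (K L : ConvexBody E), ∀ z ∈ transBody x K, ∃ w ∈ transBody y L,
      dist z w ≤ dist x y + dist K L := by
    rintro x y K L _ ⟨a, ha, rfl⟩
    obtain ⟨b, hb, hab⟩ := K.exists_near L ha
    exact ⟨y + b, ⟨b, hb, rfl⟩, (dist_add_add_le _ _ _ _).trans (by gcongr)⟩
  refine ConvexBody.dist_le_of (by positivity) (key x y K L) ?_
  rw [dist_comm x, dist_comm K]
  exact key y x L K

theorem continuous_transBody : Continuous fun p : E × ConvexBody E => transBody p.1 p.2 := by
  have : LipschitzWith 2 fun p : E × ConvexBody E => transBody p.1 p.2 := by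
    refine LipschitzWith.of_dist_le_mul fun p q => ?_
    refine (dist_transBody_le _ _ _ _).trans ?_
    rw [Prod.dist_eq]
    have h1 := le_max_left (dist p.1 q.1) (dist p.2 q.2)
    have h2 := le_max_right (dist p.1 q.1) (dist p.2 q.2)
    push_cast
    linarith
  exact this.continuous

theorem ConvexBody.subset_closedBall_of_dist_le {K L : ConvexBody E} {R : ℝ}
    (hK : (K : Set E) ⊆ closedBall 0 R) (h : dist L K ≤ 1) :
    (L : Set E) ⊆ closedBall 0 (R + 1) := by
  intro y hy
  obtain ⟨z, hz, hyz⟩ := L.exists_near K hy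
  have h1 : dist z 0 ≤ R := hK hz
  rw [mem_closedBall]
  have := dist_triangle y z 0
  linarith

/-- Integrals of families of valuations. -/
theorem TVal.integral {X : Type*} [MeasurableSpace X] {ν : Measure X} {f : X → ConvexBody E → ℂ}
    (hm : ∀ K, AEStronglyMeasurable (fun x => f x K) ν)
    (hb : ∀ R : ℝ, ∃ g : X → ℝ, Integrable g ν ∧
      ∀ K : ConvexBody E, (K : Set E) ⊆ closedBall 0 R → ∀ x, ‖f x K‖ ≤ g x)
    (hc : ∀ K, ∀ᵐ x ∂ν, ContinuousAt (f x) K)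
    (hv : ∀ x, ∀ K L U I : ConvexBody E, (U : Set E) = (K : Set E) ∪ (L : Set E) →
      (I : Set E) = (K : Set E) ∩ (L : Set E) → f x U + f x I = f x K + f x L)
    (ht : ∀ y K, ∫ x, f x (_root_.transBody y K) ∂ν = ∫ x, f x K ∂ν) :
    TVal fun K => ∫ x, f x K ∂ν := by
  have hi : ∀ K, Integrable (fun x => f x K) ν := fun K => by
    obtain ⟨R, -, hR⟩ := K.exists_bound
    obtain ⟨g, hg, hfg⟩ := hb R
    exact hg.mono' (hm K) (Eventually.of_forall (hfg K hR))
  refine ⟨fun K L U I hU hI => ?_, ?_, fun y K L h => ?_⟩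
  · rw [← integral_add (hi U) (hi I), ← integral_add (hi K) (hi L)]
    exact integral_congr_ae (Eventually.of_forall fun x => hv x K L U I hU hI)
  · refine continuous_iff_continuousAt.2 fun K => ?_
    obtain ⟨R, -, hR⟩ := K.exists_bound
    obtain ⟨g, hg, hfg⟩ := hb (R + 1)
    refine continuousAt_of_dominated (Eventually.of_forall hm) ?_ hg (hc K)
    filter_upwards [closedBall_mem_nhds K one_pos] with N hN
    exact Eventually.of_forall (hfg N (ConvexBody.subset_closedBall_of_dist_le hR hN))
  · rw [← ht y K]
    have : L = _root_.transBody y K := ConvexBody.ext h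
    rw [this]

theorem diffBody_transBody (K M : ConvexBody E) (x : E) :
    (diffBody K (transBody x M) : Set E) = (fun y => y + x) ⁻¹' (diffBody K M : Set E) := by
  ext z
  rw [mem_preimage, mem_diffBody, mem_diffBody]
  constructor
  · rintro ⟨k, hk, _, ⟨m, hm, rfl⟩, rfl⟩
    exact ⟨k, hk, m, hm, by simp only; abel⟩
  · rintro ⟨k, hk, m, hm, h⟩
    exact ⟨k, hk, x + m, ⟨m, hm, rfl⟩, by rw [sub_add_eq_sub_sub_swap, h]; abel⟩

theorem norm_eVal_inter_le {μ : ConvexBody E → ℂ} {R C : ℝ} (hC0 : 0 ≤ C)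
    (hC : ∀ (x : E) (S : Set E), S ⊆ closedBall x R → ‖eVal μ S‖ ≤ C) {K M : ConvexBody E}
    (hK : (K : Set E) ⊆ closedBall 0 R) (hM : (M : Set E) ⊆ closedBall 0 R) (x : E) :
    ‖eVal μ ((K : Set E) ∩ transBody x M)‖ ≤ (closedBall (0 : E) (2 * R)).indicator (fun _ => C) x := by
  rcases ((K : Set E) ∩ transBody x M).eq_empty_or_nonempty with h | ⟨y, hy, ⟨m, hm, rfl⟩⟩
  · rw [h, eVal_empty, norm_zero]
    exact indicator_nonneg (fun _ _ => hC0) _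
  · rw [indicator_of_mem]
    · exact hC 0 _ (inter_subset_left.trans hK)
    · rw [mem_closedBall_zero_iff]
      have h1 := mem_closedBall_zero_iff.1 (hK hy)
      have h2 := mem_closedBall_zero_iff.1 (hM hm)
      have h3 := norm_sub_le (x + m) m
      rw [add_sub_cancel_right] at h3
      linarith

theorem eVal_image_inter {F : Type*} [NormedAddCommGroup F] [InnerProductSpace ℝ F]
    {φ : ConvexBody F → ℂ} {μ : ConvexBody E → ℂ} {A : F →L[ℝ] E} {c : ℂ}
    (h : ∀ K, μ (mapBody A K) = c * φ K) {K M : ConvexBody F} :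
    eVal μ (A '' ((K : Set F) ∩ M)) = c * eVal φ ((K : Set F) ∩ M) := by
  rcases ((K : Set F) ∩ M).eq_empty_or_nonempty with h0 | h0
  · simp [h0]
  · have := h ⟨_, K.convex.inter M.convex, K.isCompact.inter M.isCompact, h0⟩
    rw [← eVal_coe μ, ← eVal_coe φ] at this
    exact this

variable [FiniteDimensional ℝ E]

theorem continuousAt_eVal_inter_transBody {μ : ConvexBody E → ℂ} (hμ : Continuous μ)
    {K M : ConvexBody E} {x : E} (h : x ∉ frontier (diffBody K M : Set E)) :
    ContinuousAt (fun N : ConvexBody E => eVal μ ((K : Set E) ∩ N)) (transBody x M) := by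
  refine continuousAt_eVal_inter hμ ?_
  rw [diffBody_transBody, ← Homeomorph.coe_addRight, ← Homeomorph.preimage_frontier]
  simpa using h

variable [MeasurableSpace E] [BorelSpace E]

/-- The integral of `μ(K ∩ (M + x))` over all translations `x`. -/
def kinInt (μ : ConvexBody E → ℂ) (K M : ConvexBody E) : ℂ :=
  ∫ x, eVal μ ((K : Set E) ∩ transBody x M)

theorem ae_notMem_frontier (N : ConvexBody E) : ∀ᵐ x : E, x ∉ frontier (N : Set E) :=
  measure_eq_zero_iff_ae_notMem.1 (N.convex.addHaar_frontier volume)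

theorem aestronglyMeasurable_eVal_inter {μ : ConvexBody E → ℂ} (hμ : Continuous μ)
    (K M : ConvexBody E) :
    AEStronglyMeasurable (fun x : E => eVal μ ((K : Set E) ∩ transBody x M)) volume := by
  have h1 : ContinuousOn (fun x : E => eVal μ ((K : Set E) ∩ transBody x M))
      (frontier (diffBody K M : Set E))ᶜ := fun x hx => by
    have h2 := continuousAt_eVal_inter_transBody hμ hx
    have h3 : Continuous fun x : E => transBody x M :=
      continuous_transBody.comp (continuous_id.prodMk continuous_const)
    exact (ContinuousAt.comp (f := fun x : E => transBody x M) h2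
      h3.continuousAt).continuousWithinAt
  have h2 := h1.aestronglyMeasurable (μ := volume) isClosed_frontier.isOpen_compl.measurableSet
  have h3 : ∀ᵐ x : E, x ∈ (frontier (diffBody K M : Set E))ᶜ := ae_notMem_frontier _
  rwa [Measure.restrict_eq_self_of_ae_mem h3] at h2

theorem integrable_indicator_closedBall (r C : ℝ) :
    Integrable ((closedBall (0 : E) r).indicator fun _ => C) volume :=
  (integrable_indicator_iff measurableSet_closedBall).2
    (integrableOn_const (isCompact_closedBall _ _).measure_lt_top.ne)

theorem kinInt_comm {μ : ConvexBody E → ℂ} (hμ : TVal μ) (K M : ConvexBody E) :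
    kinInt μ K M = kinInt μ M K := by
  unfold kinInt
  rw [← integral_neg_eq_self]
  refine integral_congr_ae (Eventually.of_forall fun x => ?_)
  simp only
  rw [← hμ.eVal_translate x]
  congr 1
  ext y
  constructor
  · rintro ⟨_, ⟨hz1, ⟨m, hm, rfl⟩⟩, rfl⟩
    exact ⟨by simpa using hm, ⟨_, hz1, rfl⟩⟩
  · rintro ⟨hy, ⟨k, hk, rfl⟩⟩
    exact ⟨k, ⟨hk, ⟨_, hy, by simp⟩⟩, rfl⟩

theorem TVal.kinInt_right {μ : ConvexBody E → ℂ} (hμ : TVal μ) (K : ConvexBody E) :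
    TVal (kinInt μ K) := by
  refine TVal.integral (f := fun x M => eVal μ ((K : Set E) ∩ _root_.transBody x M))
    (fun M => aestronglyMeasurable_eVal_inter hμ.cont K M) (fun R => ?_) (fun M => ?_)
    (fun x M L U I hU hI => ?_) (fun y M => ?_)
  · obtain ⟨R', -, hK⟩ := K.exists_bound
    obtain ⟨C, hC0, hC⟩ := hμ.exists_bound (max R R')
    exact ⟨_, integrable_indicator_closedBall (2 * max R R') C, fun M hM x =>
      norm_eVal_inter_le hC0 hC (hK.trans (closedBall_subset_closedBall (le_max_right _ _)))
        (hM.trans (closedBall_subset_closedBall (le_max_left _ _))) x⟩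
  · filter_upwards [ae_notMem_frontier (diffBody K M)] with x hx
    have h3 : Continuous fun N : ConvexBody E => _root_.transBody x N :=
      continuous_transBody.comp (continuous_const.prodMk continuous_id)
    exact ContinuousAt.comp (f := fun N : ConvexBody E => _root_.transBody x N)
      (continuousAt_eVal_inter_transBody hμ.cont hx) h3.continuousAt
  · have e1 : (K : Set E) ∩ _root_.transBody x U =
        ((K : Set E) ∩ _root_.transBody x M) ∪ ((K : Set E) ∩ _root_.transBody x L) := by
      rw [coe_transBody, hU, image_union, inter_union_distrib_left]; rfl
    have e2 : (K : Set E) ∩ _root_.transBody x I =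
        ((K : Set E) ∩ _root_.transBody x M) ∩ ((K : Set E) ∩ _root_.transBody x L) := by
      rw [coe_transBody, hI, image_inter (add_right_injective x), inter_inter_distrib_left]; rfl
    have e3 : Convex ℝ ((K : Set E) ∩ _root_.transBody x U) :=
      K.convex.inter (_root_.transBody x U).convex
    rw [e1] at e3
    rw [e1, e2]
    exact hμ.eVal_union (K.isCompact.inter (_root_.transBody x M).isCompact)
      (K.isCompact.inter (_root_.transBody x L).isCompact)
      (K.convex.inter (_root_.transBody x M).convex)
      (K.convex.inter (_root_.transBody x L).convex) e3
  · have : ∀ x, _root_.transBody x (_root_.transBody y M) = _root_.transBody (x + y) M := fun x => by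
      apply ConvexBody.ext
      simp only [coe_transBody, image_image, add_assoc]
    simp only [this]
    exact integral_add_right_eq_self
      (fun x => eVal μ ((K : Set E) ∩ _root_.transBody x M)) y

theorem TVal.kinInt_left {μ : ConvexBody E → ℂ} (hμ : TVal μ) (M : ConvexBody E) :
    TVal fun K => kinInt μ K M := by
  simp only [kinInt_comm hμ _ M]
  exact hμ.kinInt_right M

theorem TVal.norm_kinInt_le {μ : ConvexBody E → ℂ} (hμ : TVal μ) (R : ℝ) :
    ∃ C : ℝ, 0 ≤ C ∧ ∀ K M : ConvexBody E, (K : Set E) ⊆ closedBall 0 R →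
      (M : Set E) ⊆ closedBall 0 R → ‖kinInt μ K M‖ ≤ C := by
  obtain ⟨C, hC0, hC⟩ := hμ.exists_bound R
  refine ⟨∫ x, (closedBall (0 : E) (2 * R)).indicator (fun _ => C) x,
    integral_nonneg fun x => indicator_nonneg (fun _ _ => hC0) _, fun K M hK hM => ?_⟩
  exact norm_integral_le_of_norm_le (integrable_indicator_closedBall _ _)
    (Eventually.of_forall (norm_eVal_inter_le hC0 hC hK hM))

theorem kinInt_map_isometry {μ : ConvexBody E → ℂ} (e : E ≃ₗᵢ[ℝ] E) {A : E →L[ℝ] E}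
    (hA : ∀ x, A x = e x) {c : ℂ} (h : ∀ K, μ (mapBody A K) = c * μ K) (K M : ConvexBody E) :
    kinInt μ (mapBody A K) (mapBody A M) = c * kinInt μ K M := by
  unfold kinInt
  rw [← e.measurePreserving.integral_comp' (f := e.toMeasurableEquiv)
    (g := fun x => eVal μ ((mapBody A K : Set E) ∩ transBody x (mapBody A M))),
    ← integral_const_mul]
  refine integral_congr_ae (Eventually.of_forall fun x => ?_)
  simp only
  rw [← eVal_image_inter h]
  have hinj : Function.Injective A := fun x y hxy => e.injective (by rw [← hA, ← hA, hxy])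
  rw [image_inter hinj]
  congr 2
  simp only [coe_transBody, coe_mapBody, image_image, map_add]
  refine image_congr fun y _ => ?_
  rw [hA x]
  rfl

theorem kinInt_smul (μ : ConvexBody E → ℂ) {t : ℝ} (ht : 0 < t) (K M : ConvexBody E) :
    kinInt μ (t • K) (t • M) =
      (t : ℂ) ^ Module.finrank ℝ E * kinInt (fun N => μ (t • N)) K M := by
  unfold kinInt
  have h1 : ∀ x, eVal (fun N => μ (t • N)) ((K : Set E) ∩ transBody x M) =
      eVal μ ((t • K : Set E) ∩ transBody (t • x) (t • M)) := fun x => by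
    have := eVal_image_inter (φ := fun N => μ (t • N)) (μ := μ)
      (A := t • ContinuousLinearMap.id ℝ E) (c := 1)
      (fun N => by rw [one_mul, ConvexBody.smul_eq_mapBody]) (K := K) (M := transBody x M)
    rw [one_mul] at this
    rw [← this, image_inter (by
      intro x y hxy
      exact smul_right_injective E ht.ne' hxy)]
    congr 2
    ext z
    simp only [coe_transBody, ConvexBody.coe_smul, mem_image, Set.mem_smul_set]
    simp
  simp only [h1]
  rw [Measure.integral_comp_smul volume
    (fun x => eVal μ ((t • K : Set E) ∩ transBody x (t • M))) t]
  rw [abs_of_pos (by positivity), ← ConvexBody.coe_smul, Complex.real_smul, ← mul_assoc]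
  push_cast
  rw [mul_inv_cancel₀ (by exact_mod_cast (pow_pos ht _).ne'), one_mul]

end KinematicIntegral

section KinematicLimit

variable {E : Type*} [NormedAddCommGroup E] [InnerProductSpace ℝ E]

theorem mem_transBody_smul_iff {m : ℝ} (hm : 0 < m) {M : ConvexBody E} {y k : E} :
    k ∈ (transBody (m • y) (m • M) : Set E) ↔ m⁻¹ • k - y ∈ M := by
  rw [coe_transBody, ConvexBody.coe_smul]
  constructor
  · rintro ⟨_, ⟨w, hw, rfl⟩, rfl⟩
    have : m⁻¹ • (m • y + m • w) - y = w := by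
      rw [← smul_add, inv_smul_smul₀ hm.ne', add_sub_cancel_left]
    simp only
    rwa [this]
  · intro h
    refine ⟨m • (m⁻¹ • k - y), ⟨_, h, rfl⟩, ?_⟩
    simp only
    rw [smul_sub, smul_inv_smul₀ hm.ne', add_sub_cancel]

theorem eventually_smul_mem_nhds {K : ConvexBody E} {y : E} {U : Set E} (hU : U ∈ 𝓝 (-y)) :
    ∀ᶠ m : ℕ in atTop, ∀ k ∈ K, ((m : ℝ)⁻¹ • k - y) ∈ U := by
  obtain ⟨ρ, hρ, hball⟩ := Metric.mem_nhds_iff.1 hU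
  obtain ⟨R, hR, hK⟩ := K.exists_bound
  have h1 : Tendsto (fun m : ℕ => (m : ℝ)⁻¹ * R) atTop (𝓝 0) := by
    simpa using (tendsto_inv_atTop_nhds_zero_nat (𝕜 := ℝ)).mul_const R
  filter_upwards [h1.eventually (gt_mem_nhds hρ)] with m hm k hk
  apply hball
  rw [mem_ball, dist_eq_norm, sub_neg_eq_add, sub_add_cancel, norm_smul,
    Real.norm_of_nonneg (by positivity)]
  refine lt_of_le_of_lt ?_ hm
  gcongr
  exact mem_closedBall_zero_iff.1 (hK hk)

theorem norm_eVal_inter_smul_le {μ : ConvexBody E → ℂ} {R R' C : ℝ} (hC0 : 0 ≤ C)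
    (hC : ∀ (x : E) (S : Set E), S ⊆ closedBall x R → ‖eVal μ S‖ ≤ C) {K M : ConvexBody E}
    (hK : (K : Set E) ⊆ closedBall 0 R) (hM : (M : Set E) ⊆ closedBall 0 R') {m : ℕ} (hm : 1 ≤ m)
    (y : E) : ‖eVal μ ((K : Set E) ∩ transBody ((m : ℝ) • y) ((m : ℝ) • M))‖ ≤
      (closedBall (0 : E) (R + R')).indicator (fun _ => C) y := by
  have hm1 : (1 : ℝ) ≤ m := by exact_mod_cast hm
  rcases ((K : Set E) ∩ transBody ((m : ℝ) • y) ((m : ℝ) • M)).eq_empty_or_nonempty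
    with h | ⟨k, hk, hkm⟩
  · rw [h, eVal_empty, norm_zero]
    exact indicator_nonneg (fun _ _ => hC0) _
  · rw [indicator_of_mem]
    · exact hC 0 _ (inter_subset_left.trans hK)
    · rw [mem_transBody_smul_iff (by linarith)] at hkm
      have h1 := mem_closedBall_zero_iff.1 (hM hkm)
      have h2 := mem_closedBall_zero_iff.1 (hK hk)
      have h3 : ‖(m : ℝ)⁻¹ • k‖ ≤ R := by
        rw [norm_smul, Real.norm_of_nonneg (by positivity)]
        exact (mul_le_of_le_one_left (norm_nonneg _) (inv_le_one_of_one_le₀ hm1)).trans h2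
      have h4 := norm_sub_le ((m : ℝ)⁻¹ • k) ((m : ℝ)⁻¹ • k - y)
      rw [sub_sub_cancel] at h4
      rw [mem_closedBall_zero_iff]
      linarith

variable [FiniteDimensional ℝ E] [MeasurableSpace E] [BorelSpace E]

theorem inv_mul_kinInt_smul {μ : ConvexBody E → ℂ} {m : ℕ} (hm : 1 ≤ m) (K M : ConvexBody E) :
    ((m : ℂ) ^ Module.finrank ℝ E)⁻¹ * kinInt μ K ((m : ℝ) • M) =
      ∫ y, eVal μ ((K : Set E) ∩ transBody ((m : ℝ) • y) ((m : ℝ) • M)) := by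
  have hm' : (0 : ℝ) < m := by exact_mod_cast hm
  rw [Measure.integral_comp_smul volume
    (fun x => eVal μ ((K : Set E) ∩ transBody x ((m : ℝ) • M))) (m : ℝ),
    abs_of_pos (by positivity), Complex.real_smul]
  push_cast
  rfl

theorem TVal.norm_inv_mul_kinInt_smul_le {μ : ConvexBody E → ℂ} (hμ : TVal μ) (R R' : ℝ) :
    ∃ C : ℝ, ∀ K M : ConvexBody E, (K : Set E) ⊆ closedBall 0 R →
      (M : Set E) ⊆ closedBall 0 R' → ∀ m : ℕ, 1 ≤ m →
        ‖((m : ℂ) ^ Module.finrank ℝ E)⁻¹ * kinInt μ K ((m : ℝ) • M)‖ ≤ C := by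
  obtain ⟨C, hC0, hC⟩ := hμ.exists_bound R
  refine ⟨∫ x, (closedBall (0 : E) (R + R')).indicator (fun _ => C) x,
    fun K M hK hM m hm => ?_⟩
  rw [inv_mul_kinInt_smul hm]
  exact norm_integral_le_of_norm_le (integrable_indicator_closedBall _ _)
    (Eventually.of_forall fun y => norm_eVal_inter_smul_le hC0 hC hK hM hm y)

theorem TVal.tendsto_kinInt {μ : ConvexBody E → ℂ} (hμ : TVal μ) (K M : ConvexBody E) :
    Tendsto (fun m : ℕ => ((m : ℂ) ^ Module.finrank ℝ E)⁻¹ * kinInt μ K ((m : ℝ) • M)) atTop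
      (𝓝 (μ K * ((volume (M : Set E)).toReal : ℂ))) := by
  obtain ⟨R, hR, hK⟩ := K.exists_bound
  obtain ⟨R', hR', hM⟩ := M.exists_bound
  obtain ⟨C, hC0, hC⟩ := hμ.exists_bound R
  have hneg : μ K * ((volume (M : Set E)).toReal : ℂ) =
      ∫ y, (Neg.neg ⁻¹' (M : Set E)).indicator (fun _ => μ K) y := by
    rw [integral_indicator (measurable_neg M.isClosed.measurableSet), setIntegral_const,
      Measure.real, (Measure.measurePreserving_neg (volume : Measure E)).measure_preimage
        M.isClosed.measurableSet.nullMeasurableSet, Complex.real_smul, mul_comm]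
  rw [hneg]
  have hev : (fun m : ℕ => ∫ y, eVal μ ((K : Set E) ∩ _root_.transBody ((m : ℝ) • y) ((m : ℝ) • M)))
      =ᶠ[atTop] fun m : ℕ => ((m : ℂ) ^ Module.finrank ℝ E)⁻¹ * kinInt μ K ((m : ℝ) • M) := by
    filter_upwards [eventually_ge_atTop 1] with m hm
    exact (inv_mul_kinInt_smul hm K M).symm
  refine Tendsto.congr' hev (tendsto_integral_filter_of_dominated_convergence
    ((closedBall (0 : E) (R + R')).indicator fun _ => C) ?_ ?_
    (integrable_indicator_closedBall _ _) ?_)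
  · filter_upwards [eventually_ge_atTop 1] with m hm
    have hm' : (m : ℝ) ≠ 0 := by
      have : (0 : ℝ) < m := by exact_mod_cast hm
      exact this.ne'
    exact (aestronglyMeasurable_eVal_inter hμ.cont K ((m : ℝ) • M)).comp_quasiMeasurePreserving
      ⟨measurable_const_smul _, by
        rw [Measure.map_addHaar_smul volume hm']
        exact Measure.smul_absolutelyContinuous⟩
  · filter_upwards [eventually_ge_atTop 1] with m hm
    exact Eventually.of_forall fun y => norm_eVal_inter_smul_le hC0 hC hK hM hm y
  · have hfr : ∀ᵐ y : E, -y ∉ frontier (M : Set E) :=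
      (Measure.measurePreserving_neg (volume : Measure E)).quasiMeasurePreserving.ae
        (ae_notMem_frontier M)
    filter_upwards [hfr] with y hy
    refine Tendsto.congr' ?_ tendsto_const_nhds
    by_cases hyM : -y ∈ (M : Set E)
    · have hInt : (M : Set E) ∈ 𝓝 (-y) := by
        rw [← mem_interior_iff_mem_nhds]
        by_contra hi
        exact hy ⟨subset_closure hyM, hi⟩
      filter_upwards [eventually_smul_mem_nhds (K := K) hInt, eventually_ge_atTop 1] with m hm hm1
      have hm' : (0 : ℝ) < m := by exact_mod_cast hm1
      rw [indicator_of_mem (by exact hyM), inter_eq_left.2, eVal_coe]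
      exact fun k hk => (mem_transBody_smul_iff hm').2 (hm k hk)
    · have hInt : (M : Set E)ᶜ ∈ 𝓝 (-y) := M.isClosed.isOpen_compl.mem_nhds hyM
      filter_upwards [eventually_smul_mem_nhds (K := K) hInt, eventually_ge_atTop 1] with m hm hm1
      have hm' : (0 : ℝ) < m := by exact_mod_cast hm1
      rw [indicator_of_notMem (by exact hyM)]
      have : (K : Set E) ∩ _root_.transBody ((m : ℝ) • y) ((m : ℝ) • M) = ∅ := by
        rw [← Set.not_nonempty_iff_eq_empty]
        rintro ⟨k, hk, hkm⟩
        exact hm k hk ((mem_transBody_smul_iff hm').1 hkm)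
      rw [this, eVal_empty]

end KinematicLimit

section HPolytope

variable {E : Type*} [NormedAddCommGroup E] [InnerProductSpace ℝ E]

/-- Convex bodies that are finite intersections of half-spaces. -/
def IsHPolytope (P : ConvexBody E) : Prop :=
  ∃ t : Finset (E × ℝ), (P : Set E) = {y | ∀ p ∈ t, inner ℝ p.1 y ≤ p.2}

theorem ConvexBody.exists_separating (K : ConvexBody E) {y : E} (hy : y ∉ K) :
    ∃ p : E × ℝ, (∀ z ∈ K, inner ℝ p.1 z ≤ p.2) ∧ p.2 < inner ℝ p.1 y := by
  obtain ⟨q, hq, hmin⟩ := exists_norm_eq_iInf_of_complete_convex K.nonempty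
    K.isCompact.isComplete K.convex y
  rw [norm_eq_iInf_iff_real_inner_le_zero K.convex hq] at hmin
  refine ⟨(y - q, inner ℝ (y - q) q), fun z hz => ?_, ?_⟩
  · have := hmin z hz
    rw [inner_sub_right] at this
    simp only
    linarith
  · have h0 : y - q ≠ 0 := fun h => hy (by rw [sub_eq_zero.1 h]; exact hq)
    have h1 : 0 < inner ℝ (y - q) (y - q) := real_inner_self_pos.2 h0
    rw [inner_sub_right] at h1
    simp only
    linarith

theorem dense_isHPolytope [FiniteDimensional ℝ E] : Dense {P : ConvexBody E | IsHPolytope P} := by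
  refine Metric.dense_iff.2 fun K ε' hε' => ?_
  set ε := ε' / 2 with hεdef
  have hε : 0 < ε := half_pos hε'
  obtain ⟨R, hR, hK⟩ := K.exists_bound
  have hcont : Continuous fun y => infDist y (K : Set E) := continuous_infDist_pt _
  have hbdd : ∀ y, infDist y (K : Set E) ≤ ε → y ∈ closedBall (0 : E) (R + ε) := fun y hy => by
    obtain ⟨z, hz, h⟩ := K.isCompact.exists_infDist_eq_dist K.nonempty y
    have h1 := mem_closedBall.1 (hK hz)
    have h2 := dist_triangle y z 0
    rw [mem_closedBall]
    linarith
  have hSh : IsCompact {y | infDist y (K : Set E) = ε} :=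
    (isCompact_closedBall (0 : E) (R + ε)).of_isClosed_subset
      (isClosed_eq hcont continuous_const) fun y hy => hbdd y (le_of_eq hy)
  have hnot : ∀ y ∈ {y | infDist y (K : Set E) = ε}, y ∉ K := fun y hy hyK => by
    have h1 : infDist y (K : Set E) = ε := hy
    rw [infDist_zero_of_mem hyK] at h1
    exact hε.ne h1
  choose! p hp1 hp2 using fun y hy => K.exists_separating (hnot y hy)
  obtain ⟨t, htS, ht⟩ := hSh.elim_nhds_subcover (fun y => {z | (p y).2 < inner ℝ (p y).1 z})
    fun y hy => (isOpen_lt continuous_const (by fun_prop)).mem_nhds (hp2 y hy)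
  classical
  set Q : Set E := {y | ∀ q ∈ t.image p, inner ℝ q.1 y ≤ q.2} with hQ
  have hQ' : Q = ⋂ q ∈ t.image p, {y | inner ℝ q.1 y ≤ q.2} := by
    ext y
    simp [hQ]
  have hQc : Convex ℝ Q := by
    rw [hQ']
    exact convex_iInter₂ fun q _ => convex_halfSpace_le (innerSL ℝ q.1).isLinear q.2
  have hQcl : IsClosed Q := by
    rw [hQ']
    exact isClosed_biInter fun q _ => isClosed_le (by fun_prop) continuous_const
  have hKQ : (K : Set E) ⊆ Q := by
    intro y hy q hq
    obtain ⟨z, hz, rfl⟩ := Finset.mem_image.1 hq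
    exact hp1 z (htS z hz) y hy
  have hQS : ∀ y ∈ Q, infDist y (K : Set E) ≠ ε := by
    intro y hy hyS
    obtain ⟨z, hz, hyz⟩ := mem_iUnion₂.1 (ht hyS)
    exact absurd (hy (p z) (Finset.mem_image_of_mem p hz)) (not_le.2 hyz)
  have hQε : ∀ y ∈ Q, infDist y (K : Set E) ≤ ε := by
    intro y hy
    by_contra! h
    obtain ⟨k, hk⟩ := K.nonempty
    obtain ⟨z, hz, hzε⟩ := (hQc.isPreconnected).intermediate_value (hKQ hk) hy
      hcont.continuousOn (show ε ∈ Icc _ _ from ⟨by rw [infDist_zero_of_mem hk]; exact hε.le, h.le⟩)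
    exact hQS z hz hzε
  have hQcomp : IsCompact Q :=
    (isCompact_closedBall (0 : E) (R + ε)).of_isClosed_subset hQcl fun y hy => hbdd y (hQε y hy)
  refine ⟨⟨Q, hQc, hQcomp, K.nonempty.mono hKQ⟩, ?_, ⟨t.image p, rfl⟩⟩
  refine lt_of_le_of_lt (ConvexBody.dist_le_of hε.le (fun y hy => ?_) fun y hy => ?_)
    (half_lt_self hε')
  · obtain ⟨z, hz, h⟩ := K.isCompact.exists_infDist_eq_dist K.nonempty y
    exact ⟨z, hz, h ▸ hQε y hy⟩
  · exact ⟨y, hKQ hy, by rw [dist_self]; exact hε.le⟩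

end HPolytope

section SlabVolume

variable {n : ℕ}

/-- The volume of the intersection of `n` slabs in independent complex directions grows at most
like the `n`-th power of the size. -/
theorem exists_volume_slab_le (a : Fin n → Cn n) (ha : Submodule.span ℂ (range a) = ⊤)
    (b : Fin n → ℝ) (r R : ℝ) (hr : 0 ≤ r) (hR : 0 ≤ R) :
    ∃ C : ℝ, 0 ≤ C ∧ ∀ m : ℕ, 1 ≤ m →
      volume {x : Cn n | ‖x‖ ≤ R * m + r ∧ ∀ i, |inner ℝ (a i) x - m * b i| ≤ r * ‖a i‖} ≤
        ENNReal.ofReal (C * (m : ℝ) ^ n) := by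
  let T₀ : Cn n →ₗ[ℂ] (Fin n → ℂ) := LinearMap.pi fun i => (innerSL ℂ (a i)).toLinearMap
  have hT₀ : ∀ x i, T₀ x i = inner ℂ (a i) x := fun x i => rfl
  have hinj : Function.Injective T₀ := by
    refine (injective_iff_map_eq_zero T₀).2 fun x hx => ?_
    have h1 : x ∈ (Submodule.span ℂ (range a))ᗮ := by
      rw [Submodule.mem_orthogonal]
      intro u hu
      induction hu using Submodule.span_induction with
      | mem u hu =>
        obtain ⟨i, rfl⟩ := hu
        rw [← hT₀, hx]; rfl
      | zero => simp
      | add u v _ _ hu hv => rw [inner_add_left, hu, hv, add_zero]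
      | smul c u _ hu => rw [inner_smul_left, hu, mul_zero]
    rw [ha, Submodule.top_orthogonal_eq_bot] at h1
    exact (Submodule.mem_bot ℂ).1 h1
  let T : Cn n ≃ₗ[ℂ] (Fin n → ℂ) := LinearEquiv.ofInjectiveOfFinrankEq T₀ hinj (by simp)
  have hT : ∀ x i, T x i = inner ℂ (a i) x := fun x i => rfl
  have hTc : Continuous T.symm := LinearMap.continuous_of_finiteDimensional T.symm.toLinearMap
  set A : ℝ := ∑ i, ‖a i‖ with hA
  have hA0 : 0 ≤ A := Finset.sum_nonneg fun i _ => norm_nonneg _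
  have hAi : ∀ i, ‖a i‖ ≤ A := fun i =>
    Finset.single_le_sum (f := fun i => ‖a i‖) (fun i _ => norm_nonneg _) (Finset.mem_univ i)
  set Q : Set (Cn n) := T.symm '' closedBall 0 (r * A + 1) with hQ
  have hQc : IsCompact Q := (isCompact_closedBall _ _).image hTc
  set q : ℝ := (volume Q).toReal with hq
  have hqQ : volume Q = ENNReal.ofReal q := (ENNReal.ofReal_toReal hQc.measure_lt_top.ne).symm
  refine ⟨(2 * (A * (R + r)) + 5) ^ n * q, by positivity, fun m hm => ?_⟩
  have hm1 : (1 : ℝ) ≤ m := by exact_mod_cast hm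
  set N : ℕ := ⌈A * (R * m + r)⌉₊ + 1 with hN
  have hNm : (2 * N + 1 : ℝ) ≤ (2 * (A * (R + r)) + 5) * m := by
    have h1 := (Nat.ceil_lt_add_one (show 0 ≤ A * (R * m + r) by positivity)).le
    have h2 : A * (R * m + r) ≤ A * (R + r) * m := by
      have : 0 ≤ A * r := by positivity
      nlinarith
    push_cast [hN]
    nlinarith
  set s : (Fin n → ℤ) → Fin n → ℂ := fun k i => (m * b i : ℝ) + (k i : ℂ) * Complex.I with hs
  set F : Finset (Fin n → ℤ) := Fintype.piFinset fun _ => Finset.Icc (-(N : ℤ)) N with hF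
  have hsub : {x : Cn n | ‖x‖ ≤ R * m + r ∧ ∀ i, |inner ℝ (a i) x - m * b i| ≤ r * ‖a i‖} ⊆
      ⋃ k ∈ F, (fun y => T.symm (s k) + y) '' Q := by
    rintro x ⟨hx1, hx2⟩
    have hz : ∀ i, |(T x i).im| ≤ A * (R * m + r) := fun i => by
      refine (Complex.abs_im_le_norm _).trans ?_
      rw [hT]
      refine (norm_inner_le_norm _ _).trans ?_
      exact mul_le_mul (hAi i) hx1 (norm_nonneg _) hA0
    refine mem_iUnion₂.2 ⟨fun i => ⌊(T x i).im⌋, ?_, x - T.symm (s fun i => ⌊(T x i).im⌋), ?_, by simp⟩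
    · rw [hF, Fintype.mem_piFinset]
      intro i
      have h1 := abs_le.1 (hz i)
      have h2 := Nat.le_ceil (A * (R * m + r))
      have h3 := Int.floor_le (T x i).im
      have h4 := Int.lt_floor_add_one (T x i).im
      rw [Finset.mem_Icc]
      constructor
      · have : (-(N : ℤ) : ℝ) ≤ (⌊(T x i).im⌋ : ℝ) := by
          push_cast [hN]
          linarith
        exact_mod_cast this
      · have : (⌊(T x i).im⌋ : ℝ) ≤ ((N : ℤ) : ℝ) := by
          push_cast [hN]
          linarith
        exact_mod_cast this
    · refine ⟨T x - s fun i => ⌊(T x i).im⌋, ?_, by simp⟩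
      rw [mem_closedBall_zero_iff, pi_norm_le_iff_of_nonneg (by positivity)]
      intro i
      refine (Complex.norm_le_abs_re_add_abs_im _).trans (add_le_add ?_ ?_)
      · have : ((T x - s fun i => ⌊(T x i).im⌋) i).re = inner ℝ (a i) x - m * b i := by
          rw [Pi.sub_apply, Complex.sub_re, hT, Cn.inner_eq_re]
          simp [hs]
        rw [this]
        exact (hx2 i).trans (mul_le_mul_of_nonneg_left (hAi i) hr)
      · have : ((T x - s fun i => ⌊(T x i).im⌋) i).im = (T x i).im - ⌊(T x i).im⌋ := by
          rw [Pi.sub_apply, Complex.sub_im]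
          simp [hs]
        rw [this, abs_of_nonneg (sub_nonneg.2 (Int.floor_le _))]
        linarith [Int.lt_floor_add_one (T x i).im]
  refine (measure_mono hsub).trans ((measure_biUnion_finset_le _ _).trans ?_)
  have hvol : ∀ k ∈ F, volume ((fun y => T.symm (s k) + y) '' Q) = ENNReal.ofReal q := fun k _ => by
    rw [image_add_left, measure_preimage_add, hqQ]
  rw [Finset.sum_congr rfl hvol, Finset.sum_const, nsmul_eq_mul]
  have hcard : F.card = (2 * N + 1) ^ n := by
    rw [hF, Fintype.card_piFinset, Finset.prod_const, Finset.card_univ, Fintype.card_fin,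
      Int.card_Icc]
    congr 1
    omega
  rw [hcard, ← ENNReal.ofReal_natCast, ← ENNReal.ofReal_mul (by positivity)]
  apply ENNReal.ofReal_le_ofReal
  push_cast
  have := pow_le_pow_left₀ (by positivity) hNm n
  rw [mul_pow] at this
  calc _ ≤ ((2 * (A * (R + r)) + 5) ^ n * (m : ℝ) ^ n) * q :=
        mul_le_mul_of_nonneg_right this (by positivity)
    _ = _ := by ring

end SlabVolume

section HighDegree

variable {n : ℕ}

theorem span_active_eq_top {l : ℤ} (hl : l ≠ 0) {μ : ConvexBody (Cn n) → ℂ} (hμ : TVal μ)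
    (hw : HasWt l μ) {t : Finset (Cn n × ℝ)} {m r : ℝ} {Q B : ConvexBody (Cn n)}
    (hQ : (Q : Set (Cn n)) = {y | ∀ p ∈ t, inner ℝ p.1 y ≤ m * p.2})
    (hB : (B : Set (Cn n)) = closedBall 0 r) {x : Cn n}
    (hne : eVal μ ((Q : Set (Cn n)) ∩ transBody x B) ≠ 0) :
    Submodule.span ℂ {a | ∃ p ∈ t, p.1 = a ∧ |inner ℝ p.1 x - m * p.2| ≤ r * ‖p.1‖} = ⊤ := by
  by_contra hW
  obtain ⟨g, hg, hgl⟩ := exists_unitary_fixing hl hW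
  have hS : (Q : Set (Cn n)) ∩ transBody x B =
      (fun y => x + y) '' ((transBody (-x) Q : Set (Cn n)) ∩ B) := by
    rw [image_inter (add_right_injective x), coe_transBody, coe_transBody, image_image]
    simp
  have hmem : ∀ z, z ∈ (transBody (-x) Q : Set (Cn n)) ∩ B ↔
      ‖z‖ ≤ r ∧ ∀ p ∈ t, inner ℝ p.1 x + inner ℝ p.1 z ≤ m * p.2 := fun z => by
    rw [mem_inter_iff, hB, mem_closedBall_zero_iff, coe_transBody, image_add_left, mem_preimage,
      neg_neg, hQ, and_comm]
    simp only [mem_ofPred_eq, inner_add_right]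
  have hfix : ∀ g : Ugrp n, (∀ p ∈ t, |inner ℝ p.1 x - m * p.2| ≤ r * ‖p.1‖ →
      uMap g⁻¹ p.1 = p.1) → ∀ z ∈ (transBody (-x) Q : Set (Cn n)) ∩ B,
      uMap g z ∈ (transBody (-x) Q : Set (Cn n)) ∩ B := by
    intro g hg z hz
    rw [hmem] at hz ⊢
    refine ⟨by rw [norm_uMap]; exact hz.1, fun p hp => ?_⟩
    by_cases ha : |inner ℝ p.1 x - m * p.2| ≤ r * ‖p.1‖
    · rw [← inner_uMap_left, hg p hp ha]
      exact hz.2 p hp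
    · have h1 := hz.2 p hp
      have h2 := abs_le.1 (abs_real_inner_le_norm p.1 z)
      have h3 := le_trans (le_abs_self _) (abs_real_inner_le_norm p.1 (uMap g z))
      rw [norm_uMap] at h3
      have h4 : ‖p.1‖ * ‖z‖ ≤ r * ‖p.1‖ := by
        rw [mul_comm]; exact mul_le_mul_of_nonneg_right hz.1 (norm_nonneg _)
      rcases lt_abs.1 (not_le.1 ha) with h | h <;> linarith
  have himg : uMap g '' ((transBody (-x) Q : Set (Cn n)) ∩ B) =
      (transBody (-x) Q : Set (Cn n)) ∩ B := by
    have h1 : ∀ p ∈ t, |inner ℝ p.1 x - m * p.2| ≤ r * ‖p.1‖ → uMap g p.1 = p.1 :=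
      fun p hp ha => hg _ (Submodule.subset_span ⟨p, hp, rfl, ha⟩)
    have h2 : ∀ p ∈ t, |inner ℝ p.1 x - m * p.2| ≤ r * ‖p.1‖ → uMap g⁻¹ p.1 = p.1 :=
      fun p hp ha => by
        conv_lhs => rw [← h1 p hp ha]
        simp
    refine Subset.antisymm (image_subset_iff.2 fun z hz => hfix g h2 z hz) fun z hz => ?_
    exact ⟨uMap g⁻¹ z, hfix g⁻¹ (by simpa using h1) z hz, by simp⟩
  have h5 := eVal_image_inter (hw g) (K := transBody (-x) Q) (M := B)
  rw [himg] at h5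
  apply hne
  rw [hS, hμ.eVal_translate]
  have h6 : (udet g ^ l - 1) * eVal μ ((transBody (-x) Q : Set (Cn n)) ∩ B) = 0 := by
    linear_combination -h5
  exact (mul_eq_zero.1 h6).resolve_left (sub_ne_zero.2 hgl)

theorem norm_kinInt_smul_le {l : ℤ} (hl : l ≠ 0) {μ : ConvexBody (Cn n) → ℂ} (hμ : TVal μ)
    (hw : HasWt l μ) {P B : ConvexBody (Cn n)} (hP : IsHPolytope P) {r : ℝ} (hr : 0 ≤ r)
    (hB : (B : Set (Cn n)) = closedBall 0 r) :
    ∃ C : ℝ, ∀ m : ℕ, 1 ≤ m → ‖kinInt μ ((m : ℝ) • P) B‖ ≤ C * (m : ℝ) ^ n := by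
  classical
  obtain ⟨t, ht⟩ := hP
  obtain ⟨R, hR, hPR⟩ := P.exists_bound
  obtain ⟨M, hM0, hM⟩ := hμ.exists_bound r
  have key : ∀ f : Fin n → ↥t, ∃ C : ℝ, 0 ≤ C ∧ (Submodule.span ℂ (range fun i => (f i).1.1) = ⊤ →
      ∀ m : ℕ, 1 ≤ m → volume {x : Cn n | ‖x‖ ≤ R * m + r ∧
        ∀ i, |inner ℝ (f i).1.1 x - m * (f i).1.2| ≤ r * ‖(f i).1.1‖} ≤
          ENNReal.ofReal (C * (m : ℝ) ^ n)) := fun f => by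
    by_cases h : Submodule.span ℂ (range fun i => (f i).1.1) = ⊤
    · obtain ⟨C, hC0, hC⟩ := exists_volume_slab_le (fun i => (f i).1.1) h (fun i => (f i).1.2) r R
        hr hR.le
      exact ⟨C, hC0, fun _ => hC⟩
    · exact ⟨0, le_rfl, fun h' => absurd h' h⟩
  choose C hC0 hC using key
  refine ⟨M * ∑ f, C f, fun m hm => ?_⟩
  set s : Set (Cn n) := ⋃ f ∈ (Finset.univ.filter fun f : Fin n → ↥t =>
    Submodule.span ℂ (range fun i => (f i).1.1) = ⊤), {x : Cn n | ‖x‖ ≤ R * m + r ∧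
        ∀ i, |inner ℝ (f i).1.1 x - m * (f i).1.2| ≤ r * ‖(f i).1.1‖} with hs
  have hsv : volume s ≤ ENNReal.ofReal ((∑ f, C f) * (m : ℝ) ^ n) := by
    refine (measure_biUnion_finset_le _ _).trans ?_
    rw [Finset.sum_mul, ENNReal.ofReal_sum_of_nonneg fun f _ => mul_nonneg (hC0 f) (by positivity)]
    refine (Finset.sum_le_sum fun f hf => hC f (Finset.mem_filter.1 hf).2 m hm).trans ?_
    exact Finset.sum_le_sum_of_subset (Finset.subset_univ _)
  have hm0 : (0 : ℝ) < m := by exact_mod_cast hm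
  have hQ : (((m : ℝ) • P : ConvexBody (Cn n)) : Set (Cn n)) =
      {y | ∀ p ∈ t, inner ℝ p.1 y ≤ m * p.2} := by
    ext y
    rw [ConvexBody.coe_smul, mem_smul_set_iff_inv_smul_mem₀ hm0.ne', ht]
    simp only [mem_ofPred_eq, inner_smul_right]
    refine forall₂_congr fun p _ => ?_
    rw [inv_mul_le_iff₀ hm0]
  have hzero : ∀ x, x ∉ s → eVal μ ((((m : ℝ) • P : ConvexBody (Cn n)) : Set (Cn n)) ∩
      transBody x B) = 0 := by
    intro x hx
    by_contra hne
    have hspan := span_active_eq_top hl hμ hw hQ hB hne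
    apply hx
    have hfr : Module.finrank ℂ (Submodule.span ℂ {a | ∃ p ∈ t, p.1 = a ∧
        |inner ℝ p.1 x - (m : ℝ) * p.2| ≤ r * ‖p.1‖}) = n := by
      rw [hspan, finrank_top, finrank_euclideanSpace, Fintype.card_fin]
    obtain ⟨f, hf, hfs⟩ : ∃ f : Fin n → Cn n, (∀ i, f i ∈ {a | ∃ p ∈ t, p.1 = a ∧
        |inner ℝ p.1 x - (m : ℝ) * p.2| ≤ r * ‖p.1‖}) ∧ Submodule.span ℂ (range f) = ⊤ := by
      obtain ⟨f, hf, hfs, -⟩ := Submodule.exists_fun_fin_finrank_span_eq ℂ {a | ∃ p ∈ t, p.1 = a ∧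
          |inner ℝ p.1 x - (m : ℝ) * p.2| ≤ r * ‖p.1‖}
      refine ⟨f ∘ finCongr hfr.symm, fun i => hf _, ?_⟩
      rw [(finCongr hfr.symm).surjective.range_comp, hfs, hspan]
    choose p hpt hpf hp using hf
    refine mem_iUnion₂.2 ⟨fun i => ⟨p i, hpt i⟩, ?_, ?_, fun i => hp i⟩
    · rw [Finset.mem_filter]
      refine ⟨Finset.mem_univ _, ?_⟩
      simp only [hpf]
      exact hfs
    · obtain ⟨y, hy, hyx⟩ : ((((m : ℝ) • P : ConvexBody (Cn n)) : Set (Cn n)) ∩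
          transBody x B).Nonempty := by
        by_contra h
        rw [not_nonempty_iff_eq_empty] at h
        exact hne (by rw [h, eVal_empty])
      rw [ConvexBody.coe_smul] at hy
      obtain ⟨y', hy', rfl⟩ := hy
      rw [SetLike.mem_coe, ← SetLike.mem_coe, coe_transBody, hB] at hyx
      obtain ⟨b, hb, hbx⟩ := hyx
      have h1 := mem_closedBall_zero_iff.1 (hPR hy')
      have h2 := mem_closedBall_zero_iff.1 hb
      have h3 : x = (m : ℝ) • y' - b := eq_sub_of_add_eq hbx
      rw [h3]
      refine (norm_sub_le _ _).trans (add_le_add ?_ h2)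
      rw [norm_smul, Real.norm_natCast, mul_comm]
      exact mul_le_mul_of_nonneg_right h1 hm0.le
  have hbd : ∀ x, ‖eVal μ ((((m : ℝ) • P : ConvexBody (Cn n)) : Set (Cn n)) ∩ transBody x B)‖ ≤ M :=
    fun x => by
      refine hM x _ (inter_subset_right.trans ?_)
      rw [coe_transBody, hB]
      rintro _ ⟨b, hb, rfl⟩
      rw [mem_closedBall, dist_eq_norm]
      simpa using hb
  have hfin : volume s < ⊤ := hsv.trans_lt ENNReal.ofReal_lt_top
  unfold kinInt
  rw [← setIntegral_eq_integral_of_forall_compl_eq_zero hzero]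
  refine (norm_setIntegral_le_of_norm_le_const hfin fun x _ => hbd x).trans ?_
  rw [mul_assoc]
  refine mul_le_mul_of_nonneg_left ?_ hM0
  exact ENNReal.toReal_le_of_le_ofReal
    (mul_nonneg (Finset.sum_nonneg fun f _ => hC0 f) (by positivity)) hsv

/-- The closed ball of radius `1` as a convex body. -/
def unitBall (n : ℕ) : ConvexBody (Cn n) :=
  ⟨closedBall 0 1, convex_closedBall _ _, isCompact_closedBall _ _, ⟨0, by simp⟩⟩

theorem coe_smul_unitBall {r : ℝ} (hr : 0 ≤ r) :
    ((r • unitBall n : ConvexBody (Cn n)) : Set (Cn n)) = closedBall 0 r := by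
  rw [ConvexBody.coe_smul]
  change r • closedBall (0 : Cn n) 1 = _
  rw [_root_.smul_closedBall _ _ zero_le_one, smul_zero, mul_one, Real.norm_of_nonneg hr]

theorem HasWt.coeff_kinInt_eq_zero {l : ℤ} (hl : l ≠ 0) {μ : ConvexBody (Cn n) → ℂ} (hμ : TVal μ)
    (hw : HasWt l μ) {P : ConvexBody (Cn n)} (hP : IsHPolytope P) {r : ℝ} (hr : 0 ≤ r)
    {k : ℕ} (hk : n < k) : (hpoly (fun K => kinInt μ K (r • unitBall n)) P).coeff k = 0 := by
  obtain ⟨C, hC⟩ := norm_kinInt_smul_le hl hμ hw hP hr (coe_smul_unitBall hr)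
  refine Polynomial.coeff_eq_zero_of_natDegree_lt (lt_of_le_of_lt ?_ hk)
  refine Polynomial.natDegree_le_of_growth _ n C fun m hm => ?_
  have := (hμ.kinInt_left (r • unitBall n)).eval_hpoly P (Nat.cast_nonneg (α := ℝ) m)
  rw [Complex.ofReal_natCast] at this
  rw [← this]
  exact hC m hm

theorem HasWt.coeff_eq_zero_of_gt {l : ℤ} (hl : l ≠ 0) {μ : ConvexBody (Cn n) → ℂ} (hμ : TVal μ)
    (hw : HasWt l μ) {k : ℕ} (hk : n < k) (K : ConvexBody (Cn n)) :
    (hpoly μ K).coeff k = 0 := by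
  have hpol : ∀ P : ConvexBody (Cn n), IsHPolytope P → (hpoly μ P).coeff k = 0 := by
    intro P hP
    have h1 : Tendsto (fun m : ℕ => ((m : ℂ) ^ Module.finrank ℝ (Cn n))⁻¹ *
        (hpoly (fun K => kinInt μ K ((m : ℝ) • unitBall n)) P).coeff k) atTop
        (𝓝 ((hpoly μ P).coeff k * ((volume (unitBall n : Set (Cn n))).toReal : ℂ))) := by
      simp only [hpoly_coeff, Finset.mul_sum, Finset.sum_mul]
      refine tendsto_finsetSum _ fun i _ => ?_
      rw [mul_right_comm]
      simp only [← mul_assoc]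
      exact (hμ.tendsto_kinInt ((i : ℝ) • P) (unitBall n)).mul_const _
    simp only [HasWt.coeff_kinInt_eq_zero hl hμ hw hP (Nat.cast_nonneg _) hk, mul_zero] at h1
    have h2 := tendsto_nhds_unique h1 tendsto_const_nhds
    refine (mul_eq_zero.1 h2).resolve_right ?_
    rw [Complex.ofReal_eq_zero, ← ne_eq, ENNReal.toReal_ne_zero]
    refine ⟨?_, (unitBall n).isCompact.measure_lt_top.ne⟩
    exact (measure_closedBall_pos volume (0 : Cn n) one_pos).ne'
  have hcl : IsClosed {K : ConvexBody (Cn n) | (hpoly μ K).coeff k = 0} :=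
    isClosed_eq (TVal.continuous_hpoly_coeff hμ.cont k) continuous_const
  exact hcl.closure_subset_iff.2 hpol (dense_isHPolytope K)

/-- A translation invariant continuous valuation of nonzero weight is homogeneous of degree `n`. -/
theorem HasWt.smul_eq {l : ℤ} (hl : l ≠ 0) {μ : ConvexBody (Cn n) → ℂ} (hμ : TVal μ)
    (hw : HasWt l μ) {t : ℝ} (ht : 0 ≤ t) (K : ConvexBody (Cn n)) :
    μ (t • K) = (t : ℂ) ^ n * μ K := by
  have h : hpoly μ K = Polynomial.monomial n ((hpoly μ K).coeff n) := by
    ext k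
    rw [Polynomial.coeff_monomial]
    rcases lt_trichotomy k n with h | rfl | h
    · rw [if_neg h.ne', HasWt.coeff_eq_zero_of_lt hl hμ hw h]
    · rw [if_pos rfl]
    · rw [if_neg h.ne, HasWt.coeff_eq_zero_of_gt hl hμ hw h]
  have h1 := hμ.eval_hpoly K zero_le_one
  rw [one_smul, h, Polynomial.eval_monomial] at h1
  rw [hμ.eval_hpoly K ht, h, Polynomial.eval_monomial, h1]
  simp [mul_comm]

end HighDegree

section CompactGroup

variable {G : Type*} [Group G] [TopologicalSpace G] [IsTopologicalGroup G] [CompactSpace G]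
  [MeasurableSpace G] [BorelSpace G]

theorem isMulRightInvariant_of_compactSpace (ν : Measure G) [ν.IsHaarMeasure]
    [IsProbabilityMeasure ν] : ν.IsMulRightInvariant := by
  refine ⟨fun g => ?_⟩
  have h : IsProbabilityMeasure (ν.map (· * g)) :=
    Measure.isProbabilityMeasure_map (measurable_mul_const g).aemeasurable
  exact Measure.isHaarMeasure_eq_of_isProbabilityMeasure _ _

theorem isInvInvariant_of_compactSpace (ν : Measure G) [ν.IsHaarMeasure]
    [IsProbabilityMeasure ν] : ν.IsInvInvariant := by
  have _ := isMulRightInvariant_of_compactSpace ν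
  have _ : IsProbabilityMeasure ν.inv :=
    Measure.isProbabilityMeasure_map measurable_inv.aemeasurable
  have h := Measure.isMulInvariant_eq_smul_of_compactSpace ν.inv ν
  have h1 := congrArg (fun m : Measure G => m univ) h
  simp only [measure_univ, Measure.smul_apply, ENNReal.smul_def, smul_eq_mul, mul_one] at h1
  refine ⟨?_⟩
  rw [h]
  have h2 : Measure.haarScalarFactor ν.inv ν = 1 := by exact_mod_cast h1.symm
  rw [h2, one_smul]

end CompactGroup

section SpecialUnitary

variable {n : ℕ}

instance : BorelSpace (Ugrp n) := ⟨rfl⟩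
instance : BorelSpace (SUgrp n) := ⟨rfl⟩

instance : CompactSpace (Ugrp n) := by
  refine isCompact_iff_compactSpace.1 ?_
  have h : IsCompact (X := Matrix (Fin n) (Fin n) ℂ)
      (Set.pi univ fun _ : Fin n => Set.pi univ fun _ : Fin n => closedBall (0 : ℂ) 1) :=
    isCompact_univ_pi fun _ => isCompact_univ_pi fun _ => isCompact_closedBall (0 : ℂ) 1
  refine h.of_isClosed_subset isClosed_unitary fun A hA i _ j _ => ?_
  rw [mem_closedBall_zero_iff]
  exact entry_norm_bound_of_unitary hA i j

theorem mem_SUgrp {g : Ugrp n} : g ∈ SUgrp n ↔ udet g = 1 := Iff.rfl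

instance : CompactSpace (SUgrp n) := by
  refine isCompact_iff_compactSpace.1 (IsClosed.isCompact (X := Ugrp n) ?_)
  exact (isClosed_eq continuous_udet continuous_const)

theorem udet_mul_inv_self (g : Ugrp n) : udet g * udet g⁻¹ = 1 := by
  rw [← udet_mul, mul_inv_cancel, udet_one]

theorem udet_ne_zero (g : Ugrp n) : udet g ≠ 0 := left_ne_zero_of_mul_eq_one (udet_mul_inv_self g)

instance : (SUgrp n).Normal := ⟨fun s hs g => by
  rw [mem_SUgrp] at *
  rw [udet_mul, udet_mul, hs, mul_one, udet_mul_inv_self]⟩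

theorem integral_conj_SUgrp (ν : Measure (SUgrp n)) [ν.IsHaarMeasure] [IsProbabilityMeasure ν]
    (g : Ugrp n) (f : SUgrp n → ℂ) :
    ∫ s, f (MulAut.conjNormal g s) ∂ν = ∫ s, f s ∂ν := by
  have hc : ∀ g : Ugrp n, Continuous (MulAut.conjNormal (H := SUgrp n) g) := fun g => by
    refine continuous_induced_rng.2 ?_
    have : Continuous fun s : SUgrp n => g * s * g⁻¹ := by fun_prop
    exact this.congr fun s => (MulAut.conjNormal_apply g s).symm
  have h : MeasurePreserving (MulAut.conjNormal (H := SUgrp n) g) ν ν :=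
    MonoidHom.measurePreserving (f := (MulAut.conjNormal (H := SUgrp n) g).toMonoidHom) (hc g)
      (MulAut.conjNormal g).surjective rfl
  refine h.integral_comp ?_ f
  have h2 : Continuous (MulAut.conjNormal (H := SUgrp n) g).symm := hc g⁻¹
  exact (Homeomorph.mk (MulAut.conjNormal (H := SUgrp n) g).toEquiv (hc g) h2).measurableEmbedding

end SpecialUnitary

section CompactAverage

variable {E : Type*} [NormedAddCommGroup E] [InnerProductSpace ℝ E]

theorem TVal.integral_of_bounded {X : Type*} [TopologicalSpace X] [MeasurableSpace X]
    [OpensMeasurableSpace X] {ν : Measure X} [IsFiniteMeasure ν] {f : X → ConvexBody E → ℂ}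
    (hf : ∀ x, TVal (f x)) (hc : ∀ K, Continuous fun x => f x K)
    (hb : ∀ R : ℝ, ∃ C : ℝ, ∀ K : ConvexBody E, (K : Set E) ⊆ closedBall 0 R → ∀ x, ‖f x K‖ ≤ C) :
    TVal fun K => ∫ x, f x K ∂ν := by
  refine TVal.integral (fun K => (hc K).aestronglyMeasurable) (fun R => ?_)
    (fun K => Eventually.of_forall fun x => (hf x).cont.continuousAt) (fun x => (hf x).val)
    (fun y K => ?_)
  · obtain ⟨C, hC⟩ := hb R
    exact ⟨fun _ => C, integrable_const _, hC⟩
  · simp only [(hf _).transBody]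

end CompactAverage

section Rotation

variable {n : ℕ}

/-- The image of a convex body under a unitary matrix. -/
def rot (g : Ugrp n) (K : ConvexBody (Cn n)) : ConvexBody (Cn n) := mapBody (uMap g) K

theorem rot_mul (g h : Ugrp n) (K : ConvexBody (Cn n)) : rot (g * h) K = rot g (rot h K) := by
  rw [rot, rot, rot, uMap_mul, mapBody_comp]

theorem rot_one (K : ConvexBody (Cn n)) : rot 1 K = K := by
  rw [rot, uMap_one, mapBody_id]

theorem rot_smul (g : Ugrp n) (t : ℝ) (K : ConvexBody (Cn n)) : rot g (t • K) = t • rot g K :=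
  mapBody_smul _ _ _

theorem coe_rot (g : Ugrp n) (K : ConvexBody (Cn n)) :
    (rot g K : Set (Cn n)) = uMap g '' (K : Set (Cn n)) := coe_mapBody _ _

theorem continuous_rot (K : ConvexBody (Cn n)) : Continuous fun g : Ugrp n => rot g K :=
  (continuous_mapBody_left K).comp continuous_uMap

theorem rot_subset_closedBall {K : ConvexBody (Cn n)} {R : ℝ} (hK : (K : Set (Cn n)) ⊆ closedBall 0 R)
    (g : Ugrp n) : (rot g K : Set (Cn n)) ⊆ closedBall 0 R := by
  rw [coe_rot]
  rintro _ ⟨y, hy, rfl⟩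
  rw [mem_closedBall_zero_iff, norm_uMap]
  exact mem_closedBall_zero_iff.1 (hK hy)

theorem volume_rot (g : Ugrp n) (K : ConvexBody (Cn n)) :
    volume (rot g K : Set (Cn n)) = volume (K : Set (Cn n)) := by
  have h := (uIso g).measurePreserving.measure_preimage_equiv (f := (uIso g).toMeasurableEquiv)
    (rot g K : Set (Cn n))
  rw [← h, coe_rot]
  exact congrArg volume (preimage_image_eq (K : Set (Cn n)) (uIso g).injective)

theorem TVal.comp_rot {μ : ConvexBody (Cn n) → ℂ} (hμ : TVal μ) (g : Ugrp n) :
    TVal fun K => μ (rot g K) := hμ.comp_mapBody _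

theorem HasWt.kinInt_rot {l : ℤ} {μ : ConvexBody (Cn n) → ℂ} (hw : HasWt l μ) (g : Ugrp n)
    (K L : ConvexBody (Cn n)) :
    kinInt μ (rot g K) (rot g L) = udet g ^ l * kinInt μ K L :=
  kinInt_map_isometry (uIso g) (fun _ => rfl) (hw g) K L

theorem HasWt.kinInt_smul {l : ℤ} (hl : l ≠ 0) {μ : ConvexBody (Cn n) → ℂ} (hμ : TVal μ)
    (hw : HasWt l μ) {t : ℝ} (ht : 0 < t) (K L : ConvexBody (Cn n)) :
    kinInt μ (t • K) (t • L) = (t : ℂ) ^ (3 * n) * kinInt μ K L := by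
  have h : (fun N => μ (t • N)) = fun N => (t : ℂ) ^ n * μ N := by
    ext N
    exact hw.smul_eq hl hμ ht.le N
  have h2 : kinInt (fun N => (t : ℂ) ^ n * μ N) K L = (t : ℂ) ^ n * kinInt μ K L := by
    unfold kinInt
    rw [← integral_const_mul]
    congr 1
    ext x
    have := eVal_image_inter (φ := fun N => (t : ℂ) ^ n * μ N) (μ := μ)
      (A := ContinuousLinearMap.id ℝ (Cn n)) (c := ((t : ℂ) ^ n)⁻¹)
      (fun N => by
        have : (t : ℂ) ^ n ≠ 0 := pow_ne_zero _ (Complex.ofReal_ne_zero.2 ht.ne')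
        rw [mapBody_id]; field_simp)
      (K := K) (M := transBody x L)
    have h0 : (t : ℂ) ^ n ≠ 0 := pow_ne_zero _ (Complex.ofReal_ne_zero.2 ht.ne')
    rw [show ⇑(ContinuousLinearMap.id ℝ (Cn n)) = id from rfl, image_id] at this
    rw [this]
    field_simp
  rw [_root_.kinInt_smul μ ht, h, h2, Cn.finrank_real]
  ring

end Rotation

section SpecialUnitaryAverage

variable {n : ℕ}

/-- The average of the kinematic integral over the special unitary group. -/
def suInt (ν : Measure (SUgrp n)) (μ : ConvexBody (Cn n) → ℂ) (K L : ConvexBody (Cn n)) : ℂ :=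
  ∫ s, kinInt μ K (rot s L) ∂ν

variable {ν : Measure (SUgrp n)} {l : ℤ} {μ : ConvexBody (Cn n) → ℂ}

theorem TVal.continuous_kinInt_rot (hμ : TVal μ) (K L : ConvexBody (Cn n)) :
    Continuous fun s : SUgrp n => kinInt μ K (rot s L) :=
  (hμ.kinInt_right K).cont.comp ((continuous_rot L).comp continuous_subtype_val)

theorem TVal.norm_suInt_le [IsProbabilityMeasure ν] (hμ : TVal μ) (R : ℝ) :
    ∃ C : ℝ, ∀ K L : ConvexBody (Cn n), (K : Set (Cn n)) ⊆ closedBall 0 R →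
      (L : Set (Cn n)) ⊆ closedBall 0 R → ‖suInt ν μ K L‖ ≤ C := by
  obtain ⟨C, -, hC⟩ := hμ.norm_kinInt_le R
  refine ⟨C, fun K L hK hL => ?_⟩
  unfold suInt
  have := norm_integral_le_of_norm_le_const (μ := ν) (Eventually.of_forall fun s : SUgrp n =>
    hC K (rot s L) hK (rot_subset_closedBall hL _))
  simpa using this

theorem TVal.suInt_left [IsProbabilityMeasure ν] (hμ : TVal μ) (L : ConvexBody (Cn n)) :
    TVal fun K => suInt ν μ K L := by
  refine TVal.integral_of_bounded (fun s => hμ.kinInt_left _)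
    (fun K => hμ.continuous_kinInt_rot K L) fun R => ?_
  obtain ⟨R', -, hL⟩ := L.exists_bound
  obtain ⟨C, -, hC⟩ := hμ.norm_kinInt_le (max R R')
  exact ⟨C, fun K hK s => hC _ _ (hK.trans (closedBall_subset_closedBall (le_max_left _ _)))
    ((rot_subset_closedBall hL _).trans (closedBall_subset_closedBall (le_max_right _ _)))⟩

theorem suInt_comm [ν.IsHaarMeasure] [IsProbabilityMeasure ν] (hμ : TVal μ) (hw : HasWt l μ)
    (K L : ConvexBody (Cn n)) : suInt ν μ K L = suInt ν μ L K := by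
  have _ := isInvInvariant_of_compactSpace ν
  unfold suInt
  rw [← integral_inv_eq_self]
  congr 1
  ext s
  have h := hw.kinInt_rot (s : Ugrp n) K (rot ((s⁻¹ : SUgrp n) : Ugrp n) L)
  rw [mem_SUgrp.1 s.2, one_zpow, one_mul] at h
  rw [← h, ← rot_mul, ← Subgroup.coe_mul, mul_inv_cancel, Subgroup.coe_one, rot_one, kinInt_comm hμ]

theorem TVal.suInt_right [ν.IsHaarMeasure] [IsProbabilityMeasure ν] (hμ : TVal μ) (hw : HasWt l μ)
    (K : ConvexBody (Cn n)) : TVal (suInt ν μ K) := by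
  have : suInt ν μ K = fun L => suInt ν μ L K := funext fun L => suInt_comm hμ hw K L
  rw [this]
  exact hμ.suInt_left K

theorem suInt_rot_SU_right [ν.IsHaarMeasure] [IsProbabilityMeasure ν] (μ : ConvexBody (Cn n) → ℂ)
    (K L : ConvexBody (Cn n)) (s : SUgrp n) : suInt ν μ K (rot s L) = suInt ν μ K L := by
  have _ := isMulRightInvariant_of_compactSpace ν
  unfold suInt
  rw [← integral_mul_right_eq_self (fun a : SUgrp n => kinInt μ K (rot a L)) s]
  simp only [Subgroup.coe_mul, rot_mul]

theorem suInt_rot_left_eq [ν.IsHaarMeasure] [IsProbabilityMeasure ν] (hμ : TVal μ)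
    (hw : HasWt l μ) (K L : ConvexBody (Cn n)) {a b : Ugrp n} (hab : udet a = udet b) :
    suInt ν μ (rot a K) L = suInt ν μ (rot b K) L := by
  have hs : a * b⁻¹ ∈ SUgrp n := by
    rw [mem_SUgrp, udet_mul, hab, udet_mul_inv_self]
  have h := suInt_rot_SU_right (ν := ν) μ L (rot b K) ⟨a * b⁻¹, hs⟩
  simp only [← rot_mul, inv_mul_cancel_right] at h
  rw [suInt_comm hμ hw, h, suInt_comm hμ hw]

theorem suInt_rot_rot [ν.IsHaarMeasure] [IsProbabilityMeasure ν] (hw : HasWt l μ)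
    (K L : ConvexBody (Cn n)) (g : Ugrp n) :
    suInt ν μ (rot g K) (rot g L) = udet g ^ l * suInt ν μ K L := by
  unfold suInt
  rw [← integral_conj_SUgrp ν g, ← integral_const_mul]
  congr 1
  ext s
  rw [← hw.kinInt_rot, ← rot_mul, ← rot_mul, MulAut.conjNormal_apply, inv_mul_cancel_right]

theorem suInt_smul (hl : l ≠ 0) (hμ : TVal μ) (hw : HasWt l μ) {t : ℝ} (ht : 0 < t)
    (K L : ConvexBody (Cn n)) :
    suInt ν μ (t • K) (t • L) = (t : ℂ) ^ (3 * n) * suInt ν μ K L := by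
  unfold suInt
  simp only [rot_smul, hw.kinInt_smul hl hμ ht]
  rw [integral_const_mul]

theorem TVal.norm_inv_mul_suInt_smul_le [IsProbabilityMeasure ν] (hμ : TVal μ) (R : ℝ) :
    ∃ C : ℝ, ∀ K L : ConvexBody (Cn n), (K : Set (Cn n)) ⊆ closedBall 0 R →
      (L : Set (Cn n)) ⊆ closedBall 0 R → ∀ m : ℕ, 1 ≤ m →
        ‖((m : ℂ) ^ (2 * n))⁻¹ * suInt ν μ K ((m : ℝ) • L)‖ ≤ C := by
  obtain ⟨C, hC⟩ := hμ.norm_inv_mul_kinInt_smul_le R R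
  rw [Cn.finrank_real] at hC
  refine ⟨C, fun K L hK hL m hm => ?_⟩
  rw [suInt, ← integral_const_mul]
  simp only [rot_smul]
  have := norm_integral_le_of_norm_le_const (μ := ν) (Eventually.of_forall fun s : SUgrp n =>
    hC K (rot s L) hK (rot_subset_closedBall hL _) m hm)
  simpa using this

theorem TVal.tendsto_suInt [IsProbabilityMeasure ν] (hμ : TVal μ) (K L : ConvexBody (Cn n)) :
    Tendsto (fun m : ℕ => ((m : ℂ) ^ (2 * n))⁻¹ * suInt ν μ K ((m : ℝ) • L)) atTop
      (𝓝 (μ K * volC L)) := by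
  obtain ⟨R, -, hK⟩ := K.exists_bound
  obtain ⟨R', -, hL⟩ := L.exists_bound
  obtain ⟨C, hC⟩ := hμ.norm_inv_mul_kinInt_smul_le R R'
  rw [Cn.finrank_real] at hC
  have hlim : μ K * volC L = ∫ s : SUgrp n, μ K * volC (rot s L) ∂ν := by
    simp only [volC, volume_rot, integral_const, probReal_univ, one_smul]
  rw [hlim]
  simp only [suInt, ← integral_const_mul, rot_smul]
  refine tendsto_integral_filter_of_dominated_convergence (fun _ => C) ?_ ?_ (integrable_const _) ?_
  · refine Eventually.of_forall fun m => Continuous.aestronglyMeasurable ?_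
    simp only [← rot_smul]
    exact continuous_const.mul (hμ.continuous_kinInt_rot K _)
  · filter_upwards [eventually_ge_atTop 1] with m hm
    exact Eventually.of_forall fun s => hC K (rot s L) hK (rot_subset_closedBall hL _) m hm
  · refine Eventually.of_forall fun s => ?_
    have := hμ.tendsto_kinInt K (rot s L)
    rwa [Cn.finrank_real] at this

end SpecialUnitaryAverage

section FourierCoefficients

variable {n : ℕ}

theorem exists_toCircle_eq_udet (g : Ugrp n) : ∃ φ : UnitAddCircle, (φ.toCircle : ℂ) = udet g := by
  have h : ‖udet g‖ = 1 := CStarRing.norm_of_mem_unitary (Matrix.det_of_mem_unitary g.2)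
  obtain ⟨φ, hφ⟩ := (AddCircle.homeomorphCircle (T := 1) one_ne_zero).surjective
    ⟨udet g, mem_sphere_zero_iff_norm.2 h⟩
  refine ⟨φ, ?_⟩
  rw [AddCircle.homeomorphCircle_apply] at hφ
  rw [hφ]

variable [NeZero n]

/-- A circle in the unitary group on which the determinant is injective. -/
def tor (θ : UnitAddCircle) : Ugrp n :=
  ⟨Matrix.diagonal fun i => if i = 0 then (θ.toCircle : ℂ) else 1, by
    rw [Matrix.mem_unitaryGroup_iff, Matrix.star_eq_conjTranspose, Matrix.diagonal_conjTranspose,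
      Matrix.diagonal_mul_diagonal, ← Matrix.diagonal_one]
    congr 1
    ext i
    by_cases h : i = 0 <;> simp [h, Complex.mul_conj]⟩

theorem continuous_tor : Continuous (tor (n := n)) := by
  refine continuous_induced_rng.2 (Continuous.matrix_diagonal (continuous_pi fun i => ?_))
  by_cases h : i = 0
  · simp only [h, if_true]
    exact continuous_subtype_val.comp AddCircle.continuous_toCircle
  · simpa only [h, if_false] using continuous_const

theorem udet_tor (θ : UnitAddCircle) : udet (tor (n := n) θ) = θ.toCircle := by
  simp [udet, tor]

variable {ν : Measure (SUgrp n)} {l : ℤ} {μ : ConvexBody (Cn n) → ℂ}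

/-- The Fourier coefficients of the average over `SU(n)` along a circle in `U(n)`. -/
def suCoeff (ν : Measure (SUgrp n)) (μ : ConvexBody (Cn n) → ℂ) (j : ℤ) (K L : ConvexBody (Cn n)) :
    ℂ :=
  fourierCoeff (fun θ : UnitAddCircle => suInt ν μ (rot (tor θ) K) L) j

theorem fourier_eq_toCircle_zpow (j : ℤ) (θ : UnitAddCircle) :
    fourier j θ = (θ.toCircle : ℂ) ^ j := by
  rw [fourier_apply, AddCircle.toCircle_zsmul, Circle.coe_zpow]

theorem suCoeff_rot_left [ν.IsHaarMeasure] [IsProbabilityMeasure ν] (hμ : TVal μ) (hw : HasWt l μ)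
    (j : ℤ) (L : ConvexBody (Cn n)) : HasWt j fun K => suCoeff ν μ j K L := by
  intro g K
  obtain ⟨φ, hφ⟩ := exists_toCircle_eq_udet g
  change suCoeff ν μ j (rot g K) L = _
  simp only [suCoeff, fourierCoeff]
  rw [← integral_add_right_eq_self (μ := AddCircle.haarAddCircle) (fun θ : AddCircle (1 : ℝ) =>
    fourier (-j) θ • suInt ν μ (rot (tor θ) K) L) φ, ← integral_const_mul]
  congr 1
  ext θ
  rw [← rot_mul, suInt_rot_left_eq hμ hw K L (b := tor (θ + φ)), smul_eq_mul, smul_eq_mul,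
    fourier_eq_toCircle_zpow, fourier_eq_toCircle_zpow, AddCircle.toCircle_add, Circle.coe_mul,
    mul_zpow, hφ, zpow_neg (udet g)]
  · field_simp [udet_ne_zero g]
  · rw [udet_mul, udet_tor, udet_tor, AddCircle.toCircle_add, Circle.coe_mul, hφ]

theorem suCoeff_rot_rot [ν.IsHaarMeasure] [IsProbabilityMeasure ν] (hμ : TVal μ) (hw : HasWt l μ)
    (j : ℤ) (K L : ConvexBody (Cn n)) (g : Ugrp n) :
    suCoeff ν μ j (rot g K) (rot g L) = udet g ^ l * suCoeff ν μ j K L := by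
  simp only [suCoeff, fourierCoeff]
  rw [← integral_const_mul]
  congr 1
  ext θ
  rw [← rot_mul, suInt_rot_left_eq hμ hw K (rot g L) (b := g * tor θ)
    (by rw [udet_mul, udet_mul, mul_comm]), rot_mul, suInt_rot_rot hw, smul_eq_mul, smul_eq_mul]
  ring

theorem suCoeff_rot_right [ν.IsHaarMeasure] [IsProbabilityMeasure ν] (hμ : TVal μ)
    (hw : HasWt l μ) (j : ℤ) (K : ConvexBody (Cn n)) : HasWt (l - j) (suCoeff ν μ j K) := by
  intro g L
  have h1 := suCoeff_rot_left (ν := ν) hμ hw j (rot g L) g K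
  have h2 := suCoeff_rot_rot (ν := ν) hμ hw j K L g
  have h3 : udet g ^ j * suCoeff ν μ j K (rot g L) = udet g ^ l * suCoeff ν μ j K L :=
    h1.symm.trans h2
  change suCoeff ν μ j K (rot g L) = _
  rw [zpow_sub₀ (udet_ne_zero g), div_mul_eq_mul_div, ← h3,
    mul_div_cancel_left₀ _ (zpow_ne_zero _ (udet_ne_zero g))]

theorem continuous_suInt_rot_tor [IsProbabilityMeasure ν] (hμ : TVal μ) (K L : ConvexBody (Cn n)) :
    Continuous fun θ : UnitAddCircle => suInt ν μ (rot (tor θ) K) L :=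
  (hμ.suInt_left L).cont.comp ((continuous_rot K).comp continuous_tor)

theorem TVal.suCoeff_left [IsProbabilityMeasure ν] (hμ : TVal μ) (j : ℤ) (L : ConvexBody (Cn n)) :
    TVal fun K => suCoeff ν μ j K L := by
  refine TVal.integral_of_bounded
    (fun θ => by
      simpa only [smul_eq_mul, mul_comm] using
        ((hμ.suInt_left (ν := ν) L).comp_rot (tor θ)).mul_const (fourier (-j) θ))
    (fun K => (map_continuous _).mul (continuous_suInt_rot_tor hμ K L)) fun R => ?_
  obtain ⟨R', -, hL⟩ := L.exists_bound
  obtain ⟨C, hC⟩ := hμ.norm_suInt_le (ν := ν) (max R R')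
  refine ⟨C, fun K hK θ => ?_⟩
  rw [smul_eq_mul, norm_mul, fourier_eq_toCircle_zpow, norm_zpow, Circle.norm_coe, one_zpow, one_mul]
  exact hC _ _ (rot_subset_closedBall (hK.trans (closedBall_subset_closedBall (le_max_left _ _))) _)
    (hL.trans (closedBall_subset_closedBall (le_max_right _ _)))

theorem TVal.suCoeff_right [ν.IsHaarMeasure] [IsProbabilityMeasure ν] (hμ : TVal μ)
    (hw : HasWt l μ) (j : ℤ) (K : ConvexBody (Cn n)) : TVal (suCoeff ν μ j K) := by
  refine TVal.integral_of_bounded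
    (fun θ => by
      simpa only [smul_eq_mul, mul_comm] using
        (hμ.suInt_right (ν := ν) hw (rot (tor θ) K)).mul_const (fourier (-j) θ))
    (fun L => (map_continuous _).mul (continuous_suInt_rot_tor hμ K L)) fun R => ?_
  obtain ⟨R', -, hK⟩ := K.exists_bound
  obtain ⟨C, hC⟩ := hμ.norm_suInt_le (ν := ν) (max R R')
  refine ⟨C, fun L hL θ => ?_⟩
  rw [smul_eq_mul, norm_mul, fourier_eq_toCircle_zpow, norm_zpow, Circle.norm_coe, one_zpow, one_mul]
  exact hC _ _ (rot_subset_closedBall (hK.trans (closedBall_subset_closedBall (le_max_right _ _))) _)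
    (hL.trans (closedBall_subset_closedBall (le_max_left _ _)))

theorem suCoeff_smul (hl : l ≠ 0) (hμ : TVal μ) (hw : HasWt l μ) (j : ℤ) {t : ℝ} (ht : 0 < t)
    (K L : ConvexBody (Cn n)) :
    suCoeff ν μ j (t • K) (t • L) = (t : ℂ) ^ (3 * n) * suCoeff ν μ j K L := by
  unfold suCoeff
  simp only [rot_smul, suInt_smul hl hμ hw ht]
  exact fourierCoeff.const_mul _ _ _

theorem suCoeff_eq_zero [ν.IsHaarMeasure] [IsProbabilityMeasure ν] (hl : l ≠ 0) (hμ : TVal μ)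
    (hw : HasWt l μ) {j : ℤ} (hj : j ≠ 0) (hjl : j ≠ l) (K L : ConvexBody (Cn n)) :
    suCoeff ν μ j K L = 0 := by
  have h := suCoeff_smul (ν := ν) hl hμ hw j two_pos K L
  have h1 := (suCoeff_rot_left (ν := ν) hμ hw j ((2 : ℝ) • L)).smul_eq hj (hμ.suCoeff_left j _)
    zero_le_two K
  have h2 := (suCoeff_rot_right (ν := ν) hμ hw j K).smul_eq (sub_ne_zero.2 hjl.symm)
    (hμ.suCoeff_right hw j K) zero_le_two L
  rw [h1, h2] at h
  have hn : (2 : ℂ) ^ n ≠ 1 := by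
    exact_mod_cast (Nat.one_lt_two_pow (NeZero.ne n)).ne'
  have h3 : (2 : ℂ) ^ n * 2 ^ n * ((2 : ℂ) ^ n - 1) * suCoeff ν μ j K L = 0 := by
    push_cast at h
    linear_combination -h
  simpa [sub_ne_zero.2 hn] using h3

theorem suCoeff_smul_right [ν.IsHaarMeasure] [IsProbabilityMeasure ν] (hl : l ≠ 0) (hμ : TVal μ)
    (hw : HasWt l μ) {t : ℝ} (ht : 0 < t) (K L : ConvexBody (Cn n)) :
    suCoeff ν μ l K (t • L) = (t : ℂ) ^ (2 * n) * suCoeff ν μ l K L := by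
  have h := suCoeff_smul (ν := ν) hl hμ hw l ht K L
  have h1 := (suCoeff_rot_left (ν := ν) hμ hw l (t • L)).smul_eq hl (hμ.suCoeff_left l _) ht.le K
  rw [h1] at h
  have ht' : (t : ℂ) ^ n ≠ 0 := pow_ne_zero _ (by exact_mod_cast ht.ne')
  refine mul_left_cancel₀ ht' (h.trans ?_)
  ring

theorem suCoeff_smul_left [ν.IsHaarMeasure] [IsProbabilityMeasure ν] (hl : l ≠ 0) (hμ : TVal μ)
    (hw : HasWt l μ) {t : ℝ} (ht : 0 < t) (K L : ConvexBody (Cn n)) :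
    suCoeff ν μ 0 (t • K) L = (t : ℂ) ^ (2 * n) * suCoeff ν μ 0 K L := by
  have h := suCoeff_smul (ν := ν) hl hμ hw 0 ht K L
  have h1 := (suCoeff_rot_right (ν := ν) hμ hw 0 (t • K)).smul_eq (by simpa using hl)
    (hμ.suCoeff_right hw 0 _) ht.le L
  rw [h1] at h
  have ht' : (t : ℂ) ^ n ≠ 0 := pow_ne_zero _ (by exact_mod_cast ht.ne')
  refine mul_left_cancel₀ ht' (h.trans ?_)
  ring

theorem tendsto_fourierCoeff_of_bounded {f : ℕ → UnitAddCircle → ℂ} {F : UnitAddCircle → ℂ}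
    (hc : ∀ m, Continuous (f m)) {C : ℝ} (hC : ∀ m, 1 ≤ m → ∀ θ, ‖f m θ‖ ≤ C)
    (hF : ∀ θ, Tendsto (fun m => f m θ) atTop (𝓝 (F θ))) (j : ℤ) :
    Tendsto (fun m => fourierCoeff (f m) j) atTop (𝓝 (fourierCoeff F j)) := by
  refine tendsto_integral_filter_of_dominated_convergence (fun _ => C)
    (Eventually.of_forall fun m => ((map_continuous _).mul (hc m)).aestronglyMeasurable) ?_
    (integrable_const _) (Eventually.of_forall fun θ => (hF θ).const_smul _)
  filter_upwards [eventually_ge_atTop 1] with m hm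
  refine Eventually.of_forall fun θ => ?_
  rw [smul_eq_mul, norm_mul, fourier_eq_toCircle_zpow, norm_zpow, Circle.norm_coe, one_zpow, one_mul]
  exact hC m hm θ

theorem suCoeff_weight [ν.IsHaarMeasure] [IsProbabilityMeasure ν] (hl : l ≠ 0) (hμ : TVal μ)
    (hw : HasWt l μ) (K L : ConvexBody (Cn n)) : suCoeff ν μ l K L = μ K * volC L := by
  obtain ⟨R, -, hK⟩ := K.exists_bound
  obtain ⟨R', -, hL⟩ := L.exists_bound
  obtain ⟨C, hC⟩ := hμ.norm_inv_mul_suInt_smul_le (ν := ν) (max R R')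
  have h := tendsto_fourierCoeff_of_bounded (f := fun (m : ℕ) θ =>
      ((m : ℂ) ^ (2 * n))⁻¹ * suInt ν μ (rot (tor θ) K) ((m : ℝ) • L))
    (fun m => continuous_const.mul (continuous_suInt_rot_tor hμ K _))
    (fun m hm θ => hC _ _
      (rot_subset_closedBall (hK.trans (closedBall_subset_closedBall (le_max_left _ _))) _)
      (hL.trans (closedBall_subset_closedBall (le_max_right _ _))) m hm)
    (fun θ => hμ.tendsto_suInt _ L) l
  have hlim : fourierCoeff (fun θ : UnitAddCircle => μ (rot (tor θ) K) * volC L) l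
      = μ K * volC L := by
    have : ∀ θ : UnitAddCircle, fourier (-l) θ • (μ (rot (tor θ) K) * volC L) = μ K * volC L := by
      intro θ
      rw [rot, hw, udet_tor, fourier_eq_toCircle_zpow, smul_eq_mul, zpow_neg]
      field_simp [Circle.coe_ne_zero]
    unfold fourierCoeff
    simp only [this, integral_const, probReal_univ, one_smul]
  rw [hlim] at h
  refine tendsto_nhds_unique (tendsto_const_nhds.congr' ?_) h
  filter_upwards [eventually_ge_atTop 1] with m hm
  have hm' : (0 : ℝ) < m := by exact_mod_cast hm
  have hm0 : (m : ℂ) ≠ 0 := by exact_mod_cast hm'.ne'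
  rw [fourierCoeff.const_mul]
  change _ = _ * suCoeff ν μ l K ((m : ℝ) • L)
  rw [suCoeff_smul_right hl hμ hw hm', Complex.ofReal_natCast, inv_mul_cancel_left₀ (pow_ne_zero _ hm0)]

theorem suCoeff_zero [ν.IsHaarMeasure] [IsProbabilityMeasure ν] (hl : l ≠ 0) (hμ : TVal μ)
    (hw : HasWt l μ) (K L : ConvexBody (Cn n)) : suCoeff ν μ 0 K L = volC K * μ L := by
  obtain ⟨R, -, hK⟩ := K.exists_bound
  obtain ⟨R', -, hL⟩ := L.exists_bound
  obtain ⟨C, hC⟩ := hμ.norm_inv_mul_suInt_smul_le (ν := ν) (max R R')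
  have h := tendsto_fourierCoeff_of_bounded (f := fun (m : ℕ) θ =>
      ((m : ℂ) ^ (2 * n))⁻¹ * suInt ν μ (rot (tor θ) ((m : ℝ) • K)) L)
    (F := fun θ => μ L * volC (rot (tor θ) K)) (C := C)
    (fun m => continuous_const.mul (continuous_suInt_rot_tor hμ _ L))
    (fun m hm θ => by
      rw [suInt_comm hμ hw, rot_smul]
      exact hC _ _ (hL.trans (closedBall_subset_closedBall (le_max_right _ _)))
        (rot_subset_closedBall (hK.trans (closedBall_subset_closedBall (le_max_left _ _))) _) m hm)
    (fun θ => by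
      simp only [suInt_comm hμ hw _ L, rot_smul]
      exact hμ.tendsto_suInt L _) 0
  have hlim : fourierCoeff (fun θ : UnitAddCircle => μ L * volC (rot (tor θ) K)) 0
      = volC K * μ L := by
    unfold fourierCoeff
    simp only [volC, volume_rot, neg_zero, fourier_zero, integral_const, probReal_univ, one_smul,
      mul_comm]
  rw [hlim] at h
  refine tendsto_nhds_unique (tendsto_const_nhds.congr' ?_) h
  filter_upwards [eventually_ge_atTop 1] with m hm
  have hm' : (0 : ℝ) < m := by exact_mod_cast hm
  have hm0 : (m : ℂ) ≠ 0 := by exact_mod_cast hm'.ne'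
  rw [fourierCoeff.const_mul]
  change _ = _ * suCoeff ν μ 0 ((m : ℝ) • K) L
  rw [suCoeff_smul_left hl hμ hw hm', Complex.ofReal_natCast, inv_mul_cancel_left₀ (pow_ne_zero _ hm0)]

theorem suInt_eq [ν.IsHaarMeasure] [IsProbabilityMeasure ν] (hl : l ≠ 0) (hμ : TVal μ)
    (hw : HasWt l μ) (K L : ConvexBody (Cn n)) :
    suInt ν μ K L = μ K * volC L + volC K * μ L := by
  let f : C(UnitAddCircle, ℂ) := ⟨_, continuous_suInt_rot_tor (ν := ν) hμ K L⟩
  have hf : ∀ j ∉ ({l, 0} : Finset ℤ), fourierCoeff f j = 0 := by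
    intro j hj
    rw [Finset.mem_insert, Finset.mem_singleton, not_or] at hj
    exact suCoeff_eq_zero hl hμ hw hj.2 hj.1 K L
  have h1 := has_pointwise_sum_fourier_series_of_summable
    (summable_of_ne_finset_zero hf) (0 : UnitAddCircle)
  have h2 := hasSum_sum_of_ne_finset_zero (L := SummationFilter.unconditional ℤ)
    (f := fun j => fourierCoeff f j • fourier j (0 : UnitAddCircle))
    (s := {l, 0}) (fun j hj => by rw [hf j hj, zero_smul])
  have h3 := h1.unique h2
  rw [Finset.sum_pair hl] at h3
  simp only [fourier_eval_zero, smul_eq_mul, mul_one] at h3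
  have h4 : f 0 = suInt ν μ K L := by
    change suInt ν μ (rot (tor 0) K) L = _
    rw [suInt_rot_left_eq hμ hw K L (b := 1), rot_one]
    rw [udet_tor, udet_one, AddCircle.toCircle_zero, Circle.coe_one]
  rw [← h4, h3]
  exact congrArg₂ (· + ·) (suCoeff_weight hl hμ hw K L) (suCoeff_zero hl hμ hw K L)

end FourierCoefficients

end

/-- Kinematic formula for a valuation `μ` of nonzero weight `l` : integrating
`μ(K ∩ (gL + x))` over `SU(n)` (Haar probability measure) and `x ∈ ℂⁿ` gives
`μ(K)·vol(L) + vol(K)·μ(L)`. -/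
theorem kinematic_formula_weight (n : ℕ) (hn : 2 ≤ n) (l : ℤ) (hl : l ≠ 0)
    (μ : ConvexBody (Cn n) → ℂ)
    (h1 : IsValuation μ) (h2 : Continuous μ) (h3 : TranslationInvariant μ)
    (h4 : HasWeight l μ)
    (ν : Measure ↥(SUgrp n)) (hν : ν.IsHaarMeasure) (hνP : IsProbabilityMeasure ν)
    (K L : ConvexBody (Cn n)) :
    (∫ g, (∫ x, extendVal μ
        ((K : Set (Cn n)) ∩ ((fun y => actSU g y + x) '' (L : Set (Cn n))))) ∂ν)
      = μ K * volC L + volC K * μ L := by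
  have hμ : TVal μ := ⟨h1, h2, h3⟩
  have hw : HasWt l μ := fun g K => h4 g g.2 K _ rfl
  have _ : NeZero n := ⟨by lia⟩
  rw [← suInt_eq (ν := ν) hl hμ hw K L]
  have h (g : SUgrp n) (x : Cn n) : (fun y => actSU g y + x) '' (L : Set (Cn n)) =
      (transBody x (rot (g : Ugrp n) L) : Set (Cn n)) := by
    rw [coe_transBody, coe_rot, Set.image_image]
    exact Set.image_congr fun y _ => add_comm _ _
  simp only [h]
  rfl

end
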